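/- For every positive integer k there exists ε > 0 such that for infinitely many integers n there exists a 3-uniform hypergraph H on 3n vertices with minimum codegree δ_co(H) ≥ εn that contains no copy of any 3-graph F with at most k vertices and π_⋅(F) > 0. Consequently, every 3-graph F with π_⋅(F) > 0 satisfies π_co(F) > 0. -/

import Mathlib

open Filter

/-- A 3-uniform hypergraph on vertex type `V`: a set of edges, each of size 3. -/
structure H3 (V : Type) [DecidableEq V] where
  edges : Finset (Finset V)
  card3 : ∀ e ∈ edges, e.card = 3

namespace H3

variable {V W : Type} [DecidableEq V] [DecidableEq W]

/-- `H` contains a copy of `F`: an injection of vertices mapping edges to edges. -/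
def contains (H : H3 V) (F : H3 W) : Prop :=
  ∃ f : W → V, Function.Injective f ∧ ∀ e ∈ F.edges, e.image f ∈ H.edges

/-- `H` is `F`-free. -/
def free (H : H3 V) (F : H3 W) : Prop := ¬ H.contains F

/-- The codegree of a pair of vertices: the number of edges containing both. -/
def codeg (H : H3 V) (u v : V) : ℕ :=
  (H.edges.filter fun e => u ∈ e ∧ v ∈ e).card

/-- The minimum codegree: the minimum of `codeg` over pairs of distinct vertices. -/
noncomputable def minCodeg [Fintype V] (H : H3 V) : ℕ :=
  sInf {d | ∃ u v : V, u ≠ v ∧ H.codeg u v = d}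

/-- `H` is uniformly `(d, η)`-dense: every vertex subset `U` spans at least
`d * C(|U|,3) - η * n^3` edges. -/
def uniformlyDense [Fintype V] (H : H3 V) (d η : ℝ) : Prop :=
  ∀ U : Finset V,
    d * (U.card.choose 3 : ℝ) - η * (Fintype.card V : ℝ) ^ 3
      ≤ ((H.edges.filter fun e => e ⊆ U).card : ℝ)

end H3

/-- The uniform Turán density `π_⋅(F)`. -/
noncomputable def uniformTuranDensity {W : Type} [DecidableEq W] (F : H3 W) : ℝ :=
  sSup {d : ℝ | 0 ≤ d ∧ d ≤ 1 ∧
    ∀ η : ℝ, 0 < η → ∀ n₀ : ℕ, ∃ n, n₀ ≤ n ∧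
      ∃ H : H3 (Fin n), H.free F ∧ H.uniformlyDense d η}

/-- The codegree Turán number `ex_co(n, F)`: the maximum minimum codegree of an
`n`-vertex `F`-free 3-graph. -/
noncomputable def exCodeg {W : Type} [DecidableEq W] (n : ℕ) (F : H3 W) : ℕ :=
  sSup {d | ∃ H : H3 (Fin n), H.free F ∧ H.minCodeg = d}

/-- The codegree Turán density `π_co(F) = lim_n ex_co(n,F)/n` (the limit exists,
so it coincides with the limsup). -/
noncomputable def codegTuranDensity {W : Type} [DecidableEq W] (F : H3 W) : ℝ :=
  Filter.limsup (fun n : ℕ => (exCodeg n F : ℝ) / n) Filter.atTop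

namespace UniformTuran

theorem ramsey (r : ℕ) : ∀ a b : ℕ, ∃ R : ℕ, ∀ S : Finset ℕ, R ≤ S.card → ∀ P : Finset ℕ → Prop,
    (∃ A ⊆ S, A.card = a ∧ ∀ e ⊆ A, e.card = r → P e) ∨
    (∃ B ⊆ S, B.card = b ∧ ∀ e ⊆ B, e.card = r → ¬ P e) := by
  induction r with
  | zero =>
    intro a b
    refine ⟨a + b, fun S hS P => ?_⟩
    by_cases h : P ∅
    · left
      obtain ⟨A, hA, hc⟩ := Finset.exists_subset_card_eq (show a ≤ S.card by omega)
      refine ⟨A, hA, hc, fun e _ he0 => ?_⟩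
      rw [Finset.card_eq_zero.mp he0]; exact h
    · right
      obtain ⟨A, hA, hc⟩ := Finset.exists_subset_card_eq (show b ≤ S.card by omega)
      refine ⟨A, hA, hc, fun e _ he0 => ?_⟩
      rw [Finset.card_eq_zero.mp he0]; exact h
  | succ r ih =>
    intro a
    induction a with
    | zero =>
      intro b
      refine ⟨0, fun S _ P => Or.inl ⟨∅, by simp, rfl, fun e he hc => ?_⟩⟩
      rw [Finset.subset_empty.mp he] at hc
      simp at hc
    | succ a iha =>
      intro b
      induction b with
      | zero =>
        refine ⟨0, fun S _ P => Or.inr ⟨∅, by simp, rfl, fun e he hc => ?_⟩⟩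
        rw [Finset.subset_empty.mp he] at hc
        simp at hc
      | succ b ihb =>
        obtain ⟨R1, h1⟩ := iha (b + 1)
        obtain ⟨R2, h2⟩ := ihb
        obtain ⟨R, hR⟩ := ih R1 R2
        have key : ∀ (Q : Finset ℕ → Prop) (x : ℕ) (A A' : Finset ℕ), x ∉ A' → A ⊆ A' →
            (∀ e ⊆ A', e.card = r → Q (insert x e)) → (∀ e ⊆ A, e.card = r + 1 → Q e) →
            ∀ e ⊆ insert x A, e.card = r + 1 → Q e := by
          intro Q x A A' hx hAA hQ hA e he hc
          by_cases hxe : x ∈ e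
          · have h3 : e.erase x ⊆ A := fun y hy => by
              have := he (Finset.mem_of_mem_erase hy)
              rcases Finset.mem_insert.mp this with h | h
              · exact absurd h (Finset.ne_of_mem_erase hy)
              · exact h
            have := hQ (e.erase x) (h3.trans hAA) (by rw [Finset.card_erase_of_mem hxe]; omega)
            rwa [Finset.insert_erase hxe] at this
          · refine hA e (fun y hy => ?_) hc
            rcases Finset.mem_insert.mp (he hy) with h | h
            · exact absurd (h ▸ hy) hxe
            · exact h
        refine ⟨R + 1, fun S hS P => ?_⟩
        obtain ⟨x, hx⟩ : S.Nonempty := Finset.card_pos.mp (by omega)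
        have hsub : S.erase x ⊆ S := Finset.erase_subset _ _
        rcases hR (S.erase x) (by rw [Finset.card_erase_of_mem hx]; omega)
          (fun e => P (insert x e)) with ⟨A', hA', hc, hP⟩ | ⟨B', hB', hc, hP⟩
        · have hxA' : x ∉ A' := fun h => Finset.notMem_erase x S (hA' h)
          rcases h1 A' hc.ge P with ⟨A, hA, hAc, hAP⟩ | ⟨B, hB, hBc, hBP⟩
          · left
            refine ⟨insert x A, Finset.insert_subset hx (hA.trans (hA'.trans hsub)), ?_,
              key P x A A' hxA' hA hP hAP⟩
            rw [Finset.card_insert_of_notMem (fun h => hxA' (hA h)), hAc]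
          · exact Or.inr ⟨B, hB.trans (hA'.trans hsub), hBc, hBP⟩
        · have hxB' : x ∉ B' := fun h => Finset.notMem_erase x S (hB' h)
          rcases h2 B' hc.ge P with ⟨A, hA, hAc, hAP⟩ | ⟨B, hB, hBc, hBP⟩
          · exact Or.inl ⟨A, hA.trans (hB'.trans hsub), hAc, hAP⟩
          · right
            refine ⟨insert x B, Finset.insert_subset hx (hB.trans (hB'.trans hsub)), ?_,
              key (fun e => ¬ P e) x B B' hxB' hB hP hBP⟩
            rw [Finset.card_insert_of_notMem (fun h => hxB' (hB h)), hBc]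

theorem sum_prod_comp_injective {A B C : Type*} [Fintype A] [Fintype B] [Fintype C]
    [DecidableEq A] [DecidableEq B]
    {ι : B → A} (hι : Function.Injective ι) (w : A → C → ℝ) (hw : ∀ a, ∑ c, w a c = 1)
    (G : (B → C) → ℝ) :
    ∑ ω : A → C, (∏ a, w a (ω a)) * G (fun b => ω (ι b)) =
      ∑ χ : B → C, (∏ b, w (ι b) (χ b)) * G χ := by
  classical
  rw [← Finset.sum_fiberwise (s := Finset.univ) (g := fun ω : A → C => fun b => ω (ι b))]
  refine Finset.sum_congr rfl fun χ _ => ?_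
  have h1 : ∑ ω ∈ Finset.univ.filter (fun ω : A → C => (fun b => ω (ι b)) = χ),
      (∏ a, w a (ω a)) * G (fun b => ω (ι b)) =
      (∑ ω ∈ Finset.univ.filter (fun ω : A → C => (fun b => ω (ι b)) = χ),
        ∏ a, w a (ω a)) * G χ := by
    rw [Finset.sum_mul]
    refine Finset.sum_congr rfl fun ω hω => ?_
    rw [(Finset.mem_filter.mp hω).2]
  rw [h1]
  congr 1
  set t : A → Finset C := fun a =>
    Finset.univ.filter fun c => ∀ b, ι b = a → c = χ b with ht
  have h2 : Finset.univ.filter (fun ω : A → C => (fun b => ω (ι b)) = χ) =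
      Fintype.piFinset t := by
    ext ω
    simp only [Finset.mem_filter, Finset.mem_univ, true_and, Fintype.mem_piFinset, ht]
    constructor
    · rintro rfl a b rfl
      rfl
    · intro h
      funext b
      exact h _ b rfl
  rw [h2, ← Finset.prod_univ_sum]
  symm
  refine Fintype.prod_of_injective ι hι _ _ (fun a ha => ?_) fun b => ?_
  · have : t a = Finset.univ := by
      ext c
      simp only [ht, Finset.mem_filter, Finset.mem_univ, true_and, iff_true]
      intro b hb
      exact absurd ⟨b, hb⟩ ha
    rw [this, hw]
  · have : t (ι b) = {χ b} := by
      ext c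
      simp only [ht, Finset.mem_filter, Finset.mem_univ, true_and, Finset.mem_singleton]
      constructor
      · intro h
        exact h b rfl
      · rintro rfl b' hb'
        rw [hι hb']
    rw [this, Finset.sum_singleton]

/-- Properties of a relation locating `t` relative to a pair `a < b`
(below, between or above). -/
structure IsZone (zone : ℕ → ℕ → ℕ → Prop) : Prop where
  exists_pair : ∀ B : Finset ℕ, 2 ≤ B.card →
    ∃ a ∈ B, ∃ b ∈ B, a < b ∧ ∀ t ∈ B, t ≠ a → t ≠ b → zone a b t
  unique : ∀ a b a' b', a < b → a' < b' → (a' = a ∨ a' = b ∨ zone a b a') →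
    (b' = a ∨ b' = b ∨ zone a b b') → (a = a' ∨ a = b' ∨ zone a' b' a) →
    (b = a' ∨ b = b' ∨ zone a' b' b) → a' = a ∧ b' = b
  spread : ∀ k s : ℕ, ∃ m, ∀ A : Finset ℕ, m ≤ A.card → ∃ I ⊆ A, I.card = k ∧
    ∀ a ∈ I, ∀ b ∈ I, a < b → ∃ U ⊆ A, U.card = s ∧ ∀ t ∈ U, zone a b t
  ne : ∀ a b t, a < b → zone a b t → t ≠ a ∧ t ≠ b

theorem exists_spaced (k s : ℕ) : ∃ m, ∀ A : Finset ℕ, m ≤ A.card → ∃ I ⊆ A, I.card = k ∧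
    (∀ a ∈ I, ∃ U ⊆ A, U.card = s ∧ ∀ t ∈ U, t < a) ∧
    (∀ a ∈ I, ∃ U ⊆ A, U.card = s ∧ ∀ t ∈ U, a < t) ∧
    (∀ a ∈ I, ∀ b ∈ I, a < b → ∃ U ⊆ A, U.card = s ∧ ∀ t ∈ U, a < t ∧ t < b) := by
  refine ⟨(k + 2) * (s + 1), fun A hA => ?_⟩
  obtain ⟨A', hA', hc⟩ := Finset.exists_subset_card_eq hA
  set e := A'.orderEmbOfFin hc with he
  have hmem : ∀ i, e i ∈ A := fun i => hA' (Finset.orderEmbOfFin_mem _ _ _)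
  have hb : ∀ i : Fin k, ∀ j ≤ s + 1, (i.1 + 1) * (s + 1) + j < (k + 2) * (s + 1) := by
    intro i j hj
    have : (i.1 + 1 + 1) * (s + 1) ≤ (k + 1) * (s + 1) := Nat.mul_le_mul_right _ (by omega)
    have h2 : (k + 2) * (s + 1) = (k + 1) * (s + 1) + (s + 1) := by ring
    have h3 : (i.1 + 1 + 1) * (s + 1) = (i.1 + 1) * (s + 1) + (s + 1) := by ring
    omega
  let p : Fin k → Fin ((k + 2) * (s + 1)) := fun i => ⟨(i.1 + 1) * (s + 1), hb i 0 (by omega)⟩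
  have hp : Function.Injective p := by
    intro i j hij
    have := congrArg Fin.val hij
    simp only [p] at this
    have := Nat.eq_of_mul_eq_mul_right (Nat.succ_pos s) this
    exact Fin.ext (by omega)
  have build : ∀ x y : ℕ, x + s < y → y ≤ (k + 2) * (s + 1) → ∃ U ⊆ A, U.card = s ∧
      ∀ t ∈ U, ∃ z, x < z.1 ∧ z.1 < y ∧ t = e z := by
    intro x y hxy hy
    refine ⟨Finset.univ.image (fun r : Fin s => e ⟨x + 1 + r.1, by omega⟩), ?_, ?_, ?_⟩
    · intro t ht
      obtain ⟨r, _, rfl⟩ := Finset.mem_image.mp ht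
      exact hmem _
    · rw [Finset.card_image_of_injective, Finset.card_univ, Fintype.card_fin]
      intro r r' h
      have := congrArg Fin.val (e.injective h)
      simp only at this
      exact Fin.ext (by omega)
    · intro t ht
      obtain ⟨r, _, rfl⟩ := Finset.mem_image.mp ht
      exact ⟨_, by simp only; omega, by simp only; omega, rfl⟩
  refine ⟨Finset.univ.image (fun i => e (p i)), ?_, ?_, ?_, ?_, ?_⟩
  · intro t ht
    obtain ⟨r, _, rfl⟩ := Finset.mem_image.mp ht
    exact hmem _
  · rw [Finset.card_image_of_injective (f := fun i => e (p i)) _ (e.injective.comp hp), Finset.card_univ,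
      Fintype.card_fin]
  · intro a ha
    obtain ⟨i, _, rfl⟩ := Finset.mem_image.mp ha
    have h1 : (p i).1 = (i.1 + 1) * (s + 1) := rfl
    have h2 : 1 * (s + 1) ≤ (i.1 + 1) * (s + 1) := Nat.mul_le_mul_right _ (by omega)
    obtain ⟨U, hU, hUc, hUt⟩ := build 0 (p i).1 (by omega) (p i).2.le
    refine ⟨U, hU, hUc, fun t ht => ?_⟩
    obtain ⟨z, _, hz, rfl⟩ := hUt t ht
    exact e.strictMono hz
  · intro a ha
    obtain ⟨i, _, rfl⟩ := Finset.mem_image.mp ha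
    have h1 : (p i).1 = (i.1 + 1) * (s + 1) := rfl
    have h2 := hb i (s + 1) le_rfl
    obtain ⟨U, hU, hUc, hUt⟩ := build (p i).1 ((k + 2) * (s + 1)) (by omega) le_rfl
    refine ⟨U, hU, hUc, fun t ht => ?_⟩
    obtain ⟨z, hz, _, rfl⟩ := hUt t ht
    exact e.strictMono hz
  · intro a ha b hb' hab
    obtain ⟨i, _, rfl⟩ := Finset.mem_image.mp ha
    obtain ⟨j, _, rfl⟩ := Finset.mem_image.mp hb'
    have hij : p i < p j := e.lt_iff_lt.mp hab
    have h1 : (p i).1 = (i.1 + 1) * (s + 1) := rfl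
    have h2 : (p j).1 = (j.1 + 1) * (s + 1) := rfl
    have h3 : (p i).1 < (p j).1 := hij
    have h4 : i.1 + 1 < j.1 + 1 := by
      rw [h1, h2] at h3
      exact lt_of_mul_lt_mul_right h3 (Nat.zero_le _)
    have h5 : (i.1 + 1 + 1) * (s + 1) ≤ (j.1 + 1) * (s + 1) := Nat.mul_le_mul_right _ h4
    have h6 : (i.1 + 1 + 1) * (s + 1) = (i.1 + 1) * (s + 1) + (s + 1) := by ring
    obtain ⟨U, hU, hUc, hUt⟩ := build (p i).1 (p j).1 (by omega) (p j).2.le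
    refine ⟨U, hU, hUc, fun t ht => ?_⟩
    obtain ⟨z, hz, hz', rfl⟩ := hUt t ht
    exact ⟨e.strictMono hz, e.strictMono hz'⟩

theorem exists_lt_of_two_le_card (B : Finset ℕ) (hB : 2 ≤ B.card) :
    ∃ a ∈ B, ∃ b ∈ B, a < b ∧ (∀ t ∈ B, a ≤ t ∧ t ≤ b) := by
  have hne : B.Nonempty := Finset.card_pos.mp (by omega)
  refine ⟨B.min' hne, B.min'_mem hne, B.max' hne, B.max'_mem hne,
    Finset.min'_lt_max'_of_card B (by omega), fun t ht => ⟨B.min'_le t ht, B.le_max' t ht⟩⟩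

theorem isZone_middle : IsZone fun a b t => a < t ∧ t < b where
  exists_pair B hB := by
    obtain ⟨a, ha, b, hb, hab, h⟩ := exists_lt_of_two_le_card B hB
    exact ⟨a, ha, b, hb, hab, fun t ht h1 h2 => ⟨by have := h t ht; omega, by have := h t ht; omega⟩⟩
  unique := by intros; omega
  spread k s := by
    obtain ⟨m, hm⟩ := exists_spaced k s
    refine ⟨m, fun A hA => ?_⟩
    obtain ⟨I, hI, hc, _, _, h⟩ := hm A hA
    exact ⟨I, hI, hc, h⟩
  ne := by intros; omega

theorem isZone_lower : IsZone fun a _ t => t < a where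
  exists_pair B hB := by
    obtain ⟨a, ha, b, hb, hab, h⟩ := exists_lt_of_two_le_card B hB
    obtain ⟨a', ha', hm⟩ := Finset.exists_max_image (B.erase b) id ⟨a, Finset.mem_erase.mpr ⟨hab.ne, ha⟩⟩
    have h1 := Finset.mem_erase.mp ha'
    refine ⟨a', h1.2, b, hb, lt_of_le_of_ne (h _ h1.2).2 h1.1, fun t ht h2 h3 => ?_⟩
    exact lt_of_le_of_ne (hm t (Finset.mem_erase.mpr ⟨h3, ht⟩)) h2
  unique := by intros; omega
  spread k s := by
    obtain ⟨m, hm⟩ := exists_spaced k s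
    refine ⟨m, fun A hA => ?_⟩
    obtain ⟨I, hI, hc, h, _, _⟩ := hm A hA
    exact ⟨I, hI, hc, fun a ha _ _ _ => h a ha⟩
  ne := by intros; omega

theorem isZone_upper : IsZone fun _ b t => b < t where
  exists_pair B hB := by
    obtain ⟨a, ha, b, hb, hab, h⟩ := exists_lt_of_two_le_card B hB
    obtain ⟨b', hb', hm⟩ := Finset.exists_min_image (B.erase a) id ⟨b, Finset.mem_erase.mpr ⟨hab.ne', hb⟩⟩
    have h1 := Finset.mem_erase.mp hb'
    refine ⟨a, ha, b', h1.2, lt_of_le_of_ne (h _ h1.2).1 h1.1.symm, fun t ht h2 h3 => ?_⟩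
    exact lt_of_le_of_ne (hm t (Finset.mem_erase.mpr ⟨h2, ht⟩)) h3.symm
  unique := by intros; omega
  spread k s := by
    obtain ⟨m, hm⟩ := exists_spaced k s
    refine ⟨m, fun A hA => ?_⟩
    obtain ⟨I, hI, hc, _, h, _⟩ := hm A hA
    exact ⟨I, hI, hc, fun _ _ b hb _ => h b hb⟩
  ne := by intros; omega

open scoped Classical in
theorem exists_subset_weight {C : Type*} [Fintype C] {δ : ℝ} (hδ : 0 < δ)
    (s : ℕ) (U : Finset ℕ) (hU : (s : ℝ) ≤ U.card * δ / 4) (hU0 : 0 < U.card)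
    (q : C → ℝ) (hq : ∀ c, 0 ≤ q c) (hq1 : ∑ c, q c = 1) (Z : ℕ → C → ℝ)
    (hZ1 : ∀ t c, Z t c ≤ 1)
    (h : ∀ t ∈ U, δ ≤ ∑ c, q c * Z t c) :
    ∃ E ⊆ U, E.card = s ∧
      (δ / 4) / 2 ^ U.card ≤ ∑ c, q c * (if ∀ t ∈ E, δ / 2 ≤ Z t c then 1 else 0) := by
  set T : ℝ := (U.card : ℝ) with hT
  have hT0 : 0 < T := by rw [hT]; exact_mod_cast hU0
  set N : C → Finset ℕ := fun c => U.filter fun t => δ / 2 ≤ Z t c with hN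
  have h1 : T * δ ≤ ∑ c, q c * ∑ t ∈ U, Z t c := by
    calc T * δ = ∑ t ∈ U, δ := by rw [Finset.sum_const, nsmul_eq_mul]
      _ ≤ ∑ t ∈ U, ∑ c, q c * Z t c := Finset.sum_le_sum h
      _ = _ := by
        rw [Finset.sum_comm]
        simp_rw [Finset.mul_sum]
  have h2 : ∀ c, ∑ t ∈ U, Z t c ≤ (N c).card + T * (δ / 2) := by
    intro c
    rw [← Finset.sum_filter_add_sum_filter_not U (fun t => δ / 2 ≤ Z t c)]
    refine add_le_add ?_ ?_
    · calc _ ≤ ∑ t ∈ N c, (1 : ℝ) := Finset.sum_le_sum fun t _ => hZ1 t c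
        _ = _ := by simp
    · calc _ ≤ ∑ t ∈ U.filter (fun t => ¬ δ / 2 ≤ Z t c), δ / 2 :=
            Finset.sum_le_sum fun t ht => by
              have := (Finset.mem_filter.mp ht).2
              push Not at this
              exact this.le
        _ ≤ ∑ t ∈ U, δ / 2 := Finset.sum_le_sum_of_subset_of_nonneg (Finset.filter_subset _ _)
            fun _ _ _ => by positivity
        _ = _ := by rw [Finset.sum_const, nsmul_eq_mul]
  have h3 : ∀ c, ((N c).card : ℝ) ≤ T * (if s ≤ (N c).card then 1 else 0) + s := by
    intro c
    split_ifs with hc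
    · have : ((N c).card : ℝ) ≤ T := by
        rw [hT]
        exact_mod_cast Finset.card_le_card (Finset.filter_subset _ U)
      have h0 : (0 : ℝ) ≤ s := by positivity
      linarith
    · push Not at hc
      have : ((N c).card : ℝ) ≤ s := by exact_mod_cast hc.le
      linarith
  have h4 : δ / 4 ≤ ∑ c, q c * (if s ≤ (N c).card then 1 else 0) := by
    have h5 : T * δ ≤ ∑ c, q c * (T * (if s ≤ (N c).card then 1 else 0) + s + T * (δ / 2)) :=
      h1.trans (Finset.sum_le_sum fun c _ => mul_le_mul_of_nonneg_left
        ((h2 c).trans (by linarith [h3 c])) (hq c))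
    have h6 : ∑ c, q c * (T * (if s ≤ (N c).card then 1 else 0) + s + T * (δ / 2)) =
        T * (∑ c, q c * (if s ≤ (N c).card then 1 else 0)) + (s + T * (δ / 2)) * ∑ c, q c := by
      rw [Finset.mul_sum, Finset.mul_sum, ← Finset.sum_add_distrib]
      refine Finset.sum_congr rfl fun c _ => ?_
      ring
    rw [h6, hq1] at h5
    have h7 : T * (δ / 4) ≤ T * (∑ c, q c * (if s ≤ (N c).card then 1 else 0)) := by linarith
    exact le_of_mul_le_mul_left h7 hT0
  by_contra hcon
  push Not at hcon
  have h8 : ∑ c, q c * (if s ≤ (N c).card then 1 else 0) ≤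
      ∑ E ∈ U.powersetCard s, ∑ c, q c * (if ∀ t ∈ E, δ / 2 ≤ Z t c then 1 else 0) := by
    rw [Finset.sum_comm]
    refine Finset.sum_le_sum fun c _ => ?_
    rw [← Finset.mul_sum]
    refine mul_le_mul_of_nonneg_left ?_ (hq c)
    split_ifs with hc
    · obtain ⟨E, hE, hEc⟩ := Finset.exists_subset_card_eq hc
      have hmem : E ∈ U.powersetCard s :=
        Finset.mem_powersetCard.mpr ⟨hE.trans (Finset.filter_subset _ _), hEc⟩
      refine le_trans ?_ (Finset.single_le_sum
        (f := fun E : Finset ℕ => if ∀ t ∈ E, δ / 2 ≤ Z t c then (1 : ℝ) else 0)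
        (fun _ _ => by split_ifs <;> norm_num) hmem)
      rw [if_pos fun t ht => (Finset.mem_filter.mp (hE ht)).2]
    · exact Finset.sum_nonneg fun _ _ => by split_ifs <;> norm_num
  have hne : (U.powersetCard s).Nonempty := by
    by_contra hne
    rw [Finset.not_nonempty_iff_eq_empty] at hne
    rw [hne, Finset.sum_empty] at h8
    linarith
  have h9 : ∑ E ∈ U.powersetCard s, ∑ c, q c * (if ∀ t ∈ E, δ / 2 ≤ Z t c then (1:ℝ) else 0) <
      ∑ E ∈ U.powersetCard s, (δ / 4) / 2 ^ U.card :=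
    Finset.sum_lt_sum_of_nonempty hne fun E hE => by
      obtain ⟨ha, hb⟩ := Finset.mem_powersetCard.mp hE
      exact hcon E ha hb
  have h10 : ∑ E ∈ U.powersetCard s, (δ / 4) / 2 ^ U.card ≤ δ / 4 := by
    rw [Finset.sum_const, nsmul_eq_mul]
    have : ((U.powersetCard s).card : ℝ) ≤ 2 ^ U.card := by
      rw [Finset.card_powersetCard]
      exact_mod_cast Nat.choose_le_two_pow U.card s
    have hp : (0 : ℝ) < 2 ^ U.card := by positivity
    rw [← mul_div_assoc, div_le_iff₀ hp, mul_comm]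
    exact mul_le_mul_of_nonneg_left this (by positivity)
  linarith

open scoped Classical in
theorem zone_step {zone : ℕ → ℕ → ℕ → Prop} (hz : IsZone zone) (k : ℕ) {δ : ℝ} (hδ : 0 < δ) :
    ∃ (R : ℕ) (c₀ : ℝ), 0 < c₀ ∧ ∀ S : Finset ℕ, R ≤ S.card → ∀ (C : Type) [Fintype C],
      ∀ (q : ℕ → ℕ → C → ℝ), (∀ a b c, 0 ≤ q a b c) → (∀ a b, ∑ c, q a b c = 1) →
      ∀ (Z : ℕ → ℕ → ℕ → C → ℝ), (∀ a b t c, Z a b t c ≤ 1) →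
      (∀ a ∈ S, ∀ b ∈ S, ∀ t ∈ S, a < b → zone a b t → δ ≤ ∑ c, q a b c * Z a b t c) →
      ∃ I ⊆ S, I.card = k ∧ ∀ a ∈ I, ∀ b ∈ I, a < b →
        c₀ ≤ ∑ c, q a b c * (if ∀ t ∈ I, zone a b t → δ / 2 ≤ Z a b t c then 1 else 0) := by
  obtain ⟨T, hT⟩ := exists_nat_ge (4 * (k : ℝ) / δ + 1)
  have hT1 : (1 : ℝ) ≤ T := le_trans (by linarith [show 0 ≤ 4 * (k : ℝ) / δ by positivity]) hT
  have hTpos : 0 < T := by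
    have : (0 : ℝ) < T := by linarith
    exact_mod_cast this
  have hTk : (k : ℝ) ≤ T * δ / 4 := by
    have : 4 * (k : ℝ) / δ ≤ T := by linarith
    rw [div_le_iff₀ hδ] at this
    linarith
  obtain ⟨m, hm⟩ := hz.spread k k
  obtain ⟨R, hR⟩ := ramsey (k + 2) m (T + 2)
  refine ⟨R, (δ / 4) / 2 ^ T, by positivity, fun S hS C _ q hq hq1 Z hZ h => ?_⟩
  let Good : Finset ℕ → Prop := fun E => ∀ a ∈ E, ∀ b ∈ E, a < b →
    (∀ t ∈ E, t ≠ a → t ≠ b → zone a b t) →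
    (δ / 4) / 2 ^ T ≤ ∑ c, q a b c *
      (if ∀ t ∈ E, t ≠ a → t ≠ b → δ / 2 ≤ Z a b t c then 1 else 0)
  rcases hR S hS Good with ⟨A, hA, hAc, hgood⟩ | ⟨B, hB, hBc, hbad⟩
  · obtain ⟨I, hI, hIc, hsp⟩ := hm A hAc.ge
    refine ⟨I, hI.trans hA, hIc, fun a ha b hb hab => ?_⟩
    obtain ⟨V, hV, hVc, hVz⟩ := hsp a ha b hb hab
    obtain ⟨U, hU1, hU2, hUc⟩ := Finset.exists_subsuperset_card_eq
      (s := I.filter (zone a b)) (t := A.filter (zone a b)) (n := k)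
      (Finset.filter_subset_filter _ hI)
      (hIc ▸ Finset.card_le_card (Finset.filter_subset _ _))
      (hVc ▸ Finset.card_le_card fun t ht => Finset.mem_filter.mpr ⟨hV ht, hVz t ht⟩)
    have hUz : ∀ t ∈ U, zone a b t := fun t ht => (Finset.mem_filter.mp (hU2 ht)).2
    have hbU : b ∉ U := fun hbU => (hz.ne a b b hab (hUz b hbU)).2 rfl
    have haU : a ∉ insert b U := fun haU => by
      rcases Finset.mem_insert.mp haU with h | h
      · exact hab.ne h
      · exact (hz.ne a b a hab (hUz a h)).1 rfl
    have := hgood (insert a (insert b U))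
      (Finset.insert_subset (hI ha) (Finset.insert_subset (hI hb)
        (hU2.trans (Finset.filter_subset _ _))))
      (by rw [Finset.card_insert_of_notMem haU, Finset.card_insert_of_notMem hbU, hUc])
      a (by simp) b (by simp) hab (fun t ht h1 h2 => by
        simp only [Finset.mem_insert, h1, h2, false_or] at ht
        exact hUz t ht)
    refine this.trans (Finset.sum_le_sum fun c _ => mul_le_mul_of_nonneg_left ?_ (hq a b c))
    split_ifs with h1 h2 h2
    · exact le_rfl
    · refine absurd (fun t ht hzt => ?_) h2
      obtain ⟨h3, h4⟩ := hz.ne a b t hab hzt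
      exact h1 t (by simp [hU1 (Finset.mem_filter.mpr ⟨ht, hzt⟩)]) h3 h4
    · norm_num
    · exact le_rfl
  · exfalso
    obtain ⟨a, ha, b, hb, hab, hzone⟩ := hz.exists_pair B (by omega)
    set U := (B.erase a).erase b with hU
    have hUB : U ⊆ B := (Finset.erase_subset _ _).trans (Finset.erase_subset _ _)
    have hbB : b ∈ B.erase a := Finset.mem_erase.mpr ⟨hab.ne', hb⟩
    have hUc : U.card = T := by
      rw [hU, Finset.card_erase_of_mem hbB, Finset.card_erase_of_mem ha]
      omega
    have hUz : ∀ t ∈ U, t ≠ a ∧ t ≠ b ∧ zone a b t := by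
      intro t ht
      have h1 := Finset.mem_erase.mp ht
      have h2 := Finset.mem_erase.mp h1.2
      exact ⟨h2.1, h1.1, hzone t h2.2 h2.1 h1.1⟩
    obtain ⟨E, hE, hEc, hEw⟩ := exists_subset_weight hδ k U (by rw [hUc]; exact hTk)
      (by omega) (q a b) (hq a b) (hq1 a b) (Z a b) (hZ a b)
      (fun t ht => h a (hB ha) b (hB hb) t (hB (hUB ht)) hab (hUz t ht).2.2)
    have hbE : b ∉ E := fun hh => (hUz b (hE hh)).2.1 rfl
    have haE : a ∉ insert b E := fun hh => by
      rcases Finset.mem_insert.mp hh with h | h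
      · exact hab.ne h
      · exact (hUz a (hE h)).1 rfl
    refine hbad (insert a (insert b E))
      (Finset.insert_subset ha (Finset.insert_subset hb (hE.trans hUB)))
      (by rw [Finset.card_insert_of_notMem haE, Finset.card_insert_of_notMem hbE, hEc]) ?_
    intro a' ha' b' hb' hab' hz'
    have hcase : ∀ x ∈ insert a (insert b E), x = a ∨ x = b ∨ zone a b x := by
      intro x hx
      simp only [Finset.mem_insert] at hx
      rcases hx with h | h | h
      · exact Or.inl h
      · exact Or.inr (Or.inl h)
      · exact Or.inr (Or.inr (hUz x (hE h)).2.2)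
    have hcase' : ∀ x ∈ insert a (insert b E), x = a' ∨ x = b' ∨ zone a' b' x := by
      intro x hx
      by_cases h1 : x = a'
      · exact Or.inl h1
      by_cases h2 : x = b'
      · exact Or.inr (Or.inl h2)
      exact Or.inr (Or.inr (hz' x hx h1 h2))
    obtain ⟨rfl, rfl⟩ := hz.unique a b a' b' hab hab' (hcase a' ha') (hcase b' hb')
      (hcase' a (by simp)) (hcase' b (by simp))
    rw [hUc] at hEw
    refine hEw.trans (Finset.sum_le_sum fun c _ => mul_le_mul_of_nonneg_left ?_ (hq _ _ c))
    split_ifs with h1 h2 h2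
    · exact le_rfl
    · refine absurd (fun t ht h3 h4 => ?_) h2
      simp only [Finset.mem_insert, h3, h4, false_or] at ht
      exact h1 t ht
    · norm_num
    · exact le_rfl

open scoped Classical in
theorem pair_step {zone : ℕ → ℕ → ℕ → Prop} (hz : IsZone zone) (k : ℕ) {δ : ℝ} (hδ : 0 < δ) :
    ∃ (R : ℕ) (c₀ : ℝ), 0 < c₀ ∧ ∀ S : Finset ℕ, R ≤ S.card → ∀ (C P : Type) [Fintype C]
      [Fintype P] [DecidableEq P] (p : ℕ → ℕ → P), (∀ a ∈ S, ∀ b ∈ S, ∀ a' ∈ S, ∀ b' ∈ S, p a b = p a' b' →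
        a = a' ∧ b = b') →
      ∀ (w : P → C → ℝ), (∀ x c, 0 ≤ w x c) → (∀ x, ∑ c, w x c = 1) →
      ∀ (Z : ℕ → ℕ → ℕ → C → ℝ), (∀ a b t c, Z a b t c ≤ 1) →
      (∀ a ∈ S, ∀ b ∈ S, ∀ t ∈ S, a < b → zone a b t → δ ≤ ∑ c, w (p a b) c * Z a b t c) →
      ∃ I ⊆ S, I.card = k ∧ c₀ ^ Fintype.card P ≤ ∑ ω : P → C, (∏ x, w x (ω x)) *
        (if ∀ a ∈ I, ∀ b ∈ I, a < b → ∀ t ∈ I, zone a b t → δ / 2 ≤ Z a b t (ω (p a b))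
          then 1 else 0) := by
  obtain ⟨R, c₀, hc₀, hR⟩ := zone_step hz k hδ
  refine ⟨R, min c₀ 1, by positivity, fun S hS C P _ _ _ p hp w hw hw1 Z hZ h => ?_⟩
  obtain ⟨I, hI, hIc, hgood⟩ := hR S hS C (fun a b => w (p a b)) (fun _ _ => hw _)
    (fun _ _ => hw1 _) Z hZ h
  refine ⟨I, hI, hIc, ?_⟩
  let h' : P → C → ℝ := fun x c => if ∀ a ∈ I, ∀ b ∈ I, a < b → p a b = x → ∀ t ∈ I,
    zone a b t → δ / 2 ≤ Z a b t c then 1 else 0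
  have h1 : ∀ ω : P → C, (if ∀ a ∈ I, ∀ b ∈ I, a < b → ∀ t ∈ I, zone a b t →
      δ / 2 ≤ Z a b t (ω (p a b)) then (1 : ℝ) else 0) = ∏ x, h' x (ω x) := by
    intro ω
    split_ifs with h2
    · exact (Finset.prod_eq_one fun x _ => if_pos fun a ha b hb hab he => by
        subst he
        exact h2 a ha b hb hab).symm
    · push Not at h2
      obtain ⟨a, ha, b, hb, hab, t, ht, h3, h4⟩ := h2
      exact (Finset.prod_eq_zero (Finset.mem_univ (p a b)) (if_neg fun h5 =>
        h4.not_ge (h5 a ha b hb hab rfl t ht h3))).symm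
  simp_rw [h1, ← Finset.prod_mul_distrib]
  have h2 := Finset.prod_univ_sum (fun _ : P => (Finset.univ : Finset C))
    (fun x c => w x c * h' x c)
  rw [Fintype.piFinset_univ] at h2
  rw [← h2, ← Finset.card_univ, ← Finset.prod_const]
  refine Finset.prod_le_prod (fun _ _ => by positivity) fun x _ => ?_
  by_cases hx : ∃ a ∈ I, ∃ b ∈ I, a < b ∧ p a b = x
  · obtain ⟨a, ha, b, hb, hab, rfl⟩ := hx
    refine (min_le_left _ _).trans ((hgood a ha b hb hab).trans_eq ?_)
    refine Finset.sum_congr rfl fun c _ => ?_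
    congr 1
    refine if_congr ?_ rfl rfl
    constructor
    · intro h3 a' ha' b' hb' _ he
      obtain ⟨rfl, rfl⟩ := hp _ (hI ha') _ (hI hb') _ (hI ha) _ (hI hb) he
      exact h3
    · intro h3
      exact h3 a ha b hb hab rfl
  · refine (min_le_right _ _).trans_eq ?_
    rw [← hw1 x]
    refine Finset.sum_congr rfl fun c _ => ?_
    have : h' x c = 1 := if_pos fun a ha b hb hab he => absurd ⟨a, ha, b, hb, hab, he⟩ hx
    rw [this, mul_one]

/-- Ordered pairs of positions. -/
abbrev Pair (k : ℕ) := {e : Fin k × Fin k // e.1 < e.2}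

/-- Ordered triples of positions whose pairs are coloured `0`, `1`, `2` in this order. -/
abbrev Trip {k : ℕ} (φ : Fin k → Fin k → Fin 3) :=
  {t : Fin k × Fin k × Fin k // (t.1 < t.2.1 ∧ t.2.1 < t.2.2) ∧
    φ t.1 t.2.1 = 0 ∧ φ t.1 t.2.2 = 1 ∧ φ t.2.1 t.2.2 = 2}

namespace Trip
variable {k : ℕ} {φ : Fin k → Fin k → Fin 3}

abbrev p01 (t : Trip φ) : Pair k := ⟨(t.1.1, t.1.2.1), t.2.1.1⟩
abbrev p02 (t : Trip φ) : Pair k := ⟨(t.1.1, t.1.2.2), t.2.1.1.trans t.2.1.2⟩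
abbrev p12 (t : Trip φ) : Pair k := ⟨(t.1.2.1, t.1.2.2), t.2.1.2⟩

end Trip

theorem weighted_le_one {C : Type*} [Fintype C] {q Z : C → ℝ} (hq : ∀ c, 0 ≤ q c)
    (hq1 : ∑ c, q c = 1) (hZ : ∀ c, Z c ≤ 1) : ∑ c, q c * Z c ≤ 1 := by
  rw [← hq1]
  exact Finset.sum_le_sum fun c _ => mul_le_of_le_one_right (hq c) (hZ c)

open scoped Classical in
theorem nested_colorings (k : ℕ) {δ : ℝ} (hδ : 0 < δ) :
    ∃ (m : ℕ) (c₀ : ℝ), 0 < c₀ ∧ ∀ (C : Type) [Fintype C] (q : ℕ → ℕ → C → ℝ),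
      (∀ a b c, 0 ≤ q a b c) → (∀ a b, ∑ c, q a b c = 1) →
      ∀ (f : C → C → C → ℝ), (∀ a b c, f a b c ≤ 1) →
      (∀ i j l, i < j → j < l → l < m + 1 →
        δ ≤ ∑ c, ∑ c', ∑ c'', q i j c * q i l c' * q j l c'' * f c c' c'') →
      c₀ ≤ ∑ g : Fin (m + 1) × Fin (m + 1) → C, (∏ x, q x.1 x.2 (g x)) *
        ∑ b : Fin (m + 1) × Fin (m + 1) → C, (∏ x, q x.1 x.2 (b x)) *
        ∑ r : Fin (m + 1) × Fin (m + 1) → C, (∏ x, q x.1 x.2 (r x)) *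
        (if ∃ I ∈ (Finset.range (m + 1)).powersetCard k, ∀ i ∈ I, ∀ j ∈ I, ∀ l ∈ I,
          i < j → j < l → δ / 8 ≤ f (r (Fin.ofNat (m + 1) i, Fin.ofNat (m + 1) j))
            (b (Fin.ofNat (m + 1) i, Fin.ofNat (m + 1) l))
            (g (Fin.ofNat (m + 1) j, Fin.ofNat (m + 1) l)) then 1 else 0) := by
  obtain ⟨R3, c3, hc3, h3⟩ := pair_step isZone_upper k (δ := δ / 4) (by positivity)
  obtain ⟨R2, c2, hc2, h2⟩ := pair_step isZone_middle R3 (δ := δ / 2) (by positivity)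
  obtain ⟨m, c1, hc1, h1⟩ := pair_step isZone_lower R2 hδ
  set P := Fin (m + 1) × Fin (m + 1) with hP
  refine ⟨m, c1 ^ Fintype.card P * (c2 ^ Fintype.card P * c3 ^ Fintype.card P), by positivity,
    fun C _ q hq hq1 f hf h => ?_⟩
  let p : ℕ → ℕ → P := fun a b => (Fin.ofNat (m + 1) a, Fin.ofNat (m + 1) b)
  have hof : ∀ a < m + 1, ((Fin.ofNat (m + 1) a : Fin (m + 1)) : ℕ) = a := fun a ha =>
    Nat.mod_eq_of_lt ha
  have hp : ∀ a ∈ Finset.range (m + 1), ∀ b ∈ Finset.range (m + 1), ∀ a' ∈ Finset.range (m + 1),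
      ∀ b' ∈ Finset.range (m + 1), p a b = p a' b' → a = a' ∧ b = b' := by
    intro a ha b hb a' ha' b' hb' he
    simp only [Finset.mem_range] at ha hb ha' hb'
    have e1 := congrArg (fun x : P => x.1.1) he
    have e2 := congrArg (fun x : P => x.2.1) he
    simp only [p, hof a ha, hof a' ha', hof b hb, hof b' hb'] at e1 e2
    exact ⟨e1, e2⟩
  let w : P → C → ℝ := fun x => q x.1 x.2
  have hw : ∀ x c, 0 ≤ w x c := fun x c => hq _ _ _
  have hw1 : ∀ x, ∑ c, w x c = 1 := fun x => hq1 _ _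
  have hwp : ∀ a < m + 1, ∀ b < m + 1, w (p a b) = q a b := by
    intro a ha b hb
    simp only [w, p, hof a ha, hof b hb]
  have hQ : ∀ ω : P → C, 0 ≤ ∏ x, w x (ω x) := fun ω => Finset.prod_nonneg fun x _ => hw _ _
  obtain ⟨I1, hI1, hI1c, hb1⟩ := h1 (Finset.range (m + 1)) (by simp) C P p hp w hw hw1
    (fun a b t c'' => ∑ c, q t a c * ∑ c', q t b c' * f c c' c'')
    (fun a b t c'' => weighted_le_one (hq _ _) (hq1 _ _) fun c =>
      weighted_le_one (hq _ _) (hq1 _ _) fun c' => hf _ _ _)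
    (by
      intro a ha b hb t ht hab hta
      simp only [Finset.mem_range] at ha hb ht
      rw [hwp a ha b hb]
      refine (h t a b hta hab hb).trans_eq ?_
      simp_rw [Finset.mul_sum]
      rw [Finset.sum_comm]
      rw [Finset.sum_congr rfl fun c' _ => Finset.sum_comm]
      rw [Finset.sum_comm]
      refine Finset.sum_congr rfl fun c'' _ => ?_
      rw [Finset.sum_comm]
      refine Finset.sum_congr rfl fun c' _ => Finset.sum_congr rfl fun c _ => ?_
      ring)
  refine (mul_le_mul_of_nonneg_right hb1 (show 0 ≤ c2 ^ Fintype.card P * c3 ^ Fintype.card P by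
    positivity)).trans ?_
  rw [Finset.sum_mul]
  refine Finset.sum_le_sum fun g _ => ?_
  rw [mul_assoc]
  refine mul_le_mul_of_nonneg_left ?_ (hQ g)
  split_ifs with hg
  swap
  · rw [zero_mul]
    exact Finset.sum_nonneg fun b _ => mul_nonneg (hQ b) (Finset.sum_nonneg fun r _ =>
      mul_nonneg (hQ r) (by split_ifs <;> norm_num))
  rw [one_mul]
  have hr1 : ∀ a ∈ I1, a < m + 1 := fun a ha => Finset.mem_range.mp (hI1 ha)
  obtain ⟨I2, hI2, hI2c, hb2⟩ := h2 I1 hI1c.ge C P p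
    (fun a ha b hb a' ha' b' hb' => hp a (hI1 ha) b (hI1 hb) a' (hI1 ha') b' (hI1 hb')) w hw hw1
    (fun a b t c' => ∑ c, q a t c * f c c' (g (p t b)))
    (fun a b t c' => weighted_le_one (hq _ _) (hq1 _ _) fun c => hf _ _ _)
    (by
      intro a ha b hb t ht hab htab
      rw [hwp a (hr1 a ha) b (hr1 b hb)]
      refine (hg t ht b hb htab.2 a ha htab.1).trans_eq ?_
      simp_rw [Finset.mul_sum]
      rw [Finset.sum_comm]
      refine Finset.sum_congr rfl fun c' _ => Finset.sum_congr rfl fun c _ => ?_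
      ring)
  refine (mul_le_mul_of_nonneg_right hb2 (show 0 ≤ c3 ^ Fintype.card P by
    positivity)).trans ?_
  rw [Finset.sum_mul]
  refine Finset.sum_le_sum fun b _ => ?_
  rw [mul_assoc]
  refine mul_le_mul_of_nonneg_left ?_ (hQ b)
  split_ifs with hb
  swap
  · rw [zero_mul]
    exact Finset.sum_nonneg fun r _ => mul_nonneg (hQ r) (by split_ifs <;> norm_num)
  rw [one_mul]
  have hr2 : ∀ a ∈ I2, a < m + 1 := fun a ha => hr1 a (hI2 ha)
  obtain ⟨I3, hI3, hI3c, hb3⟩ := h3 I2 hI2c.ge C P p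
    (fun a ha b hb a' ha' b' hb' => hp a (hI1 (hI2 ha)) b (hI1 (hI2 hb)) a' (hI1 (hI2 ha'))
      b' (hI1 (hI2 hb'))) w hw hw1
    (fun i j l c => f c (b (p i l)) (g (p j l))) (fun _ _ _ _ => hf _ _ _)
    (by
      intro i hi j hj l hl hij hjl
      rw [hwp i (hr2 i hi) j (hr2 j hj)]
      have := hb i hi l hl (hij.trans hjl) j hj ⟨hij, hjl⟩
      linarith)
  refine hb3.trans (Finset.sum_le_sum fun r _ => mul_le_mul_of_nonneg_left ?_ (hQ r))
  split_ifs with e1 e2 e2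
  · exact le_rfl
  · refine absurd ⟨I3, Finset.mem_powersetCard.mpr ⟨hI3.trans (hI2.trans hI1), hI3c⟩, ?_⟩ e2
    intro i hi j hj l hl hij hjl
    have := e1 i hi j hj hij l hl hjl
    simp only [p] at this
    linarith
  · norm_num
  · exact le_rfl

open scoped Classical in
theorem reduced_count (k : ℕ) (φ : Fin k → Fin k → Fin 3) {δ : ℝ} (hδ : 0 < δ) :
    ∃ (M : ℕ) (c₀ : ℝ), 0 < c₀ ∧ ∀ (C : Type) [Fintype C] (q : ℕ → ℕ → C → ℝ),
      (∀ a b c, 0 ≤ q a b c) → (∀ a b, ∑ c, q a b c = 1) →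
      ∀ (f : C → C → C → ℝ), (∀ a b c, 0 ≤ f a b c) → (∀ a b c, f a b c ≤ 1) →
      (∀ i j l, i < j → j < l → l < M →
        δ ≤ ∑ c, ∑ c', ∑ c'', q i j c * q i l c' * q j l c'' * f c c' c'') →
      ∃ I : Fin k → Fin M, StrictMono I ∧
        c₀ ≤ ∑ χ : Pair k → C, (∏ e : Pair k, q (I e.1.1) (I e.1.2) (χ e)) *
          ∏ t : Trip φ, f (χ t.p01) (χ t.p02) (χ t.p12) := by
  obtain ⟨m, c₀, hc₀, hm⟩ := nested_colorings k hδ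
  set ε : ℝ := min (δ / 8) 1 with hε
  have hε0 : 0 < ε := by positivity
  refine ⟨m + 1, c₀ / 2 ^ (m + 1) * ε ^ Fintype.card (Trip φ), by positivity,
    fun C _ q hq hq1 f hf0 hf h => ?_⟩
  have hmain := hm C q hq hq1 f hf h
  set P := Fin (m + 1) × Fin (m + 1) with hP
  let p : ℕ → ℕ → P := fun a b => (Fin.ofNat (m + 1) a, Fin.ofNat (m + 1) b)
  let Good : Finset ℕ → (P → C) → (P → C) → (P → C) → Prop := fun I g b r =>
    ∀ i ∈ I, ∀ j ∈ I, ∀ l ∈ I, i < j → j < l → δ / 8 ≤ f (r (p i j)) (b (p i l)) (g (p j l))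
  let Q : (P → C) → ℝ := fun ω => ∏ x, q x.1 x.2 (ω x)
  have hQ : ∀ ω, 0 ≤ Q ω := fun ω => Finset.prod_nonneg fun x _ => hq _ _ _
  have hsum : c₀ ≤ ∑ I ∈ (Finset.range (m + 1)).powersetCard k,
      ∑ g, ∑ b, ∑ r, Q g * Q b * Q r * (if Good I g b r then 1 else 0) := by
    refine hmain.trans ?_
    simp_rw [Finset.mul_sum]
    conv_rhs => rw [Finset.sum_comm]
    refine Finset.sum_le_sum fun g _ => ?_
    conv_rhs => rw [Finset.sum_comm]
    refine Finset.sum_le_sum fun b _ => ?_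
    conv_rhs => rw [Finset.sum_comm]
    refine Finset.sum_le_sum fun r _ => ?_
    rw [← Finset.mul_sum, ← mul_assoc, ← mul_assoc]
    refine mul_le_mul_of_nonneg_left ?_ (mul_nonneg (mul_nonneg (hQ g) (hQ b)) (hQ r))
    split_ifs with h1
    · obtain ⟨I, hI, hIg⟩ := h1
      refine le_trans ?_ (Finset.single_le_sum
        (f := fun I => if Good I g b r then (1 : ℝ) else 0)
        (fun _ _ => by split_ifs <;> norm_num) hI)
      exact (if_pos hIg).ge
    · exact Finset.sum_nonneg fun _ _ => by split_ifs <;> norm_num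
  obtain ⟨I, hI, hIg⟩ : ∃ I ∈ (Finset.range (m + 1)).powersetCard k, c₀ / 2 ^ (m + 1) ≤
      ∑ g, ∑ b, ∑ r, Q g * Q b * Q r * (if Good I g b r then 1 else 0) := by
    by_contra hcon
    push Not at hcon
    have hne : ((Finset.range (m + 1)).powersetCard k).Nonempty := by
      by_contra hne
      rw [Finset.not_nonempty_iff_eq_empty] at hne
      rw [hne, Finset.sum_empty] at hsum
      linarith
    have h9 := Finset.sum_lt_sum_of_nonempty hne hcon
    have h10 : ∑ I ∈ (Finset.range (m + 1)).powersetCard k, c₀ / 2 ^ (m + 1) ≤ c₀ := by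
      rw [Finset.sum_const, nsmul_eq_mul, Finset.card_powersetCard, Finset.card_range]
      have : (((m + 1).choose k : ℕ) : ℝ) ≤ 2 ^ (m + 1) := by
        exact_mod_cast Nat.choose_le_two_pow (m + 1) k
      have hp : (0 : ℝ) < 2 ^ (m + 1) := by positivity
      rw [← mul_div_assoc, div_le_iff₀ hp, mul_comm]
      exact mul_le_mul_of_nonneg_left this hc₀.le
    linarith
  obtain ⟨hIs, hIc⟩ := Finset.mem_powersetCard.mp hI
  set e := I.orderEmbOfFin hIc with he
  have heI : ∀ i, e i ∈ I := fun i => Finset.orderEmbOfFin_mem _ _ _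
  have hlt : ∀ i, e i < m + 1 := fun i => Finset.mem_range.mp (hIs (heI i))
  refine ⟨fun i => ⟨e i, hlt i⟩, fun i j hij => e.strictMono hij, ?_⟩
  have hof : ∀ i, Fin.ofNat (m + 1) (e i) = ⟨e i, hlt i⟩ := fun i =>
    Fin.ext (Nat.mod_eq_of_lt (hlt i))
  let ι : Pair k → Fin 3 × P := fun x => (φ x.1.1 x.1.2, p (e x.1.1) (e x.1.2))
  have hι : Function.Injective ι := by
    intro x y hxy
    have h1 := congrArg (fun z : Fin 3 × P => z.2.1.1) hxy
    have h2 := congrArg (fun z : Fin 3 × P => z.2.2.1) hxy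
    simp only [ι, p, hof] at h1 h2
    exact Subtype.ext (Prod.ext (e.injective h1) (e.injective h2))
  have hmarg := sum_prod_comp_injective hι (fun a c => q a.2.1 a.2.2 c) (fun a => hq1 _ _)
    (fun χ : Pair k → C => ∏ t : Trip φ, f (χ t.p01) (χ t.p02) (χ t.p12))
  have hιq : ∀ x : Pair k, q ((ι x).2.1 : ℕ) ((ι x).2.2 : ℕ) = q (e x.1.1) (e x.1.2) := by
    intro x
    simp only [ι, p, hof]
  simp only [hιq] at hmarg
  rw [← hmarg]
  let E : (P → C) × (P → C) × (P → C) ≃ (Fin 3 × P → C) :=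
    { toFun := fun z a => (![z.2.2, z.2.1, z.1] a.1) a.2
      invFun := fun ω => (fun x => ω (2, x), fun x => ω (1, x), fun x => ω (0, x))
      left_inv := fun z => rfl
      right_inv := fun ω => by
        funext ⟨a, x⟩
        fin_cases a <;> rfl }
  rw [← E.sum_comp, Fintype.sum_prod_type]
  simp_rw [Fintype.sum_prod_type]
  refine (mul_le_mul_of_nonneg_right hIg (by positivity)).trans ?_
  simp_rw [Finset.sum_mul]
  refine Finset.sum_le_sum fun g _ => Finset.sum_le_sum fun b _ => Finset.sum_le_sum fun r _ => ?_
  have hprod : ∏ a : Fin 3 × P, q a.2.1 a.2.2 (E (g, b, r) a) = Q g * Q b * Q r := by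
    rw [Fintype.prod_prod_type, Fin.prod_univ_three]
    change Q r * Q b * Q g = Q g * Q b * Q r
    ring
  rw [hprod, mul_assoc]
  refine mul_le_mul_of_nonneg_left ?_ (mul_nonneg (mul_nonneg (hQ g) (hQ b)) (hQ r))
  split_ifs with hg
  · rw [one_mul, ← Finset.card_univ, ← Finset.prod_const]
    refine Finset.prod_le_prod (fun _ _ => hε0.le) fun t _ => (min_le_left _ _).trans ?_
    have := hg (e t.1.1) (heI _) (e t.1.2.1) (heI _) (e t.1.2.2) (heI _)
      (e.strictMono t.2.1.1) (e.strictMono t.2.1.2)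
    have e0 : φ t.1.1 t.1.2.1 = 0 := t.2.2.1
    have e1 : φ t.1.1 t.1.2.2 = 1 := t.2.2.2.1
    have e2 : φ t.1.2.1 t.1.2.2 = 2 := t.2.2.2.2
    simp only [ι, e0, e1, e2]
    exact this
  · rw [zero_mul]
    exact Finset.prod_nonneg fun _ _ => hf0 _ _ _

open scoped Classical in
/-- The average of `g` over the fibre of `T` above `z`. -/
noncomputable def fibreAvg {X Z : Type*} [Fintype X] (T : X → Z) (g : X → ℝ) (z : Z) : ℝ :=
  (∑ x with T x = z, g x) / (Finset.univ.filter fun x => T x = z).card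

section fibreAvg
variable {X Z : Type*} [Fintype X] (T : X → Z) (g : X → ℝ)

theorem fibreAvg_nonneg (hg : ∀ x, 0 ≤ g x) (z : Z) : 0 ≤ fibreAvg T g z :=
  div_nonneg (Finset.sum_nonneg fun x _ => hg x) (Nat.cast_nonneg _)

theorem fibreAvg_le_one (hg : ∀ x, g x ≤ 1) (z : Z) : fibreAvg T g z ≤ 1 := by
  refine div_le_one_of_le₀ ?_ (Nat.cast_nonneg _)
  refine (Finset.sum_le_sum fun x _ => hg x).trans ?_
  simp

open scoped Classical in
theorem card_mul_fibreAvg (z : Z) :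
    ((Finset.univ.filter fun x => T x = z).card : ℝ) * fibreAvg T g z =
      ∑ x with T x = z, g x := by
  unfold fibreAvg
  by_cases h : (Finset.univ.filter fun x => T x = z).card = 0
  · rw [h, Nat.cast_zero, zero_mul, Finset.card_eq_zero.mp h, Finset.sum_empty]
  · rw [mul_div_cancel₀]
    exact_mod_cast h

theorem sum_fibreAvg_mul [Fintype Z] (v : Z → ℝ) :
    ∑ x, fibreAvg T g (T x) * v (T x) = ∑ x, g x * v (T x) := by
  classical
  rw [← Finset.sum_fiberwise (s := Finset.univ) (g := T),
    ← Finset.sum_fiberwise (s := Finset.univ) (g := T) (f := fun x => g x * v (T x))]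
  refine Finset.sum_congr rfl fun z _ => ?_
  have h1 : ∑ x with T x = z, g x * v (T x) = (∑ x with T x = z, g x) * v z := by
    rw [Finset.sum_mul]
    refine Finset.sum_congr rfl fun x hx => ?_
    rw [(Finset.mem_filter.mp hx).2]
  have h2 : ∑ x with T x = z, fibreAvg T g (T x) * v (T x) =
      ∑ x with T x = z, fibreAvg T g z * v z := by
    refine Finset.sum_congr rfl fun x hx => ?_
    rw [(Finset.mem_filter.mp hx).2]
  rw [h1, h2, Finset.sum_const, nsmul_eq_mul, ← mul_assoc]
  congr 1
  convert card_mul_fibreAvg T g z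

theorem sum_sub_fibreAvg_mul [Fintype Z] (v : Z → ℝ) :
    ∑ x, (g x - fibreAvg T g (T x)) * v (T x) = 0 := by
  simp_rw [sub_mul]
  rw [Finset.sum_sub_distrib, sum_fibreAvg_mul, sub_self]

theorem sum_sq_sub_fibreAvg_le [Fintype Z] (u : Z → ℝ) :
    ∑ x, (g x - fibreAvg T g (T x)) ^ 2 ≤ ∑ x, (g x - u (T x)) ^ 2 := by
  have h := sum_sub_fibreAvg_mul T g fun z => fibreAvg T g z - u z
  have : ∑ x, (g x - u (T x)) ^ 2 = ∑ x, (g x - fibreAvg T g (T x)) ^ 2 +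
      2 * ∑ x, (g x - fibreAvg T g (T x)) * (fibreAvg T g (T x) - u (T x)) +
      ∑ x, (fibreAvg T g (T x) - u (T x)) ^ 2 := by
    rw [Finset.mul_sum, ← Finset.sum_add_distrib, ← Finset.sum_add_distrib]
    refine Finset.sum_congr rfl fun x _ => ?_
    ring
  rw [this, h]
  have : 0 ≤ ∑ x, (fibreAvg T g (T x) - u (T x)) ^ 2 := Finset.sum_nonneg fun _ _ => sq_nonneg _
  linarith

end fibreAvg

/-- The cell of `x` for the colouring `κ` along three projections. -/
abbrev cell {X Y C : Type*} (π : Fin 3 → X → Y) (κ : Y → C) (x : X) : C × C × C :=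
  (κ (π 0 x), κ (π 1 x), κ (π 2 x))

theorem exists_regular (r : ℕ) {ε : ℝ} (hε : 0 < ε) (Φ : ℕ → ℕ) : ∃ B : ℕ,
    ∀ (X Y J : Type) [Fintype X] [Fintype Y] [Fintype J], Fintype.card J = r →
    ∀ (π : Fin 3 → X → Y) (g : J → X → ℝ), (∀ j x, 0 ≤ g j x) → (∀ j x, g j x ≤ 1) →
    ∃ K, 0 < K ∧ K ≤ B ∧ ∃ κ : Y → Fin K, ∀ (D : Type) [Fintype D] (τ : Y → D),
      K * Fintype.card D ≤ Φ K → ∀ θ : Fin K × D → Fin K × D → Fin K × D → ℝ,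
      (∀ a b c, |θ a b c| ≤ 1) → ∀ j,
      |∑ x, (g j x - fibreAvg (cell π κ) (g j) (cell π κ x)) *
        θ (κ (π 0 x), τ (π 0 x)) (κ (π 1 x), τ (π 1 x)) (κ (π 2 x), τ (π 2 x))| ≤
      ε * Fintype.card X := by
  obtain ⟨N, hN⟩ := exists_nat_gt ((r : ℝ) / ε ^ 2)
  have hε2 : 0 < ε ^ 2 := by positivity
  have hN0 : (0 : ℝ) < N := lt_of_le_of_lt (by positivity) hN
  rw [div_lt_iff₀ hε2] at hN
  obtain ⟨Ks, hKs0, hKs⟩ : ∃ Ks : ℕ → ℕ, Ks 0 = 1 ∧ ∀ i, Ks (i + 1) = max 1 (Φ (Ks i)) :=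
    ⟨fun i => Nat.rec 1 (fun _ K => max 1 (Φ K)) i, rfl, fun _ => rfl⟩
  have hK0 : ∀ i, 0 < Ks i := by
    intro i
    cases i with
    | zero => exact hKs0 ▸ Nat.one_pos
    | succ i => exact hKs i ▸ lt_of_lt_of_le Nat.one_pos (le_max_left _ _)
  refine ⟨∑ i ∈ Finset.range N, Ks i, fun X Y J _ _ _ hJ π g hg0 hg1 => ?_⟩
  classical
  let En : ∀ {K : ℕ}, (Y → Fin K) → ℝ := fun κ =>
    ∑ j, ∑ x, (g j x - fibreAvg (cell π κ) (g j) (cell π κ x)) ^ 2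
  have hmin : ∀ i, ∃ κ : Y → Fin (Ks i), ∀ κ' : Y → Fin (Ks i), En κ ≤ En κ' := by
    intro i
    have : Nonempty (Fin (Ks i)) := ⟨⟨0, hK0 i⟩⟩
    obtain ⟨κ, _, hκ⟩ := Finset.exists_min_image (Finset.univ : Finset (Y → Fin (Ks i)))
      (fun κ => En κ) Finset.univ_nonempty
    exact ⟨κ, fun κ' => hκ κ' (Finset.mem_univ _)⟩
  choose κ hκ using hmin
  have hEn0 : ∀ i, 0 ≤ En (κ i) := fun i =>
    Finset.sum_nonneg fun _ _ => Finset.sum_nonneg fun _ _ => sq_nonneg _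
  have hEn1 : En (κ 0) ≤ r * Fintype.card X := by
    have h1 : ∀ j, ∑ x, (g j x - fibreAvg (cell π (κ 0)) (g j) (cell π (κ 0) x)) ^ 2 ≤
        Fintype.card X := by
      intro j
      refine (sum_sq_sub_fibreAvg_le (cell π (κ 0)) (g j) fun _ => 0).trans ?_
      calc ∑ x, (g j x - 0) ^ 2 ≤ ∑ x : X, (1 : ℝ) := Finset.sum_le_sum fun x _ => by
            rw [sub_zero]
            exact pow_le_one₀ (hg0 j x) (hg1 j x)
        _ = _ := by simp
    calc En (κ 0) ≤ ∑ j : J, (Fintype.card X : ℝ) := Finset.sum_le_sum fun j _ => h1 j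
      _ = _ := by rw [Finset.sum_const, nsmul_eq_mul, Finset.card_univ, hJ]
  obtain ⟨i, hiN, hi⟩ : ∃ i ∈ Finset.range N,
      En (κ i) - En (κ (i + 1)) ≤ r * Fintype.card X / N := by
    by_contra hcon
    push Not at hcon
    have hne : (Finset.range N).Nonempty := by
      rw [Finset.nonempty_range_iff]
      rintro rfl
      simp at hN0
    have h1 := Finset.sum_lt_sum_of_nonempty hne hcon
    rw [Finset.sum_range_sub', Finset.sum_const, nsmul_eq_mul, Finset.card_range,
      mul_div_cancel₀ _ hN0.ne'] at h1
    linarith [hEn0 N]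
  refine ⟨Ks i, hK0 i, Finset.single_le_sum (fun _ _ => Nat.zero_le _) hiN, κ i, ?_⟩
  intro D _ τ hD θ hθ j
  have hcard : Fintype.card (Fin (Ks i) × D) ≤ Fintype.card (Fin (Ks (i + 1))) := by
    rw [Fintype.card_prod, Fintype.card_fin, Fintype.card_fin, hKs]
    exact hD.trans (le_max_right _ _)
  obtain ⟨e⟩ := Function.Embedding.nonempty_of_card_le hcard
  let θx : X → ℝ := fun x => θ (κ i (π 0 x), τ (π 0 x)) (κ i (π 1 x), τ (π 1 x))
    (κ i (π 2 x), τ (π 2 x))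
  let G : X → ℝ := fun x => g j x - fibreAvg (cell π (κ i)) (g j) (cell π (κ i) x)
  have hone : ∀ s : ℝ, (s = 1 ∨ s = -1) → s * ∑ x, G x * θx x ≤ ε * Fintype.card X := by
    intro s hs
    have hs2 : s ^ 2 = 1 := by rcases hs with rfl | rfl <;> norm_num
    let κ' : Y → Fin (Ks (i + 1)) := fun y => e (κ i y, τ y)
    have hcomp : ∀ u : (Fin (Ks i) × D) → (Fin (Ks i) × D) → (Fin (Ks i) × D) → ℝ,
        ∃ u' : Fin (Ks (i + 1)) × Fin (Ks (i + 1)) × Fin (Ks (i + 1)) → ℝ, ∀ a b c,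
        u' (e a, e b, e c) = u a b c := by
      intro u
      have hinj : Function.Injective (fun z : (Fin (Ks i) × D) × (Fin (Ks i) × D) ×
          (Fin (Ks i) × D) => (e z.1, e z.2.1, e z.2.2)) := by
        rintro ⟨a, b, c⟩ ⟨a', b', c'⟩ h
        simp only [Prod.mk.injEq, EmbeddingLike.apply_eq_iff_eq] at h
        obtain ⟨rfl, rfl, rfl⟩ := h
        rfl
      refine ⟨Function.extend (fun z : (Fin (Ks i) × D) × (Fin (Ks i) × D) ×
          (Fin (Ks i) × D) => (e z.1, e z.2.1, e z.2.2)) (fun z => u z.1 z.2.1 z.2.2) 0, ?_⟩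
      intro a b c
      exact hinj.extend_apply _ _ (a, b, c)
    have hle : ∀ j', ∑ x, (g j' x - fibreAvg (cell π κ') (g j') (cell π κ' x)) ^ 2 ≤
        ∑ x, (g j' x - (fibreAvg (cell π (κ i)) (g j') (cell π (κ i) x) +
          (if j' = j then s * ε else 0) * θx x)) ^ 2 := by
      intro j'
      obtain ⟨u', hu'⟩ := hcomp fun a b c => fibreAvg (cell π (κ i)) (g j') (a.1, b.1, c.1) +
        (if j' = j then s * ε else 0) * θ a b c
      refine (sum_sq_sub_fibreAvg_le (cell π κ') (g j') u').trans_eq ?_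
      refine Finset.sum_congr rfl fun x _ => ?_
      rw [hu']
    have hstep : En (κ (i + 1)) ≤ En (κ i) - 2 * (s * ε) * ∑ x, G x * θx x +
        ε ^ 2 * Fintype.card X := by
      refine (hκ (i + 1) κ').trans ((Finset.sum_le_sum fun j' _ => hle j').trans ?_)
      have hsplit : ∀ j', ∑ x, (g j' x - (fibreAvg (cell π (κ i)) (g j') (cell π (κ i) x) +
          (if j' = j then s * ε else 0) * θx x)) ^ 2 =
          ∑ x, (g j' x - fibreAvg (cell π (κ i)) (g j') (cell π (κ i) x)) ^ 2 +
          (if j' = j then - 2 * (s * ε) * ∑ x, G x * θx x + ε ^ 2 * ∑ x, θx x ^ 2 else 0) := by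
        intro j'
        split_ifs with hj
        · subst hj
          rw [Finset.mul_sum, Finset.mul_sum, ← Finset.sum_add_distrib,
            ← Finset.sum_add_distrib]
          refine Finset.sum_congr rfl fun x _ => ?_
          simp only [G]
          linear_combination (ε ^ 2 * θx x ^ 2) * hs2
        · simp
      rw [Finset.sum_congr rfl fun j' _ => hsplit j', Finset.sum_add_distrib,
        Finset.sum_ite_eq' Finset.univ j, if_pos (Finset.mem_univ j)]
      have hθ2 : ∑ x, θx x ^ 2 ≤ Fintype.card X := by
        calc ∑ x, θx x ^ 2 ≤ ∑ x : X, (1 : ℝ) := Finset.sum_le_sum fun x _ => by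
              rw [← sq_abs]
              exact pow_le_one₀ (abs_nonneg _) (hθ _ _ _)
          _ = _ := by simp
      have := mul_le_mul_of_nonneg_left hθ2 hε2.le
      change En (κ i) + _ ≤ _
      linarith
    have hr : (r : ℝ) * Fintype.card X / N ≤ ε ^ 2 * Fintype.card X := by
      rw [div_le_iff₀ hN0]
      have := mul_le_mul_of_nonneg_right hN.le (Nat.cast_nonneg (α := ℝ) (Fintype.card X))
      linarith
    have hfin : ε * (s * ∑ x, G x * θx x) ≤ ε * (ε * Fintype.card X) := by linarith
    exact le_of_mul_le_mul_left hfin hε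
  rw [abs_le]
  have h1 := hone 1 (Or.inl rfl)
  have h2 := hone (-1) (Or.inr rfl)
  change -(ε * Fintype.card X) ≤ ∑ x, G x * θx x ∧ ∑ x, G x * θx x ≤ ε * Fintype.card X
  constructor <;> linarith

open scoped Classical in
theorem abs_sum_mul_le_of_indicator {X Y : Type*} [Fintype X] [Fintype Y] (p : X → Y)
    (G : X → ℝ) {B : ℝ}
    (h : ∀ s : Y → Bool, |∑ x, G x * (if s (p x) = true then 1 else 0)| ≤ B) (a : Y → ℝ)
    (ha0 : ∀ y, 0 ≤ a y) (ha1 : ∀ y, a y ≤ 1) : |∑ x, G x * a (p x)| ≤ B := by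
  have key : ∀ v : Y → ℝ, ∀ G : X → ℝ, ∑ x, G x * v (p x) =
      ∑ y, v y * ∑ x with p x = y, G x := by
    intro v G
    rw [← Finset.sum_fiberwise (s := Finset.univ) (g := p)]
    refine Finset.sum_congr rfl fun y _ => ?_
    rw [Finset.mul_sum]
    refine Finset.sum_congr rfl fun x hx => ?_
    rw [(Finset.mem_filter.mp hx).2, mul_comm]
  have up : ∀ G : X → ℝ, ∃ s : Y → Bool,
      ∑ x, G x * a (p x) ≤ ∑ x, G x * (if s (p x) = true then 1 else 0) := by
    intro G
    refine ⟨fun y => decide (0 ≤ ∑ x with p x = y, G x), ?_⟩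
    rw [key a, key fun y => if decide (0 ≤ ∑ x with p x = y, G x) = true then 1 else 0]
    refine Finset.sum_le_sum fun y _ => ?_
    by_cases hy : 0 ≤ ∑ x with p x = y, G x
    · rw [if_pos (decide_eq_true hy)]
      exact mul_le_mul_of_nonneg_right (ha1 y) hy
    · rw [if_neg (by simpa using hy), zero_mul]
      exact mul_nonpos_of_nonneg_of_nonpos (ha0 y) (not_le.mp hy).le
  rw [abs_le]
  constructor
  · obtain ⟨s, hs⟩ := up fun x => - G x
    have := (abs_le.mp (h s)).1
    simp only [neg_mul, Finset.sum_neg_distrib] at hs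
    linarith
  · obtain ⟨s, hs⟩ := up G
    exact hs.trans (abs_le.mp (h s)).2

theorem abs_sum_mul_tests_le {X Y : Type*} [Fintype X] [Fintype Y] (π : Fin 3 → X → Y)
    (G : X → ℝ) {B : ℝ}
    (h : ∀ s t u : Y → Bool, |∑ x, G x * (if s (π 0 x) = true then 1 else 0) *
      (if t (π 1 x) = true then 1 else 0) * (if u (π 2 x) = true then 1 else 0)| ≤ B)
    (a b c : Y → ℝ) (ha : ∀ y, 0 ≤ a y ∧ a y ≤ 1) (hb : ∀ y, 0 ≤ b y ∧ b y ≤ 1)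
    (hc : ∀ y, 0 ≤ c y ∧ c y ≤ 1) :
    |∑ x, G x * a (π 0 x) * b (π 1 x) * c (π 2 x)| ≤ B := by
  refine abs_sum_mul_le_of_indicator (π 2) (fun x => G x * a (π 0 x) * b (π 1 x)) (fun u => ?_) c
    (fun y => (hc y).1) fun y => (hc y).2
  have e1 : ∀ x, G x * a (π 0 x) * b (π 1 x) * (if u (π 2 x) = true then 1 else 0) =
    G x * a (π 0 x) * (if u (π 2 x) = true then 1 else 0) * b (π 1 x) := fun x => by ring
  simp_rw [e1]
  refine abs_sum_mul_le_of_indicator (π 1) (fun x => G x * a (π 0 x) *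
    (if u (π 2 x) = true then 1 else 0)) (fun t => ?_) b (fun y => (hb y).1) fun y => (hb y).2
  have e2 : ∀ x, G x * a (π 0 x) * (if u (π 2 x) = true then 1 else 0) *
    (if t (π 1 x) = true then 1 else 0) = G x * (if u (π 2 x) = true then 1 else 0) *
    (if t (π 1 x) = true then 1 else 0) * a (π 0 x) := fun x => by ring
  simp_rw [e2]
  refine abs_sum_mul_le_of_indicator (π 0) (fun x => G x * (if u (π 2 x) = true then 1 else 0) *
    (if t (π 1 x) = true then 1 else 0)) (fun s => ?_) a (fun y => (ha y).1) fun y => (ha y).2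
  refine le_of_eq_of_le ?_ (h s t u)
  congr 1
  refine Finset.sum_congr rfl fun x _ => ?_
  ring

theorem sum_triple {V : Type} [Fintype V] (F : V × V × V → ℝ) :
    ∑ x, F x = ∑ u, ∑ v, ∑ w, F (u, v, w) := by
  simp_rw [Fintype.sum_prod_type]

theorem abs_mul_le_one {a b : ℝ} (ha : |a| ≤ 1) (hb : |b| ≤ 1) : |a * b| ≤ 1 := by
  rw [abs_mul]
  exact mul_le_one₀ ha (abs_nonneg _) hb

theorem abs_ite_le_one (p : Prop) [Decidable p] : |(if p then (1 : ℝ) else 0)| ≤ 1 := by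
  split_ifs <;> simp

theorem exists_pair_coloring {ε : ℝ} (hε : 0 < ε) (Lm : ℕ → ℕ) : ∃ B : ℕ,
    ∀ (V : Type) [Fintype V] (h : V → V → V → ℝ), (∀ u v w, 0 ≤ h u v w ∧ h u v w ≤ 1) →
    ∃ K, 0 < K ∧ K ≤ B ∧ ∃ (κ : V → V → Fin K) (f : Fin K → Fin K → Fin K → ℝ),
      (∀ a b c, 0 ≤ f a b c ∧ f a b c ≤ 1) ∧
      (∀ a b c : V → V → ℝ, (∀ x y, 0 ≤ a x y ∧ a x y ≤ 1) → (∀ x y, 0 ≤ b x y ∧ b x y ≤ 1) →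
        (∀ x y, 0 ≤ c x y ∧ c x y ≤ 1) →
        |∑ u, ∑ v, ∑ w, (h u v w - f (κ u v) (κ u w) (κ v w)) * a u v * b u w * c v w| ≤
          ε * (Fintype.card V : ℝ) ^ 3) ∧
      (∀ L ≤ Lm K, ∀ (ν : V → Fin L) (σ : Fin L → Fin L → Fin L → ℝ), (∀ a b c, |σ a b c| ≤ 1) →
        |∑ u, ∑ v, ∑ w, (h u v w - f (κ u v) (κ u w) (κ v w)) * σ (ν u) (ν v) (ν w)| ≤
          ε * (Fintype.card V : ℝ) ^ 3) := by
  obtain ⟨B, hB⟩ := exists_regular 1 hε (fun K => K * 8 + K * Lm K ^ 2)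
  refine ⟨B, fun V _ h hh => ?_⟩
  let π : Fin 3 → V × V × V → V × V :=
    ![fun x => (x.1, x.2.1), fun x => (x.1, x.2.2), fun x => (x.2.1, x.2.2)]
  obtain ⟨K, hK, hKB, κ, hκ⟩ := hB (V × V × V) (V × V) Unit rfl π
    (fun _ x => h x.1 x.2.1 x.2.2) (fun _ x => (hh _ _ _).1) (fun _ x => (hh _ _ _).2)
  have hcard : (Fintype.card (V × V × V) : ℝ) = (Fintype.card V : ℝ) ^ 3 := by
    simp only [Fintype.card_prod]
    push_cast
    ring
  rw [hcard] at hκ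
  refine ⟨K, hK, hKB, fun u v => κ (u, v), fun a b c => fibreAvg (cell π κ)
    (fun x => h x.1 x.2.1 x.2.2) (a, b, c), fun a b c =>
    ⟨fibreAvg_nonneg _ _ (fun x => (hh _ _ _).1) _, fibreAvg_le_one _ _ (fun x => (hh _ _ _).2) _⟩,
    ?_, ?_⟩
  · intro a b c ha hb hc
    have := abs_sum_mul_tests_le π (fun x => h x.1 x.2.1 x.2.2 - fibreAvg (cell π κ)
      (fun x => h x.1 x.2.1 x.2.2) (cell π κ x)) (B := ε * (Fintype.card V : ℝ) ^ 3)
      (fun s t u => by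
        have := hκ (Bool × Bool × Bool) (fun y => (s y, t y, u y))
          (by simp only [Fintype.card_prod, Fintype.card_bool]; omega)
          (fun x y z => (if x.2.1 = true then 1 else 0) * (if y.2.2.1 = true then 1 else 0) *
            (if z.2.2.2 = true then 1 else 0))
          (fun x y z => abs_mul_le_one (abs_mul_le_one (abs_ite_le_one _) (abs_ite_le_one _))
            (abs_ite_le_one _)) ()
        simpa only [mul_assoc] using this)
      (fun y => a y.1 y.2) (fun y => b y.1 y.2) (fun y => c y.1 y.2)
      (fun y => ha _ _) (fun y => hb _ _) (fun y => hc _ _)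
    rw [sum_triple] at this
    exact this
  · intro L hL ν σ hσ
    have := hκ (Fin L × Fin L) (fun y => (ν y.1, ν y.2))
      (by
        simp only [Fintype.card_prod, Fintype.card_fin]
        have : K * (L * L) ≤ K * Lm K ^ 2 := by
          rw [← pow_two]
          exact Nat.mul_le_mul_left _ (Nat.pow_le_pow_left hL 2)
        omega)
      (fun x y z => σ x.2.1 x.2.2 y.2.2) (fun x y z => hσ _ _ _) ()
    rw [sum_triple] at this
    exact this

theorem exists_vertex_coloring (K : ℕ) (hK : 0 < K) {ε : ℝ} (hε : 0 < ε) : ∃ B : ℕ,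
    ∀ (V : Type) [Fintype V] (κ : V → V → Fin K),
    ∃ L, 0 < L ∧ L ≤ B ∧ ∃ (ν : V → Fin L) (p : Fin L → Fin L → Fin K → ℝ),
      (∀ a b c, 0 ≤ p a b c) ∧ (∀ a b, ∑ c, p a b c = 1) ∧
      ∀ (c : Fin K) (θ : Fin L → Fin L → ℝ), (∀ a b, |θ a b| ≤ 1) →
        ∀ a b : V → ℝ, (∀ x, 0 ≤ a x ∧ a x ≤ 1) → (∀ x, 0 ≤ b x ∧ b x ≤ 1) →
        |∑ u, ∑ v, ((if κ u v = c then 1 else 0) - p (ν u) (ν v) c) * θ (ν u) (ν v) *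
          a u * b v| ≤ ε * (Fintype.card V : ℝ) ^ 2 := by
  classical
  obtain ⟨B, hB⟩ := exists_regular K hε (fun L => L * 8)
  refine ⟨B, fun V _ κ => ?_⟩
  let π : Fin 3 → V × V → V := ![fun x => x.1, fun x => x.2, fun x => x.1]
  let g : Fin K → V × V → ℝ := fun c x => if κ x.1 x.2 = c then 1 else 0
  have hg0 : ∀ c x, 0 ≤ g c x := fun c x => by simp only [g]; split_ifs <;> norm_num
  have hg1 : ∀ c x, g c x ≤ 1 := fun c x => by simp only [g]; split_ifs <;> norm_num
  obtain ⟨L, hL, hLB, ν, hν⟩ := hB (V × V) V (Fin K) (Fintype.card_fin K) π g hg0 hg1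
  have hcard : (Fintype.card (V × V) : ℝ) = (Fintype.card V : ℝ) ^ 2 := by
    rw [Fintype.card_prod]
    push_cast
    ring
  rw [hcard] at hν
  let p : Fin L → Fin L → Fin K → ℝ := fun a b c =>
    if (Finset.univ.filter fun x => cell π ν x = (a, b, a)).Nonempty then
      fibreAvg (cell π ν) (g c) (a, b, a) else if c = ⟨0, hK⟩ then 1 else 0
  have hp : ∀ (c : Fin K) (u v : V), p (ν u) (ν v) c =
      fibreAvg (cell π ν) (g c) (cell π ν (u, v)) := by
    intro c u v
    have : cell π ν (u, v) = (ν u, ν v, ν u) := rfl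
    rw [this]
    exact if_pos ⟨(u, v), Finset.mem_filter.mpr ⟨Finset.mem_univ _, rfl⟩⟩
  refine ⟨L, hL, hLB, ν, p, ?_, ?_, ?_⟩
  · intro a b c
    simp only [p]
    split_ifs
    · exact fibreAvg_nonneg _ _ (hg0 c) _
    · norm_num
    · norm_num
  · intro a b
    simp only [p]
    split_ifs with hne
    · unfold fibreAvg
      rw [← Finset.sum_div, Finset.sum_comm]
      have : ∀ x : V × V, ∑ c, g c x = 1 := by
        intro x
        simp only [g]
        rw [Finset.sum_ite_eq, if_pos (Finset.mem_univ _)]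
      simp_rw [this]
      rw [Finset.sum_const, nsmul_eq_mul, mul_one]
      refine div_self ?_
      have := Finset.card_pos.mpr hne
      convert (Nat.cast_ne_zero (R := ℝ)).mpr this.ne'
    · rw [Finset.sum_ite_eq', if_pos (Finset.mem_univ _)]
  · intro c θ hθ a b ha hb
    have := abs_sum_mul_tests_le π (fun x => (g c x - fibreAvg (cell π ν)
      (g c) (cell π ν x)) * θ (ν x.1) (ν x.2)) (B := ε * (Fintype.card V : ℝ) ^ 2)
      (fun s t u => by
        have := hν (Bool × Bool × Bool) (fun y => (s y, t y, u y))
          (by simp only [Fintype.card_prod, Fintype.card_bool]; omega)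
          (fun x y z => θ x.1 y.1 * (if x.2.1 = true then 1 else 0) *
            (if y.2.2.1 = true then 1 else 0) *
            (if z.2.2.2 = true then 1 else 0))
          (fun x y z => abs_mul_le_one (abs_mul_le_one (abs_mul_le_one (hθ _ _)
            (abs_ite_le_one _)) (abs_ite_le_one _)) (abs_ite_le_one _)) c
        simp only [← mul_assoc] at this
        exact this)
      a b (fun _ => 1) ha hb (fun _ => ⟨zero_le_one, le_rfl⟩)
    simp only [mul_one] at this
    rw [Fintype.sum_prod_type] at this
    simp_rw [hp]
    exact this

theorem abs_sum_prod_sub_prod_le {Ω E : Type*} [Fintype Ω] [Fintype E] [DecidableEq E]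
    (w : Ω → ℝ) (A B : E → Ω → ℝ) {β : ℝ}
    (h : ∀ e, ∀ C : E → Ω → ℝ, (∀ e', C e' = A e' ∨ C e' = B e') →
      |∑ x, w x * ((A e x - B e x) * ∏ e' ∈ Finset.univ.erase e, C e' x)| ≤ β) :
    |∑ x, w x * (∏ e, A e x - ∏ e, B e x)| ≤ Fintype.card E * β := by
  have key : ∀ S : Finset E,
      |∑ x, w x * (∏ e, (if e ∈ S then A e x else B e x) - ∏ e, B e x)| ≤ S.card * β := by
    intro S
    induction S using Finset.induction_on with
    | empty => simp
    | insert e S he ih =>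
      have h1 := h e (fun e' => if e' ∈ S then A e' else B e') (fun e' => by
        split_ifs
        · exact Or.inl rfl
        · exact Or.inr rfl)
      have h2 : ∀ x, w x * (∏ e', (if e' ∈ insert e S then A e' x else B e' x) -
          ∏ e, B e x) = w x * ((A e x - B e x) *
          ∏ e' ∈ Finset.univ.erase e, (if e' ∈ S then A e' else B e') x) +
          w x * (∏ e, (if e ∈ S then A e x else B e x) - ∏ e, B e x) := by
        intro x
        rw [← Finset.mul_prod_erase _ _ (Finset.mem_univ e),
          ← Finset.mul_prod_erase _ (fun e => if e ∈ S then A e x else B e x) (Finset.mem_univ e),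
          if_pos (Finset.mem_insert_self _ _), if_neg he]
        have h3 : ∏ e' ∈ Finset.univ.erase e, (if e' ∈ insert e S then A e' x else B e' x) =
            ∏ e' ∈ Finset.univ.erase e, (if e' ∈ S then A e' else B e') x := by
          refine Finset.prod_congr rfl fun e' he' => ?_
          simp only [Finset.mem_insert, Finset.ne_of_mem_erase he', false_or]
          split_ifs <;> rfl
        have h4 : ∏ e' ∈ Finset.univ.erase e, (if e' ∈ S then A e' x else B e' x) =
            ∏ e' ∈ Finset.univ.erase e, (if e' ∈ S then A e' else B e') x := by
          refine Finset.prod_congr rfl fun e' _ => ?_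
          split_ifs <;> rfl
        rw [h3, h4]
        ring
      rw [Finset.sum_congr rfl fun x _ => h2 x, Finset.sum_add_distrib,
        Finset.card_insert_of_notMem he]
      refine (abs_add_le _ _).trans ?_
      push_cast
      linarith
  have := key Finset.univ
  simpa using this

section update
variable {k : ℕ} {V : Type} [Fintype V]

theorem sum_sum_update (F : (Fin k → V) → ℝ) (i : Fin k) :
    ∑ u, ∑ x, F (Function.update u i x) = Fintype.card V * ∑ u, F u := by
  let E : (Fin k → V) × V → (Fin k → V) × V := fun z => (Function.update z.1 i z.2, z.1 i)
  have hE : Function.Involutive E := by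
    rintro ⟨u, x⟩
    simp [E]
  have h1 := Equiv.sum_comp hE.toPerm (fun z : (Fin k → V) × V => F z.1)
  rw [Fintype.sum_prod_type, Fintype.sum_prod_type] at h1
  simp only [Finset.sum_const, nsmul_eq_mul, Finset.card_univ] at h1
  rw [Finset.mul_sum]
  exact h1

theorem prod_mem_unitInterval {E : Type*} (S : Finset E) (c : E → ℝ)
    (hc : ∀ e, 0 ≤ c e ∧ c e ≤ 1) : 0 ≤ ∏ e ∈ S, c e ∧ ∏ e ∈ S, c e ≤ 1 :=
  ⟨Finset.prod_nonneg fun e _ => (hc e).1, Finset.prod_le_one (fun e _ => (hc e).1)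
    fun e _ => (hc e).2⟩

theorem abs_sum_two_coords_le {E : Type*} (S : Finset E) {i j : Fin k} (hij : i ≠ j)
    (C : E → (Fin k → V) → ℝ) (hC : ∀ e u, 0 ≤ C e u ∧ C e u ≤ 1)
    (hind : ∀ e ∈ S, (∀ u x, C e (Function.update u i x) = C e u) ∨
      ∀ u x, C e (Function.update u j x) = C e u)
    (G : (Fin k → V) → ℝ) {β : ℝ}
    (hG : ∀ u, ∀ a b : V → ℝ, (∀ x, 0 ≤ a x ∧ a x ≤ 1) → (∀ x, 0 ≤ b x ∧ b x ≤ 1) →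
      |∑ x, ∑ y, G (Function.update (Function.update u i x) j y) * a x * b y| ≤
        β * (Fintype.card V : ℝ) ^ 2) :
    |∑ u, G u * ∏ e ∈ S, C e u| ≤ β * (Fintype.card V : ℝ) ^ k := by
  classical
  rcases isEmpty_or_nonempty V with hV | hV
  · have : IsEmpty (Fin k → V) := ⟨fun u => hV.elim (u i)⟩
    have hk : k ≠ 0 := by rintro rfl; exact i.elim0
    simp [hk]
  have hn : (0 : ℝ) < Fintype.card V := by exact_mod_cast Fintype.card_pos
  have h1 := sum_sum_update (fun u => G u * ∏ e ∈ S, C e u) j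
  have h2 := sum_sum_update (fun u => ∑ y, G (Function.update u j y) *
    ∏ e ∈ S, C e (Function.update u j y)) i
  rw [h1] at h2
  have h3 : ∀ u, |∑ x, ∑ y, G (Function.update (Function.update u i x) j y) *
      ∏ e ∈ S, C e (Function.update (Function.update u i x) j y)| ≤
      β * (Fintype.card V : ℝ) ^ 2 := by
    intro u
    let P : E → Prop := fun e => ∀ u x, C e (Function.update u j x) = C e u
    have := hG u (fun x => ∏ e ∈ S with P e, C e (Function.update u i x))
      (fun y => ∏ e ∈ S with ¬ P e, C e (Function.update u j y))
      (fun x => prod_mem_unitInterval _ _ fun e => hC e _)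
      (fun x => prod_mem_unitInterval _ _ fun e => hC e _)
    refine le_of_eq_of_le ?_ this
    congr 1
    refine Finset.sum_congr rfl fun x _ => Finset.sum_congr rfl fun y _ => ?_
    rw [mul_assoc, ← Finset.prod_filter_mul_prod_filter_not S P]
    congr 2
    · refine Finset.prod_congr rfl fun e he => ?_
      exact (Finset.mem_filter.mp he).2 _ _
    · refine Finset.prod_congr rfl fun e he => ?_
      obtain ⟨he1, he2⟩ := Finset.mem_filter.mp he
      rw [Function.update_comm hij]
      exact ((hind e he1).resolve_right he2) _ _
  have h4 : |(Fintype.card V : ℝ) * ((Fintype.card V : ℝ) * ∑ u, G u * ∏ e ∈ S, C e u)| ≤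
      (Fintype.card V : ℝ) ^ k * (β * (Fintype.card V : ℝ) ^ 2) := by
    rw [← h2]
    refine (Finset.abs_sum_le_sum_abs _ _).trans ((Finset.sum_le_sum fun u _ => h3 u).trans_eq ?_)
    rw [Finset.sum_const, nsmul_eq_mul, Finset.card_univ, Fintype.card_fun, Fintype.card_fin]
    push_cast
    ring
  rw [← mul_assoc, abs_mul, abs_of_pos (mul_pos hn hn)] at h4
  refine le_of_mul_le_mul_left (h4.trans_eq ?_) (mul_pos hn hn)
  ring

theorem abs_sum_three_coords_le {E : Type*} (S : Finset E) {i j l : Fin k} (hij : i ≠ j)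
    (hil : i ≠ l) (hjl : j ≠ l)
    (C : E → (Fin k → V) → ℝ) (hC : ∀ e u, 0 ≤ C e u ∧ C e u ≤ 1)
    (hind : ∀ e ∈ S, (∀ u x, C e (Function.update u i x) = C e u) ∨
      (∀ u x, C e (Function.update u j x) = C e u) ∨
      ∀ u x, C e (Function.update u l x) = C e u)
    (G : V → V → V → ℝ) {β : ℝ}
    (hG : ∀ a b c : V → V → ℝ, (∀ x y, 0 ≤ a x y ∧ a x y ≤ 1) →
      (∀ x y, 0 ≤ b x y ∧ b x y ≤ 1) → (∀ x y, 0 ≤ c x y ∧ c x y ≤ 1) →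
      |∑ x, ∑ y, ∑ z, G x y z * a x y * b x z * c y z| ≤ β * (Fintype.card V : ℝ) ^ 3) :
    |∑ u : Fin k → V, G (u i) (u j) (u l) * ∏ e ∈ S, C e u| ≤
      β * (Fintype.card V : ℝ) ^ k := by
  classical
  rcases isEmpty_or_nonempty V with hV | hV
  · have : IsEmpty (Fin k → V) := ⟨fun u => hV.elim (u i)⟩
    have hk : k ≠ 0 := by rintro rfl; exact i.elim0
    simp [hk]
  have hn : (0 : ℝ) < Fintype.card V := by exact_mod_cast Fintype.card_pos
  let F : (Fin k → V) → ℝ := fun u => G (u i) (u j) (u l) * ∏ e ∈ S, C e u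
  have h1 := sum_sum_update F l
  have h2 := sum_sum_update (fun u => ∑ z, F (Function.update u l z)) j
  have h3 := sum_sum_update (fun u => ∑ y, ∑ z,
    F (Function.update (Function.update u j y) l z)) i
  rw [h1] at h2
  rw [h2] at h3
  have h4 : ∀ u, |∑ x, ∑ y, ∑ z,
      F (Function.update (Function.update (Function.update u i x) j y) l z)| ≤
      β * (Fintype.card V : ℝ) ^ 3 := by
    intro u
    let P : E → Prop := fun e => ∀ u x, C e (Function.update u l x) = C e u
    let Q : E → Prop := fun e => ∀ u x, C e (Function.update u j x) = C e u
    have := hG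
      (fun x y => ∏ e ∈ S with P e, C e (Function.update (Function.update u i x) j y))
      (fun x z => ∏ e ∈ (S.filter fun e => ¬ P e) with Q e,
        C e (Function.update (Function.update u i x) l z))
      (fun y z => ∏ e ∈ (S.filter fun e => ¬ P e) with ¬ Q e,
        C e (Function.update (Function.update u j y) l z))
      (fun _ _ => prod_mem_unitInterval _ _ fun e => hC e _)
      (fun _ _ => prod_mem_unitInterval _ _ fun e => hC e _)
      (fun _ _ => prod_mem_unitInterval _ _ fun e => hC e _)
    refine le_of_eq_of_le ?_ this
    congr 1
    refine Finset.sum_congr rfl fun x _ => Finset.sum_congr rfl fun y _ =>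
      Finset.sum_congr rfl fun z _ => ?_
    have e1 : Function.update (Function.update (Function.update u i x) j y) l z i = x := by
      rw [Function.update_of_ne hil, Function.update_of_ne hij, Function.update_self]
    have e2 : Function.update (Function.update (Function.update u i x) j y) l z j = y := by
      rw [Function.update_of_ne hjl, Function.update_self]
    simp only [F]
    rw [e1, e2, Function.update_self, mul_assoc, mul_assoc,
      ← Finset.prod_filter_mul_prod_filter_not S P,
      ← Finset.prod_filter_mul_prod_filter_not (S.filter fun e => ¬ P e) Q]
    congr 1
    congr 1
    · refine Finset.prod_congr rfl fun e he => ?_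
      exact (Finset.mem_filter.mp he).2 _ _
    congr 1
    · refine Finset.prod_congr rfl fun e he => ?_
      rw [Function.update_comm hjl]
      exact (Finset.mem_filter.mp he).2 _ _
    · refine Finset.prod_congr rfl fun e he => ?_
      obtain ⟨he', he2⟩ := Finset.mem_filter.mp he
      obtain ⟨he1, he3⟩ := Finset.mem_filter.mp he'
      rw [Function.update_comm hij, Function.update_comm hil]
      exact (((hind e he1).resolve_right fun h => h.elim he2 he3)) _ _
  have h5 : |(Fintype.card V : ℝ) * ((Fintype.card V : ℝ) * ((Fintype.card V : ℝ) *
      ∑ u, F u))| ≤ (Fintype.card V : ℝ) ^ k * (β * (Fintype.card V : ℝ) ^ 3) := by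
    rw [← h3]
    refine (Finset.abs_sum_le_sum_abs _ _).trans ((Finset.sum_le_sum fun u _ => h4 u).trans_eq ?_)
    rw [Finset.sum_const, nsmul_eq_mul, Finset.card_univ, Fintype.card_fun, Fintype.card_fin]
    push_cast
    ring
  have hn3 : (0 : ℝ) < (Fintype.card V : ℝ) ^ 3 := by positivity
  have e : (Fintype.card V : ℝ) * ((Fintype.card V : ℝ) * ((Fintype.card V : ℝ) * ∑ u, F u)) =
    (Fintype.card V : ℝ) ^ 3 * ∑ u, F u := by ring
  rw [e, abs_mul, abs_of_pos hn3] at h5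
  refine le_of_mul_le_mul_left (h5.trans_eq ?_) hn3
  ring

end update

section counting
variable {k : ℕ} {V : Type} [Fintype V]

theorem abs_sum_triples_le {K : ℕ} (φ : Fin k → Fin k → Fin 3) (h : V → V → V → ℝ)
    (hh : ∀ u v w, 0 ≤ h u v w ∧ h u v w ≤ 1) (κ : V → V → Fin K)
    (f : Fin K → Fin K → Fin K → ℝ) (hf : ∀ a b c, 0 ≤ f a b c ∧ f a b c ≤ 1) {ε : ℝ}
    (hreg : ∀ a b c : V → V → ℝ, (∀ x y, 0 ≤ a x y ∧ a x y ≤ 1) →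
      (∀ x y, 0 ≤ b x y ∧ b x y ≤ 1) → (∀ x y, 0 ≤ c x y ∧ c x y ≤ 1) →
        |∑ u, ∑ v, ∑ w, (h u v w - f (κ u v) (κ u w) (κ v w)) * a u v * b u w * c v w| ≤
          ε * (Fintype.card V : ℝ) ^ 3) :
    |∑ u : Fin k → V, (∏ t : Trip φ, h (u t.1.1) (u t.1.2.1) (u t.1.2.2) -
      ∏ t : Trip φ, f (κ (u t.1.1) (u t.1.2.1)) (κ (u t.1.1) (u t.1.2.2))
        (κ (u t.1.2.1) (u t.1.2.2)))| ≤
      Fintype.card (Trip φ) * (ε * (Fintype.card V : ℝ) ^ k) := by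
  have := abs_sum_prod_sub_prod_le (fun _ : Fin k → V => (1 : ℝ))
    (fun t : Trip φ => fun u => h (u t.1.1) (u t.1.2.1) (u t.1.2.2))
    (fun t : Trip φ => fun u => f (κ (u t.1.1) (u t.1.2.1)) (κ (u t.1.1) (u t.1.2.2))
        (κ (u t.1.2.1) (u t.1.2.2))) (β := ε * (Fintype.card V : ℝ) ^ k) (by
    intro t C hC
    simp only [one_mul]
    have hij : t.1.1 ≠ t.1.2.1 := t.2.1.1.ne
    have hjl : t.1.2.1 ≠ t.1.2.2 := t.2.1.2.ne
    have hil : t.1.1 ≠ t.1.2.2 := (t.2.1.1.trans t.2.1.2).ne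
    refine abs_sum_three_coords_le (Finset.univ.erase t) hij hil hjl C ?_ ?_
      (fun x y z => h x y z - f (κ x y) (κ x z) (κ y z)) hreg
    · intro e u
      rcases hC e with h1 | h1 <;> rw [h1]
      · exact hh _ _ _
      · exact hf _ _ _
    · intro e he
      have hind : ∀ m : Fin k, e.1.1 ≠ m → e.1.2.1 ≠ m → e.1.2.2 ≠ m →
          ∀ u x, C e (Function.update u m x) = C e u := by
        intro m h1 h2 h3 u x
        rcases hC e with h0 | h0 <;>
          simp only [h0, Function.update_of_ne h1, Function.update_of_ne h2,
            Function.update_of_ne h3]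
      by_contra hcon
      push Not at hcon
      obtain ⟨⟨u1, x1, c1⟩, ⟨u2, x2, c2⟩, ⟨u3, x3, c3⟩⟩ := hcon
      have m1 : e.1.1 = t.1.1 ∨ e.1.2.1 = t.1.1 ∨ e.1.2.2 = t.1.1 := by
        by_contra hh
        push Not at hh
        exact c1 (hind _ hh.1 hh.2.1 hh.2.2 _ _)
      have m2 : e.1.1 = t.1.2.1 ∨ e.1.2.1 = t.1.2.1 ∨ e.1.2.2 = t.1.2.1 := by
        by_contra hh
        push Not at hh
        exact c2 (hind _ hh.1 hh.2.1 hh.2.2 _ _)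
      have m3 : e.1.1 = t.1.2.2 ∨ e.1.2.1 = t.1.2.2 ∨ e.1.2.2 = t.1.2.2 := by
        by_contra hh
        push Not at hh
        exact c3 (hind _ hh.1 hh.2.1 hh.2.2 _ _)
      refine Finset.ne_of_mem_erase he ?_
      have o1 := t.2.1.1
      have o2 := t.2.1.2
      have o3 := e.2.1.1
      have o4 := e.2.1.2
      refine Subtype.ext (Prod.ext ?_ (Prod.ext ?_ ?_)) <;> omega)
  simpa only [one_mul] using this

theorem abs_sum_pairs_le {K L : ℕ} (κ : V → V → Fin K) (ν : V → Fin L)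
    (p : Fin L → Fin L → Fin K → ℝ) (hp : ∀ a b c, 0 ≤ p a b c) (hp1 : ∀ a b, ∑ c, p a b c = 1)
    {ε : ℝ} (hε : 0 ≤ ε)
    (hreg : ∀ (c : Fin K) (θ : Fin L → Fin L → ℝ), (∀ a b, |θ a b| ≤ 1) →
      ∀ a b : V → ℝ, (∀ x, 0 ≤ a x ∧ a x ≤ 1) → (∀ x, 0 ≤ b x ∧ b x ≤ 1) →
      |∑ u, ∑ v, ((if κ u v = c then 1 else 0) - p (ν u) (ν v) c) * θ (ν u) (ν v) *
          a u * b v| ≤ ε * (Fintype.card V : ℝ) ^ 2)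
    (G : (Pair k → Fin K) → ℝ) (hG : ∀ χ, 0 ≤ G χ ∧ G χ ≤ 1)
    (σ : (Fin k → Fin L) → ℝ) (hσ : ∀ z, |σ z| ≤ 1) :
    |∑ u : Fin k → V, σ (fun i => ν (u i)) * (G (fun e => κ (u e.1.1) (u e.1.2)) -
      ∑ χ : Pair k → Fin K, (∏ e : Pair k, p (ν (u e.1.1)) (ν (u e.1.2)) (χ e)) * G χ)| ≤
      Fintype.card (Pair k → Fin K) * (Fintype.card (Pair k) *
        (ε * (Fintype.card V : ℝ) ^ k)) := by
  have hp2 : ∀ a b c, p a b c ≤ 1 := fun a b c =>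
    (hp1 a b) ▸ Finset.single_le_sum (fun c _ => hp a b c) (Finset.mem_univ c)
  have hχ : ∀ χ : Pair k → Fin K, |∑ u : Fin k → V, σ (fun i => ν (u i)) *
      (∏ e : Pair k, (if κ (u e.1.1) (u e.1.2) = χ e then (1 : ℝ) else 0) -
        ∏ e : Pair k, p (ν (u e.1.1)) (ν (u e.1.2)) (χ e))| ≤
      Fintype.card (Pair k) * (ε * (Fintype.card V : ℝ) ^ k) := by
    intro χ
    refine abs_sum_prod_sub_prod_le (fun u : Fin k → V => σ (fun i => ν (u i)))
      (fun e : Pair k => fun u => if κ (u e.1.1) (u e.1.2) = χ e then (1 : ℝ) else 0)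
      (fun e : Pair k => fun u => p (ν (u e.1.1)) (ν (u e.1.2)) (χ e)) ?_
    intro t C hC
    have hij : t.1.1 ≠ t.1.2 := t.2.ne
    have := abs_sum_two_coords_le (Finset.univ.erase t) hij C ?_ ?_
      (fun u : Fin k → V => σ (fun i => ν (u i)) *
        ((if κ (u t.1.1) (u t.1.2) = χ t then (1 : ℝ) else 0) -
          p (ν (u t.1.1)) (ν (u t.1.2)) (χ t))) (β := ε) ?_
    · simpa only [mul_assoc] using this
    · intro e u
      rcases hC e with h1 | h1 <;> rw [h1]
      · dsimp only
        split_ifs <;> norm_num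
      · exact ⟨hp _ _ _, hp2 _ _ _⟩
    · intro e he
      have hind : ∀ m : Fin k, e.1.1 ≠ m → e.1.2 ≠ m →
          ∀ u x, C e (Function.update u m x) = C e u := by
        intro m h1 h2 u x
        rcases hC e with h0 | h0 <;>
          simp only [h0, Function.update_of_ne h1, Function.update_of_ne h2]
      by_contra hcon
      push Not at hcon
      obtain ⟨⟨u1, x1, c1⟩, ⟨u2, x2, c2⟩⟩ := hcon
      have m1 : e.1.1 = t.1.1 ∨ e.1.2 = t.1.1 := by
        by_contra hh
        push Not at hh
        exact c1 (hind _ hh.1 hh.2 _ _)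
      have m2 : e.1.1 = t.1.2 ∨ e.1.2 = t.1.2 := by
        by_contra hh
        push Not at hh
        exact c2 (hind _ hh.1 hh.2 _ _)
      refine Finset.ne_of_mem_erase he ?_
      have o1 := t.2
      have o2 := e.2
      refine Subtype.ext (Prod.ext ?_ ?_) <;> omega
    · intro u a b ha hb
      have := hreg (χ t) (fun α β => σ (Function.update (Function.update (fun i => ν (u i))
        t.1.1 α) t.1.2 β)) (fun _ _ => hσ _) a b ha hb
      refine le_of_eq_of_le ?_ this
      congr 1
      refine Finset.sum_congr rfl fun x _ => Finset.sum_congr rfl fun y _ => ?_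
      rw [Function.update_of_ne hij, Function.update_self, Function.update_self]
      have e1 : (fun i => ν (Function.update (Function.update u t.1.1 x) t.1.2 y i)) =
          Function.update (Function.update (fun i => ν (u i)) t.1.1 (ν x)) t.1.2 (ν y) := by
        funext i
        by_cases h2 : i = t.1.2
        · subst h2
          simp
        by_cases h1 : i = t.1.1
        · rw [Function.update_of_ne h2, Function.update_of_ne h2, h1]
          simp
        · rw [Function.update_of_ne h2, Function.update_of_ne h2, Function.update_of_ne h1,
            Function.update_of_ne h1]
      rw [e1]
      ring
  have hdecomp : ∀ u : Fin k → V, G (fun e => κ (u e.1.1) (u e.1.2)) =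
      ∑ χ : Pair k → Fin K, (∏ e : Pair k,
        (if κ (u e.1.1) (u e.1.2) = χ e then (1 : ℝ) else 0)) * G χ := by
    intro u
    rw [Finset.sum_eq_single fun e : Pair k => κ (u e.1.1) (u e.1.2)]
    · simp
    · intro χ _ hne
      obtain ⟨e, he⟩ := Function.ne_iff.mp hne
      rw [Finset.prod_eq_zero (Finset.mem_univ e) (if_neg fun h => he h.symm), zero_mul]
    · intro h
      exact absurd (Finset.mem_univ _) h
  have hsum : ∑ u : Fin k → V, σ (fun i => ν (u i)) * (G (fun e => κ (u e.1.1) (u e.1.2)) -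
      ∑ χ : Pair k → Fin K, (∏ e : Pair k, p (ν (u e.1.1)) (ν (u e.1.2)) (χ e)) * G χ) =
      ∑ χ : Pair k → Fin K, G χ * ∑ u : Fin k → V, σ (fun i => ν (u i)) *
      (∏ e : Pair k, (if κ (u e.1.1) (u e.1.2) = χ e then (1 : ℝ) else 0) -
        ∏ e : Pair k, p (ν (u e.1.1)) (ν (u e.1.2)) (χ e)) := by
    simp_rw [Finset.mul_sum]
    rw [Finset.sum_comm]
    refine Finset.sum_congr rfl fun u _ => ?_
    rw [hdecomp, ← Finset.sum_sub_distrib, Finset.mul_sum]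
    refine Finset.sum_congr rfl fun χ _ => ?_
    ring
  rw [hsum]
  refine (Finset.abs_sum_le_sum_abs _ _).trans ?_
  have hk : 0 ≤ (Fintype.card (Pair k) : ℝ) * (ε * (Fintype.card V : ℝ) ^ k) := by positivity
  calc _ ≤ ∑ χ : Pair k → Fin K, (Fintype.card (Pair k) : ℝ) * (ε * (Fintype.card V : ℝ) ^ k) := by
        refine Finset.sum_le_sum fun χ _ => ?_
        rw [abs_mul, abs_of_nonneg (hG χ).1]
        exact (mul_le_of_le_one_left (abs_nonneg _) (hG χ).2).trans (hχ χ)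
    _ = _ := by rw [Finset.sum_const, nsmul_eq_mul, Finset.card_univ]

end counting

theorem sum_fun_fin_three {V : Type} [Fintype V] (F : V → V → V → ℝ) :
    ∑ u : Fin 3 → V, F (u 0) (u 1) (u 2) = ∑ x, ∑ y, ∑ z, F x y z := by
  let E : V × V × V ≃ (Fin 3 → V) :=
    { toFun := fun z => ![z.1, z.2.1, z.2.2]
      invFun := fun u => (u 0, u 1, u 2)
      left_inv := fun z => rfl
      right_inv := fun u => by
        funext i
        fin_cases i <;> rfl }
  rw [← E.sum_comp, Fintype.sum_prod_type]
  simp_rw [Fintype.sum_prod_type]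
  rfl

abbrev pair01 : Pair 3 := ⟨(0, 1), by decide⟩
abbrev pair02 : Pair 3 := ⟨(0, 2), by decide⟩
abbrev pair12 : Pair 3 := ⟨(1, 2), by decide⟩

theorem univ_pair_three : (Finset.univ : Finset (Pair 3)) = {pair01, pair02, pair12} := by
  decide

theorem sum_fun_pair_three {C : Type} [Fintype C] (q : Fin 3 → Fin 3 → C → ℝ)
    (F : C → C → C → ℝ) :
    ∑ χ : Pair 3 → C, (∏ e : Pair 3, q e.1.1 e.1.2 (χ e)) * F (χ pair01) (χ pair02) (χ pair12) =
      ∑ c, ∑ c', ∑ c'', q 0 1 c * q 0 2 c' * q 1 2 c'' * F c c' c'' := by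
  let E : C × C × C ≃ (Pair 3 → C) :=
    { toFun := fun z e => if e = pair01 then z.1 else if e = pair02 then z.2.1 else z.2.2
      invFun := fun χ => (χ pair01, χ pair02, χ pair12)
      left_inv := fun z => rfl
      right_inv := fun χ => by
        funext e
        have he : e ∈ (Finset.univ : Finset (Pair 3)) := Finset.mem_univ e
        rw [univ_pair_three] at he
        simp only [Finset.mem_insert, Finset.mem_singleton] at he
        rcases he with rfl | rfl | rfl <;> rfl }
  rw [← E.sum_comp, Fintype.sum_prod_type]
  simp_rw [Fintype.sum_prod_type]
  refine Finset.sum_congr rfl fun c _ => Finset.sum_congr rfl fun c' _ =>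
    Finset.sum_congr rfl fun c'' _ => ?_
  rw [univ_pair_three, Finset.prod_insert (by decide), Finset.prod_insert (by decide),
    Finset.prod_singleton, ← mul_assoc]
  rfl

open scoped Classical in
/-- The indicator of the edges of a 3-graph, as a function of three vertices. -/
noncomputable def edgeInd {V : Type} [DecidableEq V] (H : H3 V) (u v w : V) : ℝ :=
  if ({u, v, w} : Finset V) ∈ H.edges then 1 else 0

section weighted
variable {V : Type} [DecidableEq V] (H : H3 V)

theorem edgeInd_mem_unitInterval (u v w : V) : 0 ≤ edgeInd H u v w ∧ edgeInd H u v w ≤ 1 := by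
  unfold edgeInd
  split_ifs <;> norm_num

theorem edgeInd_swap_left (u v w : V) : edgeInd H u v w = edgeInd H v u w := by
  unfold edgeInd
  rw [Finset.insert_comm]

theorem edgeInd_swap_right (u v w : V) : edgeInd H u v w = edgeInd H u w v := by
  unfold edgeInd
  rw [Finset.pair_comm]

/-- A polynomial that is affine in each coordinate and bounded below on the vertices of the
cube is bounded below on the cube. -/
theorem le_of_affine {V : Type} [DecidableEq V] [Fintype V] (G : (V → ℝ) → ℝ) (c : ℝ)
    (hG : ∀ x v t, G (Function.update x v t) =
      (1 - t) * G (Function.update x v 0) + t * G (Function.update x v 1))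
    (h : ∀ x, (∀ v, x v = 0 ∨ x v = 1) → c ≤ G x) (x : V → ℝ) (hx : ∀ v, 0 ≤ x v ∧ x v ≤ 1) :
    c ≤ G x := by
  suffices hS : ∀ (S : Finset V) (x : V → ℝ), (∀ v, 0 ≤ x v ∧ x v ≤ 1) →
      (∀ v ∉ S, x v = 0 ∨ x v = 1) → c ≤ G x from
    hS Finset.univ x hx fun v hv => absurd (Finset.mem_univ v) hv
  intro S
  induction S using Finset.induction_on with
  | empty => exact fun x _ h0 => h x fun v => h0 v (Finset.notMem_empty v)
  | insert s S _ ih =>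
    intro x hx h0
    have key : ∀ t : ℝ, (t = 0 ∨ t = 1) → c ≤ G (Function.update x s t) := by
      intro t ht
      refine ih _ (fun v => ?_) fun v hv => ?_
      · by_cases hvs : v = s
        · subst hvs
          rw [Function.update_self]
          rcases ht with rfl | rfl <;> norm_num
        · rw [Function.update_of_ne hvs]
          exact hx v
      · by_cases hvs : v = s
        · subst hvs
          rwa [Function.update_self]
        · rw [Function.update_of_ne hvs]
          exact h0 v (by simp [hvs, hv])
    have h1 := hG x s (x s)
    rw [Function.update_eq_self] at h1
    rw [h1]
    have := mul_le_mul_of_nonneg_left (key 0 (Or.inl rfl)) (sub_nonneg.mpr (hx s).2)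
    have := mul_le_mul_of_nonneg_left (key 1 (Or.inr rfl)) (hx s).1
    linarith

variable [Fintype V]

theorem card_edges_le_sum_edgeInd (U : Finset V) (x : V → ℝ)
    (hx : ∀ v, x v = if v ∈ U then 1 else 0) :
    ((H.edges.filter fun e => e ⊆ U).card : ℝ) ≤
      ∑ u, ∑ v, ∑ w, edgeInd H u v w * x u * x v * x w := by
  have h1 : H.edges.filter (fun e => e ⊆ U) ⊆
      ((Finset.univ : Finset (V × V × V)).filter fun t =>
        ({t.1, t.2.1, t.2.2} : Finset V) ∈ H.edges ∧ ({t.1, t.2.1, t.2.2} : Finset V) ⊆ U).image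
        fun t => {t.1, t.2.1, t.2.2} := by
    intro e he
    obtain ⟨he, heU⟩ := Finset.mem_filter.mp he
    obtain ⟨a, b, c, -, -, -, rfl⟩ := Finset.card_eq_three.mp (H.card3 e he)
    exact Finset.mem_image.mpr ⟨(a, b, c), Finset.mem_filter.mpr ⟨Finset.mem_univ _, he, heU⟩, rfl⟩
  have h2 := (Finset.card_le_card h1).trans Finset.card_image_le
  refine (Nat.cast_le.mpr h2).trans ?_
  rw [← sum_triple fun t : V × V × V => edgeInd H t.1 t.2.1 t.2.2 * x t.1 * x t.2.1 * x t.2.2,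
    Finset.card_filter, Nat.cast_sum]
  refine Finset.sum_le_sum fun t _ => ?_
  have hn : ∀ v, 0 ≤ x v := fun v => by rw [hx]; split_ifs <;> norm_num
  by_cases h : ({t.1, t.2.1, t.2.2} : Finset V) ∈ H.edges ∧ ({t.1, t.2.1, t.2.2} : Finset V) ⊆ U
  · obtain ⟨ha, hb⟩ := h
    have m1 : t.1 ∈ U := hb (by simp)
    have m2 : t.2.1 ∈ U := hb (by simp)
    have m3 : t.2.2 ∈ U := hb (by simp)
    rw [hx, hx, hx, if_pos ⟨ha, hb⟩, if_pos m1, if_pos m2, if_pos m3]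
    simp [edgeInd, ha]
  · rw [if_neg h, Nat.cast_zero]
    exact mul_nonneg (mul_nonneg (mul_nonneg (edgeInd_mem_unitInterval H _ _ _).1 (hn _)) (hn _))
      (hn _)

theorem pow_three_le_choose (m : ℕ) : (m : ℝ) ^ 3 ≤ 27 * (m.choose 3 : ℝ) + 8 := by
  have : m ^ 3 ≤ 27 * m.choose 3 + 8 := by
    rcases Nat.lt_or_ge m 3 with h | h
    · interval_cases m <;> simp
    · obtain ⟨a, rfl⟩ := Nat.exists_eq_add_of_le' h
      have h6 : 6 * (a + 3).choose 3 = (a + 3) * (a + 2) * (a + 1) := by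
        have h3 := Nat.descFactorial_eq_factorial_mul_choose (a + 3) 3
        have h4 : (a + 3).descFactorial 3 = (a + 3) * (a + 2) * (a + 1) := by
          simp [Nat.descFactorial]
          ring
        rw [← h4, h3]
        rfl
      nlinarith [h6, Nat.zero_le (a ^ 3), Nat.zero_le (a ^ 2)]
  exact_mod_cast this

theorem weighted_density {d η : ℝ} (hd : 0 ≤ d) (hd1 : d ≤ 1) (hH : H.uniformlyDense d η)
    (x : V → ℝ) (hx : ∀ v, 0 ≤ x v ∧ x v ≤ 1) :
    d / 27 * (∑ v, x v) ^ 3 - (η * (Fintype.card V : ℝ) ^ 3 + 8 + 3 * (Fintype.card V : ℝ) ^ 2) ≤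
      ∑ u, ∑ v, ∑ w, edgeInd H u v w * x u * x v * x w := by
  classical
  let D : V → V → V → Prop := fun u v w => u ≠ v ∧ u ≠ w ∧ v ≠ w
  let ψ : V → V → V → ℝ := fun u v w => if D u v w then edgeInd H u v w - d / 27 else 0
  have hD : ∀ u v w, ¬ D u v w → edgeInd H u v w = 0 := by
    intro u v w h
    unfold edgeInd
    rw [if_neg]
    intro he
    have h3 := H.card3 _ he
    apply h
    refine ⟨?_, ?_, ?_⟩
    · rintro rfl
      have := Finset.card_le_two (a := u) (b := w)
      simp at h3
      omega
    · rintro rfl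
      have := Finset.card_le_two (a := v) (b := u)
      rw [Finset.insert_comm] at h3
      simp at h3
      omega
    · rintro rfl
      have := Finset.card_le_two (a := u) (b := v)
      simp at h3
      omega
  have haff := le_of_affine (fun x : V → ℝ => ∑ u, ∑ v, ∑ w, ψ u v w * x u * x v * x w)
    (-(η * (Fintype.card V : ℝ) ^ 3 + 8)) (fun x s t => by
      simp only [Finset.mul_sum, ← Finset.sum_add_distrib]
      refine Finset.sum_congr rfl fun u _ => Finset.sum_congr rfl fun v _ =>
        Finset.sum_congr rfl fun w _ => ?_
      by_cases hDu : D u v w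
      · obtain ⟨h1, h2, h3⟩ := hDu
        by_cases hu : u = s
        · subst hu
          simp only [Function.update_self, Function.update_of_ne h1.symm,
            Function.update_of_ne h2.symm]
          ring
        · by_cases hv : v = s
          · subst hv
            simp only [Function.update_self, Function.update_of_ne hu,
              Function.update_of_ne h3.symm]
            ring
          · by_cases hw : w = s
            · subst hw
              simp only [Function.update_self, Function.update_of_ne hu,
                Function.update_of_ne hv]
              ring
            · simp only [Function.update_of_ne hu, Function.update_of_ne hv,
                Function.update_of_ne hw]
              ring
      · simp [ψ, hDu]) (fun x hx => by
      set U : Finset V := Finset.univ.filter fun v => x v = 1 with hU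
      have hxU : ∀ v, x v = if v ∈ U then 1 else 0 := by
        intro v
        rcases hx v with h | h <;> simp [hU, h]
      have h1 := card_edges_le_sum_edgeInd H U x hxU
      have h2 := hH U
      have h3 : ∑ u, ∑ v, ∑ w, d / 27 * (x u * x v * x w) = d / 27 * (U.card : ℝ) ^ 3 := by
        have : (U.card : ℝ) = ∑ v, x v := by
          simp [hxU]
        rw [this]
        simp only [← Finset.mul_sum, ← Finset.sum_mul]
        ring
      have h4 : ∑ u, ∑ v, ∑ w, (edgeInd H u v w * x u * x v * x w - d / 27 * (x u * x v * x w)) ≤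
          ∑ u, ∑ v, ∑ w, ψ u v w * x u * x v * x w := by
        refine Finset.sum_le_sum fun u _ => Finset.sum_le_sum fun v _ =>
          Finset.sum_le_sum fun w _ => ?_
        have h0 : 0 ≤ x u * x v * x w := by
          have hn : ∀ v, 0 ≤ x v := fun v => by rcases hx v with h | h <;> simp [h]
          exact mul_nonneg (mul_nonneg (hn u) (hn v)) (hn w)
        by_cases hDu : D u v w
        · simp only [ψ, if_pos hDu]
          linarith
        · simp only [ψ, if_neg hDu, hD u v w hDu]
          have := mul_nonneg (div_nonneg hd (by norm_num : (0 : ℝ) ≤ 27)) h0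
          linarith
      simp only [Finset.sum_sub_distrib] at h4
      have h5 := pow_three_le_choose U.card
      have h6 := mul_le_mul_of_nonneg_left h5 (div_nonneg hd (by norm_num : (0 : ℝ) ≤ 27))
      linarith) x hx
  have hbad : ∑ u, ∑ v, ∑ w, (if D u v w then (0 : ℝ) else 1) ≤
      3 * (Fintype.card V : ℝ) ^ 2 := by
    have : ∀ u v w, (if D u v w then (0 : ℝ) else 1) ≤
        (if u = v then 1 else 0) + (if u = w then 1 else 0) + (if v = w then 1 else 0) := by
      intro u v w
      by_cases h1 : u = v <;> by_cases h2 : u = w <;> by_cases h3 : v = w <;>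
        simp [D, h1, h2, h3] <;> (try positivity)
    refine (Finset.sum_le_sum fun u _ => Finset.sum_le_sum fun v _ =>
          Finset.sum_le_sum fun w _ => this u v w).trans ?_
    simp only [Finset.sum_add_distrib]
    simp
    apply le_of_eq
    ring
  have hfin : ∑ u, ∑ v, ∑ w, (ψ u v w * x u * x v * x w + d / 27 * (x u * x v * x w) -
      (if D u v w then (0 : ℝ) else 1)) ≤ ∑ u, ∑ v, ∑ w, edgeInd H u v w * x u * x v * x w := by
    refine Finset.sum_le_sum fun u _ => Finset.sum_le_sum fun v _ =>
          Finset.sum_le_sum fun w _ => ?_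
    have h0 : x u * x v * x w ≤ 1 := by
      have h1 := mul_le_one₀ (hx u).2 (hx v).1 (hx v).2
      exact mul_le_one₀ h1 (hx w).1 (hx w).2
    have h00 : 0 ≤ x u * x v * x w := mul_nonneg (mul_nonneg (hx u).1 (hx v).1) (hx w).1
    by_cases hDu : D u v w
    · simp only [ψ, if_pos hDu]
      linarith
    · simp only [ψ, if_neg hDu, hD u v w hDu]
      have : d / 27 * (x u * x v * x w) ≤ 1 := mul_le_one₀ (by linarith) h00 h0
      linarith
  simp only [Finset.sum_sub_distrib, Finset.sum_add_distrib] at hfin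
  have h3 : ∑ u, ∑ v, ∑ w, d / 27 * (x u * x v * x w) = d / 27 * (∑ v, x v) ^ 3 := by
    simp only [← Finset.mul_sum, ← Finset.sum_mul]
    ring
  rw [h3] at hfin
  linarith

end weighted

section triples
variable {V : Type} [DecidableEq V] [Fintype V] (H : H3 V)

/-- The density of edges between three weight functions. -/
noncomputable def tripleDensity (a b c : V → ℝ) : ℝ :=
  ∑ u, ∑ v, ∑ w, edgeInd H u v w * a u * b v * c w

theorem tripleDensity_swap_left (a b c : V → ℝ) :
    tripleDensity H a b c = tripleDensity H b a c := by
  unfold tripleDensity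
  rw [Finset.sum_comm]
  refine Finset.sum_congr rfl fun u _ => Finset.sum_congr rfl fun v _ =>
    Finset.sum_congr rfl fun w _ => ?_
  rw [edgeInd_swap_left]
  ring

theorem tripleDensity_swap_right (a b c : V → ℝ) :
    tripleDensity H a b c = tripleDensity H a c b := by
  unfold tripleDensity
  refine Finset.sum_congr rfl fun u _ => ?_
  rw [Finset.sum_comm]
  refine Finset.sum_congr rfl fun v _ => Finset.sum_congr rfl fun w _ => ?_
  rw [edgeInd_swap_right]
  ring

theorem tripleDensity_le_one {a b c : V → ℝ} (ha : ∀ v, 0 ≤ a v) (hb : ∀ v, 0 ≤ b v)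
    (hc : ∀ v, 0 ≤ c v) (ha1 : ∑ v, a v = 1) (hb1 : ∑ v, b v = 1) (hc1 : ∑ v, c v = 1) :
    tripleDensity H a b c ≤ 1 := by
  have : ∑ u, ∑ v, ∑ w, a u * b v * c w = 1 := by
    simp only [← Finset.mul_sum, ha1, hb1, hc1, mul_one]
  rw [← this]
  unfold tripleDensity
  refine Finset.sum_le_sum fun u _ => Finset.sum_le_sum fun v _ => Finset.sum_le_sum fun w _ => ?_
  have h0 := mul_nonneg (mul_nonneg (ha u) (hb v)) (hc w)
  have := mul_le_of_le_one_left h0 (edgeInd_mem_unitInterval H u v w).2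
  linarith

theorem tripleDensity_sum {B : Finset ℕ} (s : ℝ) (μ : ℕ → V → ℝ) :
    tripleDensity H (fun v => s * ∑ i ∈ B, μ i v) (fun v => s * ∑ i ∈ B, μ i v)
      (fun v => s * ∑ i ∈ B, μ i v) =
      s ^ 3 * ∑ i ∈ B, ∑ j ∈ B, ∑ l ∈ B, tripleDensity H (μ i) (μ j) (μ l) := by
  unfold tripleDensity
  have h1 : ∀ u v w, edgeInd H u v w * (s * ∑ i ∈ B, μ i u) * (s * ∑ i ∈ B, μ i v) *
      (s * ∑ i ∈ B, μ i w) = s ^ 3 * ∑ i ∈ B, ∑ j ∈ B, ∑ l ∈ B,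
        edgeInd H u v w * μ i u * μ j v * μ l w := by
    intro u v w
    simp only [← Finset.mul_sum, ← Finset.sum_mul]
    ring
  simp only [h1, ← Finset.mul_sum (a := s ^ 3)]
  congr 1
  have h2 : ∀ (f : V → V → V → ℕ → ℝ), ∑ u, ∑ v, ∑ w, ∑ i ∈ B, f u v w i =
      ∑ i ∈ B, ∑ u, ∑ v, ∑ w, f u v w i := by
    intro f
    simp only [Finset.sum_comm (t := B)]
  rw [h2]
  refine Finset.sum_congr rfl fun i _ => ?_
  rw [h2]
  refine Finset.sum_congr rfl fun j _ => ?_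
  rw [h2]

theorem exists_dense_triple {d η r : ℝ} (hd : 0 < d) (hd1 : d ≤ 1)
    (hH : H.uniformlyDense d η) (hr : 0 < r) (hη : η ≤ d / 27 * r ^ 3 / 16)
    (hn : 1 ≤ Fintype.card V) (hn' : 176 ≤ d / 27 * r ^ 3 * Fintype.card V)
    (B : Finset ℕ) (hB : 12 ≤ d / 27 * B.card) (μ : ℕ → V → ℝ)
    (h0 : ∀ i ∈ B, ∀ v, 0 ≤ μ i v) (h1 : ∀ i ∈ B, ∑ v, μ i v = 1)
    (hμ : ∀ i ∈ B, ∀ v, r * Fintype.card V * μ i v ≤ 1) :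
    ∃ i ∈ B, ∃ j ∈ B, ∃ l ∈ B, i < j ∧ j < l ∧
      d / 54 ≤ tripleDensity H (μ i) (μ j) (μ l) := by
  suffices hs : ∃ i ∈ B, ∃ j ∈ B, ∃ l ∈ B, i ≠ j ∧ i ≠ l ∧ j ≠ l ∧
      d / 54 ≤ tripleDensity H (μ i) (μ j) (μ l) by
    obtain ⟨i, hi, j, hj, l, hl, hij, hil, hjl, ht⟩ := hs
    rcases lt_or_gt_of_ne hij with a | a <;> rcases lt_or_gt_of_ne hil with b | b <;>
      rcases lt_or_gt_of_ne hjl with c | c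
    · exact ⟨i, hi, j, hj, l, hl, a, c, ht⟩
    · exact ⟨i, hi, l, hl, j, hj, b, c, by rwa [tripleDensity_swap_right]⟩
    · omega
    · exact ⟨l, hl, i, hi, j, hj, b, a, by
        rwa [tripleDensity_swap_left, tripleDensity_swap_right]⟩
    · exact ⟨j, hj, i, hi, l, hl, a, b, by rwa [tripleDensity_swap_left]⟩
    · omega
    · exact ⟨j, hj, l, hl, i, hi, c, b, by
        rwa [tripleDensity_swap_right, tripleDensity_swap_left]⟩
    · exact ⟨l, hl, j, hj, i, hi, c, a, by
        rwa [tripleDensity_swap_left, tripleDensity_swap_right, tripleDensity_swap_left]⟩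
  by_contra hcon
  push Not at hcon
  set n : ℝ := (Fintype.card V : ℝ) with hnd
  have hn1 : (1 : ℝ) ≤ n := by rw [hnd]; exact_mod_cast hn
  set N : ℝ := (B.card : ℝ) with hN
  set D : ℝ := d / 27 with hD
  have hD0 : 0 < D := by positivity
  have hN0 : 0 < N := by
    by_contra hN0
    have : D * N ≤ 0 := mul_nonpos_of_nonneg_of_nonpos hD0.le (not_lt.mp hN0)
    linarith
  set s : ℝ := r * n / N with hs
  have hs0 : 0 < s := by positivity
  have hw := weighted_density H hd.le hd1 hH (fun v => s * ∑ i ∈ B, μ i v) (fun v => by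
    refine ⟨mul_nonneg hs0.le (Finset.sum_nonneg fun i hi => h0 i hi v), ?_⟩
    have h2 : r * n * ∑ i ∈ B, μ i v ≤ N := by
      rw [Finset.mul_sum]
      refine (Finset.sum_le_sum fun i hi => hμ i hi v).trans ?_
      rw [Finset.sum_const, nsmul_eq_mul, mul_one]
    have h3 : s * ∑ i ∈ B, μ i v = (r * n * ∑ i ∈ B, μ i v) / N := by
      rw [hs]; ring
    rw [h3]
    exact div_le_one_of_le₀ h2 hN0.le)
  have hsum : ∑ v, s * ∑ i ∈ B, μ i v = r * n := by
    rw [← Finset.mul_sum, Finset.sum_comm, Finset.sum_congr rfl h1, Finset.sum_const,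
      nsmul_eq_mul, mul_one, hs, div_mul_cancel₀ _ hN0.ne']
  rw [hsum] at hw
  have hT := tripleDensity_sum H (B := B) s μ
  unfold tripleDensity at hT
  rw [hT] at hw
  have hup : ∑ i ∈ B, ∑ j ∈ B, ∑ l ∈ B, tripleDensity H (μ i) (μ j) (μ l) ≤
      N ^ 3 * (D / 2) + 3 * N ^ 2 := by
    have : ∀ i ∈ B, ∀ j ∈ B, ∀ l ∈ B, tripleDensity H (μ i) (μ j) (μ l) ≤
        D / 2 + ((if i = j then 1 else 0) + (if i = l then 1 else 0) +
          (if j = l then 1 else 0)) := by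
      intro i hi j hj l hl
      have h1' := tripleDensity_le_one H (h0 i hi) (h0 j hj) (h0 l hl) (h1 i hi) (h1 j hj) (h1 l hl)
      by_cases hij : i = j
      · rw [if_pos hij]
        have : (0 : ℝ) ≤ (if i = l then 1 else 0) + (if j = l then 1 else 0) := by positivity
        linarith
      by_cases hil : i = l
      · rw [if_pos hil]
        have : (0 : ℝ) ≤ (if i = j then 1 else 0) + (if j = l then 1 else 0) := by positivity
        linarith
      by_cases hjl : j = l
      · rw [if_pos hjl]
        have : (0 : ℝ) ≤ (if i = j then 1 else 0) + (if i = l then 1 else 0) := by positivity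
        linarith
      rw [if_neg hij, if_neg hil, if_neg hjl]
      have := hcon i hi j hj l hl hij hil hjl
      have h54 : d / 54 = D / 2 := by rw [hD]; ring
      linarith
    refine (Finset.sum_le_sum fun i hi => Finset.sum_le_sum fun j hj =>
          Finset.sum_le_sum fun l hl => this i hi j hj l hl).trans ?_
    simp only [Finset.sum_add_distrib]
    simp only [Finset.sum_const, nsmul_eq_mul, Finset.sum_ite_eq, Finset.sum_ite_mem,
      Finset.inter_self, ← hN]
    have e2 : ∀ x ∈ B, (∑ j ∈ B, N * if x = j then (1 : ℝ) else 0) = N := by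
      intro x hx
      simp [hx]
    have e3 : ∀ x ∈ B, (N * if x ∈ B then (1 : ℝ) else 0) = N := by
      intro x hx
      simp [hx]
    rw [Finset.sum_congr rfl e2, Finset.sum_congr rfl e3, Finset.sum_const, nsmul_eq_mul, ← hN]
    apply le_of_eq
    ring
  have hup2 : s ^ 3 * ∑ i ∈ B, ∑ j ∈ B, ∑ l ∈ B, tripleDensity H (μ i) (μ j) (μ l) ≤
      (r * n) ^ 3 * (3 / 4 * D) := by
    refine (mul_le_mul_of_nonneg_left hup (by positivity)).trans ?_
    have h5 : N ^ 3 * (D / 2) + 3 * N ^ 2 ≤ N ^ 3 * (3 / 4 * D) := by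
      have : 0 ≤ N ^ 2 * (D * N - 12) := mul_nonneg (by positivity) (by linarith)
      nlinarith
    refine (mul_le_mul_of_nonneg_left h5 (by positivity)).trans (le_of_eq ?_)
    rw [hs]
    field_simp
  unfold tripleDensity at hup2
  have hn3 : 0 < n ^ 3 := by positivity
  have e1 : η * n ^ 3 ≤ D * r ^ 3 / 16 * n ^ 3 := mul_le_mul_of_nonneg_right hη hn3.le
  have e2 : 11 * n ^ 2 ≤ D * r ^ 3 * n / 16 * n ^ 2 :=
    mul_le_mul_of_nonneg_right (by linarith) (by positivity)
  have e3 : 8 ≤ 8 * n ^ 2 := by nlinarith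
  have e4 : 0 < D * (r * n) ^ 3 := by positivity
  nlinarith

theorem exists_dense_subset {d η r : ℝ} (hd : 0 < d) (hd1 : d ≤ 1)
    (hH : H.uniformlyDense d η) (hr : 0 < r) (hη : η ≤ d / 27 * r ^ 3 / 16)
    (hn : 1 ≤ Fintype.card V) (hn' : 176 ≤ d / 27 * r ^ 3 * Fintype.card V)
    {M N R : ℕ} (hN : 12 ≤ d / 27 * N)
    (hR : ∀ S : Finset ℕ, R ≤ S.card → ∀ P : Finset ℕ → Prop,
      (∃ A ⊆ S, A.card = M ∧ ∀ e ⊆ A, e.card = 3 → P e) ∨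
      (∃ B ⊆ S, B.card = N ∧ ∀ e ⊆ B, e.card = 3 → ¬ P e)) (μ : ℕ → V → ℝ)
    (h0 : ∀ i < R, ∀ v, 0 ≤ μ i v) (h1 : ∀ i < R, ∑ v, μ i v = 1)
    (hμ : ∀ i < R, ∀ v, r * Fintype.card V * μ i v ≤ 1) :
    ∃ A ⊆ Finset.range R, A.card = M ∧ ∀ i ∈ A, ∀ j ∈ A, ∀ l ∈ A, i < j → j < l →
      d / 54 ≤ tripleDensity H (μ i) (μ j) (μ l) := by
  have hc : ∀ i j l : ℕ, i < j → j < l → ({i, j, l} : Finset ℕ).card = 3 := fun i j l hij hjl =>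
    Finset.card_eq_three.mpr ⟨i, j, l, by omega, by omega, by omega, rfl⟩
  rcases hR (Finset.range R) (by simp) (fun e => ∀ i ∈ e, ∀ j ∈ e, ∀ l ∈ e, i < j → j < l →
      d / 54 ≤ tripleDensity H (μ i) (μ j) (μ l)) with ⟨A, hA, hAc, h⟩ | ⟨B, hB, hBc, h⟩
  · refine ⟨A, hA, hAc, fun i hi j hj l hl hij hjl => ?_⟩
    refine h {i, j, l} ?_ (hc i j l hij hjl) i (by simp) j (by simp) l (by simp) hij hjl
    intro x hx
    simp only [Finset.mem_insert, Finset.mem_singleton] at hx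
    rcases hx with rfl | rfl | rfl <;> assumption
  · exfalso
    have hlt : ∀ i ∈ B, i < R := fun i hi => Finset.mem_range.mp (hB hi)
    obtain ⟨i, hi, j, hj, l, hl, hij, hjl, ht⟩ := exists_dense_triple H hd hd1 hH hr hη hn hn' B
      (by rwa [hBc]) μ (fun i hi => h0 i (hlt i hi)) (fun i hi => h1 i (hlt i hi))
      (fun i hi => hμ i (hlt i hi))
    refine h {i, j, l} ?_ (hc i j l hij hjl) fun a ha b hb c hc' hab hbc => ?_
    · intro x hx
      simp only [Finset.mem_insert, Finset.mem_singleton] at hx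
      rcases hx with rfl | rfl | rfl <;> assumption
    · simp only [Finset.mem_insert, Finset.mem_singleton] at ha hb hc'
      obtain ⟨rfl, rfl, rfl⟩ : a = i ∧ b = j ∧ c = l := by omega
      exact ht

end triples

theorem sum_comp_injective {A B V : Type} [Fintype A] [Fintype B] [Fintype V] [Nonempty V]
    [DecidableEq A] [DecidableEq B] {ι : B → A} (hι : Function.Injective ι) (G : (B → V) → ℝ) :
    ∑ ω : A → V, G (fun b => ω (ι b)) =
      (Fintype.card V : ℝ) ^ Fintype.card A *
        ((∑ χ : B → V, G χ) / (Fintype.card V : ℝ) ^ Fintype.card B) := by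
  have hn : (Fintype.card V : ℝ) ≠ 0 := Nat.cast_ne_zero.mpr Fintype.card_ne_zero
  have h := sum_prod_comp_injective hι (fun _ (_ : V) => (Fintype.card V : ℝ)⁻¹) (fun _ => by
    rw [Finset.sum_const, nsmul_eq_mul, Finset.card_univ, mul_inv_cancel₀ hn]) G
  simp only [Finset.prod_const, Finset.card_univ, ← Finset.mul_sum] at h
  rw [div_eq_inv_mul, ← inv_pow, ← h, ← mul_assoc, ← mul_pow, mul_inv_cancel₀ hn, one_pow, one_mul]

open scoped Classical in
theorem half_le_good {V : Type} [Fintype V] [Nonempty V] {R : ℕ} (b₁ : V → Prop)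
    (b₃ : V → V → V → Prop) {x y : ℝ}
    (h₁ : ∑ v, (if b₁ v then (1 : ℝ) else 0) ≤ x * Fintype.card V)
    (h₃ : ∑ u, ∑ v, ∑ w, (if b₃ u v w then (1 : ℝ) else 0) ≤ y * (Fintype.card V : ℝ) ^ 3)
    (hx : R * x ≤ 1 / 4) (hy0 : 0 ≤ y) (hy : (R : ℝ) ^ 3 * y ≤ 1 / 4) :
    (Fintype.card V : ℝ) ^ R / 2 ≤ ∑ u : Fin R → V,
      if (∀ i, ¬ b₁ (u i)) ∧ ∀ i j l, i < j → j < l → ¬ b₃ (u i) (u j) (u l) then 1 else 0 := by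
  have hn : (0 : ℝ) < Fintype.card V := Nat.cast_pos.mpr Fintype.card_pos
  have hpt : ∀ u : Fin R → V, 1 ≤
      (if (∀ i, ¬ b₁ (u i)) ∧ ∀ i j l, i < j → j < l → ¬ b₃ (u i) (u j) (u l) then (1 : ℝ) else 0) +
      (∑ i, (if b₁ (u i) then (1 : ℝ) else 0) + ∑ i : Fin R, ∑ j : Fin R, ∑ l : Fin R,
        if i < j ∧ j < l then (if b₃ (u i) (u j) (u l) then (1 : ℝ) else 0) else 0) := by
    intro u
    have n1 : ∀ i, 0 ≤ (if b₁ (u i) then (1 : ℝ) else 0) := fun i => by positivity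
    have n3 : ∀ i j l : Fin R, 0 ≤ (if i < j ∧ j < l then
        (if b₃ (u i) (u j) (u l) then (1 : ℝ) else 0) else 0) := fun i j l => by positivity
    have s1 := Finset.sum_nonneg fun i (_ : i ∈ Finset.univ) => n1 i
    have s3 : 0 ≤ ∑ i : Fin R, ∑ j : Fin R, ∑ l : Fin R,
        if i < j ∧ j < l then (if b₃ (u i) (u j) (u l) then (1 : ℝ) else 0) else 0 :=
      Finset.sum_nonneg fun i _ => Finset.sum_nonneg fun j _ => Finset.sum_nonneg fun l _ => n3 i j l
    split_ifs with h
    · linarith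
    · rw [not_and_or] at h
      push Not at h
      rcases h with ⟨i, hi⟩ | ⟨i, j, l, hij, hjl, hb⟩
      · have := Finset.single_le_sum (fun i (_ : i ∈ Finset.univ) => n1 i) (Finset.mem_univ i)
        rw [if_pos hi] at this
        linarith
      · have t1 := Finset.single_le_sum (fun l (_ : l ∈ Finset.univ) => n3 i j l) (Finset.mem_univ l)
        have t2 := Finset.single_le_sum (fun j (_ : j ∈ Finset.univ) =>
          Finset.sum_nonneg fun l (_ : l ∈ Finset.univ) => n3 i j l) (Finset.mem_univ j)
        have t3 := Finset.single_le_sum (fun i (_ : i ∈ Finset.univ) =>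
          Finset.sum_nonneg fun j (_ : j ∈ Finset.univ) =>
          Finset.sum_nonneg fun l (_ : l ∈ Finset.univ) => n3 i j l) (Finset.mem_univ i)
        rw [if_pos ⟨hij, hjl⟩, if_pos hb] at t1
        linarith
  have htot := Finset.sum_le_sum fun u (_ : u ∈ (Finset.univ : Finset (Fin R → V))) => hpt u
  rw [Finset.sum_add_distrib, Finset.sum_add_distrib, Finset.sum_const, nsmul_eq_mul, mul_one,
    Finset.card_univ, Fintype.card_fun, Fintype.card_fin, Nat.cast_pow] at htot
  have e1 : ∑ u : Fin R → V, ∑ i, (if b₁ (u i) then (1 : ℝ) else 0) ≤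
      (Fintype.card V : ℝ) ^ R * (1 / 4) := by
    rw [Finset.sum_comm]
    have : ∀ i : Fin R, ∑ u : Fin R → V, (if b₁ (u i) then (1 : ℝ) else 0) ≤
        (Fintype.card V : ℝ) ^ R * x := by
      intro i
      have := sum_comp_injective (ι := fun _ : Unit => i) (fun a b _ => rfl)
        (fun χ : Unit → V => if b₁ (χ ()) then (1 : ℝ) else 0)
      rw [this, Fintype.card_fin, Fintype.card_unit, pow_one]
      refine mul_le_mul_of_nonneg_left ?_ (by positivity)
      rw [div_le_iff₀ hn]
      refine le_trans (le_of_eq ?_) h₁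
      exact Fintype.sum_equiv (Equiv.funUnique Unit V) _ _ fun χ => rfl
    refine (Finset.sum_le_sum fun i _ => this i).trans ?_
    rw [Finset.sum_const, nsmul_eq_mul, Finset.card_univ, Fintype.card_fin]
    have := mul_le_mul_of_nonneg_left hx (pow_nonneg hn.le R)
    linarith
  have e3 : ∑ u : Fin R → V, ∑ i : Fin R, ∑ j : Fin R, ∑ l : Fin R,
        (if i < j ∧ j < l then (if b₃ (u i) (u j) (u l) then (1 : ℝ) else 0) else 0) ≤
      (Fintype.card V : ℝ) ^ R * (1 / 4) := by
    have : ∀ i j l : Fin R, ∑ u : Fin R → V,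
        (if i < j ∧ j < l then (if b₃ (u i) (u j) (u l) then (1 : ℝ) else 0) else 0) ≤
        (Fintype.card V : ℝ) ^ R * y := by
      intro i j l
      by_cases hijl : i < j ∧ j < l
      · simp only [if_pos hijl]
        have hinj : Function.Injective ![i, j, l] := by
          intro a b hab
          fin_cases a <;> fin_cases b <;> simp at hab ⊢ <;> omega
        have := sum_comp_injective hinj
          (fun χ : Fin 3 → V => if b₃ (χ 0) (χ 1) (χ 2) then (1 : ℝ) else 0)
        rw [sum_fun_fin_three (fun a b c => if b₃ a b c then (1 : ℝ) else 0), Fintype.card_fin,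
          Fintype.card_fin] at this
        refine this.le.trans ?_
        refine mul_le_mul_of_nonneg_left ?_ (by positivity)
        rwa [div_le_iff₀ (by positivity)]
      · simp only [if_neg hijl, Finset.sum_const_zero]
        positivity
    rw [Finset.sum_comm]
    have c2 : ∀ i : Fin R, ∑ u : Fin R → V, ∑ j : Fin R, ∑ l : Fin R,
        (if i < j ∧ j < l then (if b₃ (u i) (u j) (u l) then (1 : ℝ) else 0) else 0) ≤
        R * (R * ((Fintype.card V : ℝ) ^ R * y)) := by
      intro i
      rw [Finset.sum_comm]
      have c1 : ∀ j : Fin R, ∑ u : Fin R → V, ∑ l : Fin R,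
          (if i < j ∧ j < l then (if b₃ (u i) (u j) (u l) then (1 : ℝ) else 0) else 0) ≤
          R * ((Fintype.card V : ℝ) ^ R * y) := by
        intro j
        rw [Finset.sum_comm]
        refine (Finset.sum_le_sum fun l _ => this i j l).trans ?_
        rw [Finset.sum_const, nsmul_eq_mul, Finset.card_univ, Fintype.card_fin]
      refine (Finset.sum_le_sum fun j _ => c1 j).trans ?_
      rw [Finset.sum_const, nsmul_eq_mul, Finset.card_univ, Fintype.card_fin]
    refine (Finset.sum_le_sum fun i _ => c2 i).trans ?_
    rw [Finset.sum_const, nsmul_eq_mul, Finset.card_univ, Fintype.card_fin]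
    have := mul_le_mul_of_nonneg_left hy (pow_nonneg hn.le R)
    linarith
  linarith

section cells
variable {V : Type} [Fintype V] {L : ℕ} (ν : V → Fin L)

open scoped Classical in
/-- The number of vertices in a cell. -/
noncomputable def cellCard (a : Fin L) : ℕ := (Finset.univ.filter fun v => ν v = a).card

open scoped Classical in
/-- The uniform weight on a cell. -/
noncomputable def cellWeight (a : Fin L) (v : V) : ℝ :=
  if ν v = a then (cellCard ν a : ℝ)⁻¹ else 0

theorem cellWeight_nonneg (a : Fin L) (v : V) : 0 ≤ cellWeight ν a v := by
  unfold cellWeight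
  positivity

theorem sum_cellWeight {a : Fin L} (ha : 0 < cellCard ν a) : ∑ v, cellWeight ν a v = 1 := by
  classical
  unfold cellWeight
  rw [← Finset.sum_filter, Finset.sum_const, nsmul_eq_mul]
  have hc : ((Finset.univ.filter fun v => ν v = a).card : ℝ) = cellCard ν a := by
    unfold cellCard
    congr!
  rw [hc]
  exact mul_inv_cancel₀ (Nat.cast_ne_zero.mpr ha.ne')

open scoped Classical in
theorem sum_small_cells {s : ℝ} (hs : 0 ≤ s) :
    ∑ v, (if (cellCard ν (ν v) : ℝ) < s then (1 : ℝ) else 0) ≤ L * s := by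
  rw [← Finset.sum_fiberwise (s := Finset.univ) (g := ν)]
  have : ∀ a : Fin L, ∑ v with ν v = a, (if (cellCard ν (ν v) : ℝ) < s then (1 : ℝ) else 0) ≤ s := by
    intro a
    have h1 : ∑ v with ν v = a, (if (cellCard ν (ν v) : ℝ) < s then (1 : ℝ) else 0) =
        ∑ v with ν v = a, (if (cellCard ν a : ℝ) < s then (1 : ℝ) else 0) :=
      Finset.sum_congr rfl fun v hv => by rw [(Finset.mem_filter.mp hv).2]
    rw [h1]
    split_ifs with h
    · have hc : ((Finset.univ.filter fun v => ν v = a).card : ℝ) = cellCard ν a := by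
        unfold cellCard
        congr!
      rw [Finset.sum_const, nsmul_eq_mul, mul_one, hc]
      exact h.le
    · rw [Finset.sum_const_zero]
      exact hs
  refine (Finset.sum_le_sum fun a _ => this a).trans ?_
  rw [Finset.sum_const, nsmul_eq_mul, Finset.card_univ, Fintype.card_fin]

theorem fibreAvg_cells [DecidableEq V] (H : H3 V) (a b c : Fin L) :
    fibreAvg (fun x : V × V × V => (ν x.1, ν x.2.1, ν x.2.2))
      (fun x => edgeInd H x.1 x.2.1 x.2.2) (a, b, c) =
      tripleDensity H (cellWeight ν a) (cellWeight ν b) (cellWeight ν c) := by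
  classical
  unfold fibreAvg tripleDensity
  have hcard : ((Finset.univ.filter fun x : V × V × V =>
      (ν x.1, ν x.2.1, ν x.2.2) = (a, b, c)).card : ℝ) =
      cellCard ν a * (cellCard ν b * cellCard ν c) := by
    have : (Finset.univ.filter fun x : V × V × V => (ν x.1, ν x.2.1, ν x.2.2) = (a, b, c)) =
        (Finset.univ.filter fun v => ν v = a) ×ˢ
          ((Finset.univ.filter fun v => ν v = b) ×ˢ (Finset.univ.filter fun v => ν v = c)) := by
      ext x
      simp [Prod.ext_iff]
    rw [this, Finset.card_product, Finset.card_product]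
    push_cast
    unfold cellCard
    congr!
  have hs : (∑ x with (fun x : V × V × V => (ν x.1, ν x.2.1, ν x.2.2)) x = (a, b, c),
      (fun x : V × V × V => edgeInd H x.1 x.2.1 x.2.2) x) = ∑ u, ∑ v, ∑ w,
        if ν u = a ∧ ν v = b ∧ ν w = c then edgeInd H u v w else 0 := by
    rw [Finset.sum_filter, sum_triple]
    simp only [Prod.mk.injEq]
  have hgoal : (∑ u, ∑ v, ∑ w, if ν u = a ∧ ν v = b ∧ ν w = c then edgeInd H u v w else 0) /
      (cellCard ν a * (cellCard ν b * cellCard ν c) : ℝ) = ∑ u, ∑ v, ∑ w,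
        edgeInd H u v w * cellWeight ν a u * cellWeight ν b v * cellWeight ν c w := by
    simp only [Finset.sum_div]
    refine Finset.sum_congr rfl fun u _ => Finset.sum_congr rfl fun v _ =>
      Finset.sum_congr rfl fun w _ => ?_
    unfold cellWeight
    by_cases h1 : ν u = a <;> by_cases h2 : ν v = b <;> by_cases h3 : ν w = c <;>
      simp [h1, h2, h3]
    rw [div_eq_mul_inv, mul_inv, mul_inv]
    ring
  rw [← hgoal, ← hcard, ← hs]
  congr!

end cells

/-- The expected value of `f` on the colours of a triple of cells. -/
noncomputable def cellSum {K L : ℕ} (p : Fin L → Fin L → Fin K → ℝ)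
    (f : Fin K → Fin K → Fin K → ℝ) (a b c : Fin L) : ℝ :=
  ∑ x, ∑ y, ∑ z, p a b x * p a c y * p b c z * f x y z

section
variable {V : Type} [Fintype V] [DecidableEq V] (H : H3 V) {L : ℕ}

theorem sum_abs_tripleDensity_sub_cellSum_le {K : ℕ} (κ : V → V → Fin K)
    (f : Fin K → Fin K → Fin K → ℝ) (hf : ∀ a b c, 0 ≤ f a b c ∧ f a b c ≤ 1) (ν : V → Fin L)
    (p : Fin L → Fin L → Fin K → ℝ) (hp : ∀ a b c, 0 ≤ p a b c) (hp1 : ∀ a b, ∑ c, p a b c = 1)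
    {ε₂ ε₃ : ℝ} (hε₂ : 0 ≤ ε₂)
    (hreg₃ : ∀ σ : Fin L → Fin L → Fin L → ℝ, (∀ a b c, |σ a b c| ≤ 1) →
      |∑ u, ∑ v, ∑ w, (edgeInd H u v w - f (κ u v) (κ u w) (κ v w)) * σ (ν u) (ν v) (ν w)| ≤
        ε₃ * (Fintype.card V : ℝ) ^ 3)
    (hreg₂ : ∀ (c : Fin K) (θ : Fin L → Fin L → ℝ), (∀ a b, |θ a b| ≤ 1) →
      ∀ a b : V → ℝ, (∀ x, 0 ≤ a x ∧ a x ≤ 1) → (∀ x, 0 ≤ b x ∧ b x ≤ 1) →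
      |∑ u, ∑ v, ((if κ u v = c then 1 else 0) - p (ν u) (ν v) c) * θ (ν u) (ν v) *
          a u * b v| ≤ ε₂ * (Fintype.card V : ℝ) ^ 2) :
    ∑ u, ∑ v, ∑ w, |tripleDensity H (cellWeight ν (ν u)) (cellWeight ν (ν v))
        (cellWeight ν (ν w)) - cellSum p f (ν u) (ν v) (ν w)| ≤
      (ε₃ + Fintype.card (Pair 3 → Fin K) * (Fintype.card (Pair 3) * ε₂)) *
        (Fintype.card V : ℝ) ^ 3 := by
  classical
  set T : Fin L → Fin L → Fin L → ℝ := fun a b c =>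
    tripleDensity H (cellWeight ν a) (cellWeight ν b) (cellWeight ν c) with hT
  set σ : Fin L → Fin L → Fin L → ℝ := fun a b c =>
    if 0 ≤ T a b c - cellSum p f a b c then 1 else -1 with hσ
  have hσ1 : ∀ a b c, |σ a b c| ≤ 1 := by
    intro a b c
    simp only [hσ]
    split_ifs <;> simp
  have habs : ∀ a b c, |T a b c - cellSum p f a b c| =
      (T a b c - cellSum p f a b c) * σ a b c := by
    intro a b c
    simp only [hσ]
    split_ifs with h
    · rw [abs_of_nonneg h, mul_one]
    · rw [abs_of_neg (not_le.mp h), mul_neg_one]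
  have havg : ∑ u, ∑ v, ∑ w, T (ν u) (ν v) (ν w) * σ (ν u) (ν v) (ν w) =
      ∑ u, ∑ v, ∑ w, edgeInd H u v w * σ (ν u) (ν v) (ν w) := by
    have := sum_fibreAvg_mul (fun x : V × V × V => (ν x.1, ν x.2.1, ν x.2.2))
      (fun x => edgeInd H x.1 x.2.1 x.2.2) (fun z => σ z.1 z.2.1 z.2.2)
    simp only [fibreAvg_cells] at this
    rw [sum_triple, sum_triple] at this
    exact this
  have h3 := hreg₃ σ hσ1
  have h2 := abs_sum_pairs_le κ ν p hp hp1 hε₂ hreg₂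
    (fun χ : Pair 3 → Fin K => f (χ pair01) (χ pair02) (χ pair12)) (fun χ => hf _ _ _)
    (fun z => σ (z 0) (z 1) (z 2)) (fun z => hσ1 _ _ _)
  have h2' : ∑ u : Fin 3 → V, σ (ν (u 0)) (ν (u 1)) (ν (u 2)) *
      (f (κ (u 0) (u 1)) (κ (u 0) (u 2)) (κ (u 1) (u 2)) -
        ∑ χ : Pair 3 → Fin K, (∏ e : Pair 3, p (ν (u e.1.1)) (ν (u e.1.2)) (χ e)) *
          f (χ pair01) (χ pair02) (χ pair12)) =
      ∑ u, ∑ v, ∑ w, σ (ν u) (ν v) (ν w) *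
        (f (κ u v) (κ u w) (κ v w) - cellSum p f (ν u) (ν v) (ν w)) := by
    rw [← sum_fun_fin_three]
    refine Finset.sum_congr rfl fun u _ => ?_
    rw [sum_fun_pair_three (fun i j => p (ν (u i)) (ν (u j)))]
    rfl
  rw [h2'] at h2
  have hmain : ∑ u, ∑ v, ∑ w, |T (ν u) (ν v) (ν w) - cellSum p f (ν u) (ν v) (ν w)| =
      (∑ u, ∑ v, ∑ w, (edgeInd H u v w - f (κ u v) (κ u w) (κ v w)) * σ (ν u) (ν v) (ν w)) +
      ∑ u, ∑ v, ∑ w, σ (ν u) (ν v) (ν w) *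
        (f (κ u v) (κ u w) (κ v w) - cellSum p f (ν u) (ν v) (ν w)) := by
    simp only [habs, sub_mul, mul_sub, Finset.sum_sub_distrib, havg]
    simp only [mul_comm (σ _ _ _)]
    ring
  refine hmain.le.trans ?_
  have := le_abs_self (∑ u, ∑ v, ∑ w, (edgeInd H u v w - f (κ u v) (κ u w) (κ v w)) *
    σ (ν u) (ν v) (ν w))
  have := le_abs_self (∑ u, ∑ v, ∑ w, σ (ν u) (ν v) (ν w) *
        (f (κ u v) (κ u w) (κ v w) - cellSum p f (ν u) (ν v) (ν w)))
  linarith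

theorem exists_dense_cells {d η r : ℝ} (hd : 0 < d) (hd1 : d ≤ 1)
    (hH : H.uniformlyDense d η) (hr : 0 < r) (hη : η ≤ d / 27 * r ^ 3 / 16)
    (hn : 1 ≤ Fintype.card V) (hn' : 176 ≤ d / 27 * r ^ 3 * Fintype.card V)
    {M N R : ℕ} (hN : 12 ≤ d / 27 * N)
    (hR : ∀ S : Finset ℕ, R ≤ S.card → ∀ P : Finset ℕ → Prop,
      (∃ A ⊆ S, A.card = M ∧ ∀ e ⊆ A, e.card = 3 → P e) ∨
      (∃ B ⊆ S, B.card = N ∧ ∀ e ⊆ B, e.card = 3 → ¬ P e))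
    (ν : V → Fin L) (a : Fin R → Fin L) (ha : ∀ i, r * Fintype.card V ≤ cellCard ν (a i)) :
    ∃ J : Fin M → Fin R, StrictMono J ∧ ∀ i j l, i < j → j < l →
      d / 54 ≤ tripleDensity H (cellWeight ν (a (J i))) (cellWeight ν (a (J j)))
        (cellWeight ν (a (J l))) := by
  classical
  have hn0 : (0 : ℝ) < Fintype.card V := Nat.cast_pos.mpr hn
  let μ : ℕ → V → ℝ := fun i v => if h : i < R then cellWeight ν (a ⟨i, h⟩) v else 0
  have hμ : ∀ i (h : i < R), μ i = cellWeight ν (a ⟨i, h⟩) := by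
    intro i h
    funext v
    simp only [μ, dif_pos h]
  have hpos : ∀ i, (0 : ℝ) < cellCard ν (a i) := fun i =>
    lt_of_lt_of_le (mul_pos hr hn0) (ha i)
  obtain ⟨A, hA, hAc, h⟩ := exists_dense_subset H hd hd1 hH hr hη hn hn' hN hR μ
    (fun i hi v => by rw [hμ i hi]; exact cellWeight_nonneg _ _ _)
    (fun i hi => by rw [hμ i hi]; exact sum_cellWeight ν (Nat.cast_pos.mp (hpos _)))
    (fun i hi v => by
      rw [hμ i hi]
      unfold cellWeight
      split_ifs
      · rw [← div_eq_mul_inv]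
        exact div_le_one_of_le₀ (ha _) (hpos _).le
      · rw [mul_zero]
        exact zero_le_one)
  set e := A.orderEmbOfFin hAc with he
  have heA : ∀ i, e i ∈ A := fun i => Finset.orderEmbOfFin_mem _ _ _
  have hlt : ∀ i, e i < R := fun i => Finset.mem_range.mp (hA (heA i))
  refine ⟨fun i => ⟨e i, hlt i⟩, fun i j hij => e.strictMono hij, fun i j l hij hjl => ?_⟩
  have := h (e i) (heA i) (e j) (heA j) (e l) (heA l) (e.strictMono hij) (e.strictMono hjl)
  rwa [hμ _ (hlt i), hμ _ (hlt j), hμ _ (hlt l)] at this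

end

open scoped Classical in
theorem sum_not_injective_le {V : Type} [Fintype V] [Nonempty V] (k : ℕ) :
    ∑ u : Fin k → V, (if Function.Injective u then (0 : ℝ) else 1) ≤
      k ^ 2 * ((Fintype.card V : ℝ) ^ k / Fintype.card V) := by
  have hn : (0 : ℝ) < Fintype.card V := Nat.cast_pos.mpr Fintype.card_pos
  have hpt : ∀ u : Fin k → V, (if Function.Injective u then (0 : ℝ) else 1) ≤
      ∑ i : Fin k, ∑ j : Fin k, if i ≠ j then (if u i = u j then (1 : ℝ) else 0) else 0 := by
    intro u
    have n3 : ∀ i j : Fin k, 0 ≤ if i ≠ j then (if u i = u j then (1 : ℝ) else 0) else 0 :=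
      fun i j => by positivity
    split_ifs with h
    · exact Finset.sum_nonneg fun i _ => Finset.sum_nonneg fun j _ => n3 i j
    · unfold Function.Injective at h
      push Not at h
      obtain ⟨i, j, hij, hne⟩ := h
      have t2 := Finset.single_le_sum (fun j (_ : j ∈ Finset.univ) => n3 i j) (Finset.mem_univ j)
      have t3 := Finset.single_le_sum (fun i (_ : i ∈ Finset.univ) =>
        Finset.sum_nonneg fun j (_ : j ∈ Finset.univ) => n3 i j) (Finset.mem_univ i)
      rw [if_pos hne, if_pos hij] at t2
      exact t2.trans t3
  refine (Finset.sum_le_sum fun u _ => hpt u).trans ?_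
  have hij : ∀ i j : Fin k, ∑ u : Fin k → V,
      (if i ≠ j then (if u i = u j then (1 : ℝ) else 0) else 0) ≤
      (Fintype.card V : ℝ) ^ k / Fintype.card V := by
    intro i j
    by_cases h : i ≠ j
    · simp only [if_pos h]
      have hinj : Function.Injective ![i, j] := by
        intro a b hab
        fin_cases a <;> fin_cases b <;> simp [h, h.symm] at hab ⊢
      have := sum_comp_injective hinj (fun χ : Fin 2 → V => if χ 0 = χ 1 then (1 : ℝ) else 0)
      refine this.le.trans (le_of_eq ?_)
      have h2 : ∑ χ : Fin 2 → V, (if χ 0 = χ 1 then (1 : ℝ) else 0) = Fintype.card V := by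
        refine (Fintype.sum_equiv (finTwoArrowEquiv V) _
          (fun x => if x.1 = x.2 then (1 : ℝ) else 0) (fun χ => rfl)).trans ?_
        rw [Fintype.sum_prod_type]
        simp
      rw [h2, Fintype.card_fin, Fintype.card_fin]
      field_simp
    · simp only [if_neg h, Finset.sum_const_zero]
      positivity
  rw [Finset.sum_comm]
  have hi : ∀ i : Fin k, ∑ u : Fin k → V, ∑ j : Fin k,
      (if i ≠ j then (if u i = u j then (1 : ℝ) else 0) else 0) ≤
      k * ((Fintype.card V : ℝ) ^ k / Fintype.card V) := by
    intro i
    rw [Finset.sum_comm]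
    refine (Finset.sum_le_sum fun j _ => hij i j).trans ?_
    rw [Finset.sum_const, nsmul_eq_mul, Finset.card_univ, Fintype.card_fin]
  refine (Finset.sum_le_sum fun i _ => hi i).trans ?_
  rw [Finset.sum_const, nsmul_eq_mul, Finset.card_univ, Fintype.card_fin, sq, mul_assoc]

/-- The expected value of the product of `f` over the triples of a pattern on given cells. -/
noncomputable def patternSum {k K L : ℕ} (φ : Fin k → Fin k → Fin 3)
    (p : Fin L → Fin L → Fin K → ℝ) (f : Fin K → Fin K → Fin K → ℝ) (z : Fin k → Fin L) : ℝ :=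
  ∑ χ : Pair k → Fin K, (∏ e : Pair k, p (z e.1.1) (z e.1.2) (χ e)) *
    ∏ t : Trip φ, f (χ t.p01) (χ t.p02) (χ t.p12)

section
variable {k K L : ℕ} (φ : Fin k → Fin k → Fin 3)

theorem patternSum_nonneg {p : Fin L → Fin L → Fin K → ℝ} (hp : ∀ a b c, 0 ≤ p a b c)
    {f : Fin K → Fin K → Fin K → ℝ} (hf : ∀ a b c, 0 ≤ f a b c) (z : Fin k → Fin L) :
    0 ≤ patternSum φ p f z :=
  Finset.sum_nonneg fun _ _ => mul_nonneg (Finset.prod_nonneg fun _ _ => hp _ _ _)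
    (Finset.prod_nonneg fun _ _ => hf _ _ _)

/-- If many samples of `R` vertices contain a sample of `k` vertices with a large pattern sum,
then the average pattern sum is large. -/
theorem le_sum_patternSum {V : Type} [Fintype V] [Nonempty V] {R : ℕ} {c₀ : ℝ}
    {p : Fin L → Fin L → Fin K → ℝ} (hp : ∀ a b c, 0 ≤ p a b c)
    {f : Fin K → Fin K → Fin K → ℝ} (hf : ∀ a b c, 0 ≤ f a b c) (ν : V → Fin L)
    (hc₀ : 0 ≤ c₀) (Good : (Fin R → V) → Prop) [DecidablePred Good]
    (hG : (Fintype.card V : ℝ) ^ R / 2 ≤ ∑ u : Fin R → V, if Good u then 1 else 0)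
    (h : ∀ u, Good u → ∃ J : Fin k → Fin R, Function.Injective J ∧
      c₀ ≤ patternSum φ p f fun i => ν (u (J i))) :
    c₀ / (2 * ((R : ℝ) + 1) ^ k) * (Fintype.card V : ℝ) ^ k ≤
      ∑ u : Fin k → V, patternSum φ p f fun i => ν (u i) := by
  classical
  have hn : (0 : ℝ) < Fintype.card V := Nat.cast_pos.mpr Fintype.card_pos
  set S := ∑ u : Fin k → V, patternSum φ p f fun i => ν (u i) with hS
  have hS0 : 0 ≤ S := Finset.sum_nonneg fun u _ => patternSum_nonneg φ hp hf _
  have hpt : ∀ u : Fin R → V, c₀ * (if Good u then 1 else 0) ≤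
      ∑ J : Fin k → Fin R, if Function.Injective J then
        patternSum φ p f (fun i => ν (u (J i))) else 0 := by
    intro u
    have h0 : ∀ J : Fin k → Fin R, 0 ≤ if Function.Injective J then
        patternSum φ p f (fun i => ν (u (J i))) else 0 := by
      intro J
      split_ifs
      · exact patternSum_nonneg φ hp hf _
      · exact le_rfl
    split_ifs with hu
    · obtain ⟨J, hJ, hJc⟩ := h u hu
      refine le_trans ?_ (Finset.single_le_sum (fun J _ => h0 J) (Finset.mem_univ J))
      rw [if_pos hJ, mul_one]
      exact hJc
    · rw [mul_zero]
      exact Finset.sum_nonneg fun J _ => h0 J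
  have htot := Finset.sum_le_sum fun u (_ : u ∈ (Finset.univ : Finset (Fin R → V))) => hpt u
  rw [← Finset.mul_sum, Finset.sum_comm] at htot
  have hJ : ∀ J : Fin k → Fin R, (∑ u : Fin R → V, if Function.Injective J then
        patternSum φ p f (fun i => ν (u (J i))) else 0) ≤
        (Fintype.card V : ℝ) ^ R * (S / (Fintype.card V : ℝ) ^ k) := by
    intro J
    split_ifs with hJ
    · have := sum_comp_injective hJ (fun χ : Fin k → V => patternSum φ p f fun i => ν (χ i))
      rw [this, Fintype.card_fin, Fintype.card_fin]
    · rw [Finset.sum_const_zero]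
      positivity
  have h1 := htot.trans (Finset.sum_le_sum fun J _ => hJ J)
  rw [Finset.sum_const, nsmul_eq_mul, Finset.card_univ, Fintype.card_fun, Fintype.card_fin,
    Fintype.card_fin, Nat.cast_pow] at h1
  have h2 := (mul_le_mul_of_nonneg_left hG hc₀).trans h1
  have h3 : (R : ℝ) ^ k * ((Fintype.card V : ℝ) ^ R * (S / (Fintype.card V : ℝ) ^ k)) ≤
      ((R : ℝ) + 1) ^ k * ((Fintype.card V : ℝ) ^ R * (S / (Fintype.card V : ℝ) ^ k)) := by
    refine mul_le_mul_of_nonneg_right ?_ (by positivity)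
    exact pow_le_pow_left₀ (Nat.cast_nonneg R) (by linarith) k
  have h4 := h2.trans h3
  have hnR : 0 < (Fintype.card V : ℝ) ^ R := by positivity
  have hnk : 0 < (Fintype.card V : ℝ) ^ k := by positivity
  have hRk : 0 < ((R : ℝ) + 1) ^ k := by positivity
  rw [div_mul_eq_mul_div, div_le_iff₀ (by positivity)]
  have h5 : c₀ / 2 ≤ ((R : ℝ) + 1) ^ k * (S / (Fintype.card V : ℝ) ^ k) := by
    refine le_of_mul_le_mul_left ?_ hnR
    linarith
  have h6 := mul_le_mul_of_nonneg_right h5 hnk.le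
  have h7 : ((R : ℝ) + 1) ^ k * (S / (Fintype.card V : ℝ) ^ k) * (Fintype.card V : ℝ) ^ k =
      ((R : ℝ) + 1) ^ k * S := by
    field_simp
  linarith

end

open scoped Classical in
theorem exists_pattern_embedding (k : ℕ) (φ : Fin k → Fin k → Fin 3) {d : ℝ} (hd : 0 < d)
    (hd1 : d ≤ 1) :
    ∃ η : ℝ, 0 < η ∧ ∃ n₀ : ℕ, ∀ (V : Type) [DecidableEq V] [Fintype V],
      n₀ ≤ Fintype.card V → ∀ H : H3 V, H.uniformlyDense d η →
      ∃ u : Fin k → V, Function.Injective u ∧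
        ∀ t : Trip φ, ({u t.1.1, u t.1.2.1, u t.1.2.2} : Finset V) ∈ H.edges := by
  obtain ⟨M, c₀, hc₀, hM⟩ := reduced_count k φ (show 0 < d / 108 by positivity)
  obtain ⟨N, hN⟩ := exists_nat_ge (324 / d)
  have hN' : 12 ≤ d / 27 * N := by
    rw [div_le_iff₀ hd] at hN
    linarith
  obtain ⟨R, hR⟩ := ramsey 3 M N
  set c₂ : ℝ := c₀ / (2 * ((R : ℝ) + 1) ^ k) with hc₂
  have hc₂0 : 0 < c₂ := by positivity
  set β : ℝ := d / 108 / (4 * ((R : ℝ) + 1) ^ 3) with hβ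
  have hβ0 : 0 < β := by positivity
  set ε₃ : ℝ := min (c₂ / (4 * (Fintype.card (Trip φ) + 1))) (β / 2) with hε₃
  have hε₃0 : 0 < ε₃ := by positivity
  let Q : ℕ → ℝ := fun K => Fintype.card (Pair k → Fin K) * Fintype.card (Pair k)
  let Q₃ : ℕ → ℝ := fun K => Fintype.card (Pair 3 → Fin K) * Fintype.card (Pair 3)
  have hQ : ∀ K, 0 ≤ Q K := fun K => by positivity
  have hQ₃ : ∀ K, 0 ≤ Q₃ K := fun K => by positivity
  obtain ⟨ε₂, hε₂⟩ : ∃ ε₂ : ℕ → ℝ, ∀ K, 0 < ε₂ K ∧ Q K * ε₂ K ≤ c₂ / 4 ∧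
      Q₃ K * ε₂ K ≤ β / 2 := by
    refine ⟨fun K => min (c₂ / (4 * (Q K + 1))) (β / (2 * (Q₃ K + 1))), fun K => ⟨?_, ?_, ?_⟩⟩
    · have := hQ K
      have := hQ₃ K
      positivity
    · refine (mul_le_mul_of_nonneg_left (min_le_left _ _) (hQ K)).trans ?_
      rw [← mul_div_assoc, div_le_div_iff₀ (by linarith [hQ K]) (by norm_num)]
      nlinarith [hQ K]
    · refine (mul_le_mul_of_nonneg_left (min_le_right _ _) (hQ₃ K)).trans ?_
      rw [← mul_div_assoc, div_le_div_iff₀ (by linarith [hQ₃ K]) (by norm_num)]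
      nlinarith [hQ₃ K]
  have hB₂ : ∀ K : ℕ, ∃ B : ℕ, 0 < K → ∀ (V : Type) [Fintype V] (κ : V → V → Fin K),
      ∃ L, 0 < L ∧ L ≤ B ∧ ∃ (ν : V → Fin L) (p : Fin L → Fin L → Fin K → ℝ),
      (∀ a b c, 0 ≤ p a b c) ∧ (∀ a b, ∑ c, p a b c = 1) ∧ ∀ (c : Fin K) (θ : Fin L → Fin L → ℝ),
        (∀ a b, |θ a b| ≤ 1) → ∀ a b : V → ℝ, (∀ x, 0 ≤ a x ∧ a x ≤ 1) →
        (∀ x, 0 ≤ b x ∧ b x ≤ 1) →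
        |∑ u, ∑ v, ((if κ u v = c then 1 else 0) - p (ν u) (ν v) c) * θ (ν u) (ν v) *
          a u * b v| ≤ ε₂ K * (Fintype.card V : ℝ) ^ 2 := by
    intro K
    by_cases hK : 0 < K
    · obtain ⟨B, hB⟩ := exists_vertex_coloring K hK (hε₂ K).1
      exact ⟨B, fun _ V _ κ => by convert hB V κ⟩
    · exact ⟨0, fun h => absurd h hK⟩
  choose B₂ hB₂ using hB₂
  obtain ⟨B₃, hB₃⟩ := exists_pair_coloring hε₃0 B₂
  set Λ : ℝ := ((∑ K ∈ Finset.range (B₃ + 1), B₂ K : ℕ) : ℝ) + 1 with hΛ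
  have hΛ0 : 0 < Λ := by positivity
  set r : ℝ := 1 / (4 * ((R : ℝ) + 1) * Λ) with hr
  have hr0 : 0 < r := by positivity
  obtain ⟨n₁, hn₁⟩ := exists_nat_ge (176 / (d / 27 * r ^ 3))
  obtain ⟨n₂, hn₂⟩ := exists_nat_gt (2 * (k : ℝ) ^ 2 / c₂)
  refine ⟨d / 27 * r ^ 3 / 16, by positivity, n₁ + n₂ + 1, fun V _ _ hV H hH => ?_⟩
  have hn : 1 ≤ Fintype.card V := by omega
  have : Nonempty V := Fintype.card_pos_iff.mp (by omega)
  have hn0 : (0 : ℝ) < Fintype.card V := Nat.cast_pos.mpr hn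
  have hV₁ : 176 ≤ d / 27 * r ^ 3 * Fintype.card V := by
    have : (n₁ : ℝ) ≤ Fintype.card V := by exact_mod_cast (by omega : n₁ ≤ Fintype.card V)
    have := hn₁.trans this
    rwa [div_le_iff₀ (by positivity), mul_comm] at this
  have hV₂ : 2 * (k : ℝ) ^ 2 < c₂ * Fintype.card V := by
    have : (n₂ : ℝ) ≤ Fintype.card V := by exact_mod_cast (by omega : n₂ ≤ Fintype.card V)
    have := hn₂.trans_le this
    rwa [div_lt_iff₀ hc₂0, mul_comm (Fintype.card V : ℝ)] at this
  obtain ⟨K, hK, hKB, κ, f, hf, htri, hσ⟩ := hB₃ V (edgeInd H) (edgeInd_mem_unitInterval H)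
  obtain ⟨L, hL, hLB, ν, p, hp, hp1, hpair⟩ := hB₂ K hK V κ
  have hLΛ : (L : ℝ) ≤ Λ := by
    have h1 : B₂ K ≤ ∑ K ∈ Finset.range (B₃ + 1), B₂ K :=
      Finset.single_le_sum (f := B₂) (fun _ _ => Nat.zero_le _)
        (Finset.mem_range.mpr (by omega))
    have : (L : ℝ) ≤ ((∑ K ∈ Finset.range (B₃ + 1), B₂ K : ℕ) : ℝ) := by
      exact_mod_cast hLB.trans h1
    linarith
  have havg := sum_abs_tripleDensity_sub_cellSum_le H κ f hf ν p hp hp1 (hε₂ K).1.le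
    (fun σ hσ1 => hσ L hLB ν σ hσ1) (fun c θ hθ a b ha hb => by convert hpair c θ hθ a b ha hb)
  have hβ2 : ε₃ + Fintype.card (Pair 3 → Fin K) * (Fintype.card (Pair 3) * ε₂ K) ≤ β := by
    have h1 := (hε₂ K).2.2
    have h2 : ε₃ ≤ β / 2 := min_le_right _ _
    simp only [Q₃] at h1
    linarith
  replace havg := havg.trans (mul_le_mul_of_nonneg_right hβ2 (by positivity))
  let b₁ : V → Prop := fun v => (cellCard ν (ν v) : ℝ) < r * Fintype.card V
  let b₃ : V → V → V → Prop := fun u v w => d / 108 < |tripleDensity H (cellWeight ν (ν u))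
    (cellWeight ν (ν v)) (cellWeight ν (ν w)) - cellSum p f (ν u) (ν v) (ν w)|
  have hb₁ : ∑ v, (if b₁ v then (1 : ℝ) else 0) ≤ L * r * Fintype.card V := by
    rw [mul_assoc]
    exact sum_small_cells ν (by positivity)
  have hb₃ : ∑ u, ∑ v, ∑ w, (if b₃ u v w then (1 : ℝ) else 0) ≤
      β / (d / 108) * (Fintype.card V : ℝ) ^ 3 := by
    have : ∀ u v w, (if b₃ u v w then (1 : ℝ) else 0) ≤ (d / 108)⁻¹ *
        |tripleDensity H (cellWeight ν (ν u)) (cellWeight ν (ν v)) (cellWeight ν (ν w)) -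
          cellSum p f (ν u) (ν v) (ν w)| := by
      intro u v w
      split_ifs with hb
      · have h1 := mul_le_mul_of_nonneg_left hb.le (inv_nonneg.mpr (by positivity : 0 ≤ d / 108))
        rwa [inv_mul_cancel₀ (by positivity)] at h1
      · positivity
    refine (Finset.sum_le_sum fun u _ => Finset.sum_le_sum fun v _ =>
      Finset.sum_le_sum fun w _ => this u v w).trans ?_
    simp only [← Finset.mul_sum]
    refine (mul_le_mul_of_nonneg_left havg
      (inv_nonneg.mpr (by positivity : 0 ≤ d / 108))).trans (le_of_eq ?_)
    rw [div_eq_mul_inv β]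
    ring
  have hgood := half_le_good (R := R) b₁ b₃ hb₁ hb₃ (by
      have h1 : (R : ℝ) * (L * r) ≤ ((R : ℝ) + 1) * (Λ * r) := by
        refine mul_le_mul (by linarith) (mul_le_mul_of_nonneg_right hLΛ hr0.le) (by positivity)
          (by positivity)
      refine h1.trans (le_of_eq ?_)
      rw [hr]
      field_simp) (by positivity) (by
      have h1 : (R : ℝ) ^ 3 * (β / (d / 108)) ≤ ((R : ℝ) + 1) ^ 3 * (β / (d / 108)) :=
        mul_le_mul_of_nonneg_right (pow_le_pow_left₀ (Nat.cast_nonneg R) (by linarith) 3)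
          (by positivity)
      refine h1.trans (le_of_eq ?_)
      rw [hβ]
      field_simp)
  have hsum := le_sum_patternSum φ hp (fun a b c => (hf a b c).1) ν hc₀.le _ hgood (by
    rintro u ⟨hu₁, hu₃⟩
    obtain ⟨J, hJ, hdense⟩ := exists_dense_cells H hd hd1 hH hr0 le_rfl hn hV₁ hN' hR ν
      (fun i => ν (u i)) (fun i => not_lt.mp (hu₁ i))
    let z : ℕ → Fin L := fun a => if h : a < M then ν (u (J ⟨a, h⟩)) else ⟨0, hL⟩
    have hz : ∀ a (h : a < M), z a = ν (u (J ⟨a, h⟩)) := fun a h => dif_pos h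
    obtain ⟨I, hI, hIc⟩ := hM (Fin K) (fun a b => p (z a) (z b)) (fun a b c => hp _ _ _)
      (fun a b => hp1 _ _) f (fun a b c => (hf a b c).1) (fun a b c => (hf a b c).2)
      (fun i j l hij hjl hl => by
        have e1 := hdense ⟨i, by omega⟩ ⟨j, by omega⟩ ⟨l, hl⟩ hij hjl
        have e2 := abs_le.mp (not_lt.mp (hu₃ (J ⟨i, by omega⟩) (J ⟨j, by omega⟩) (J ⟨l, hl⟩)
          (hJ hij) (hJ hjl)))
        rw [hz i (by omega), hz j (by omega), hz l hl]
        unfold cellSum at e2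
        linarith [e2.2])
    refine ⟨fun i => J (I i), fun a b hab => hI.injective (hJ.injective hab), hIc.trans (le_of_eq ?_)⟩
    unfold patternSum
    simp only [hz _ (I _).2])
  have h2 := abs_sum_pairs_le κ ν p hp hp1 (hε₂ K).1.le
    (fun c θ hθ a b ha hb => by convert hpair c θ hθ a b ha hb)
    (fun χ : Pair k → Fin K => ∏ t : Trip φ, f (χ t.p01) (χ t.p02) (χ t.p12))
    (fun χ => ⟨Finset.prod_nonneg fun _ _ => (hf _ _ _).1,
      Finset.prod_le_one (fun _ _ => (hf _ _ _).1) fun _ _ => (hf _ _ _).2⟩)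
    (fun _ => 1) (fun _ => by simp)
  have h3 := abs_sum_triples_le φ (edgeInd H) (edgeInd_mem_unitInterval H) κ f hf htri
  simp only [one_mul, Finset.sum_sub_distrib] at h2 h3
  by_contra hcon
  push Not at hcon
  have hup : ∑ u : Fin k → V, ∏ t : Trip φ, edgeInd H (u t.1.1) (u t.1.2.1) (u t.1.2.2) ≤
      ∑ u : Fin k → V, (if Function.Injective u then (0 : ℝ) else 1) := by
    refine Finset.sum_le_sum fun u _ => ?_
    split_ifs with hu
    · obtain ⟨t, ht⟩ := hcon u hu
      refine le_of_eq (Finset.prod_eq_zero (Finset.mem_univ t) ?_)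
      exact if_neg ht
    · exact Finset.prod_le_one (fun _ _ => (edgeInd_mem_unitInterval H _ _ _).1)
        fun _ _ => (edgeInd_mem_unitInterval H _ _ _).2
  have hinj := sum_not_injective_le (V := V) k
  have hnk : 0 < (Fintype.card V : ℝ) ^ k := by positivity
  have hq := (hε₂ K).2.1
  have hk' : (k : ℝ) ^ 2 * ((Fintype.card V : ℝ) ^ k / Fintype.card V) <
      c₂ / 2 * (Fintype.card V : ℝ) ^ k := by
    rw [← mul_div_assoc, div_lt_iff₀ hn0]
    have := mul_lt_mul_of_pos_right hV₂ hnk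
    linarith
  have ht3 : (Fintype.card (Trip φ) : ℝ) * ε₃ ≤ c₂ / 4 := by
    refine (mul_le_mul_of_nonneg_left (min_le_left _ _) (Nat.cast_nonneg _)).trans ?_
    rw [← mul_div_assoc, div_le_div_iff₀ (by positivity) (by norm_num)]
    nlinarith
  have e2 := (abs_le.mp h2).1
  have e3 := (abs_le.mp h3).1
  have m2 := mul_le_mul_of_nonneg_right hq hnk.le
  have m3 := mul_le_mul_of_nonneg_right ht3 hnk.le
  unfold patternSum at hsum
  rw [← hc₂] at hsum
  simp only [Q] at m2
  beta_reduce at hsum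
  have hup' := hup.trans ((le_of_eq (Finset.sum_congr rfl fun u _ => by congr)).trans hinj)
  linarith

/-- A 3-graph whose vertices can be ordered and whose pairs can be coloured so that every edge
`a < b < c` gives the pairs `ab`, `ac`, `bc` the colours `0`, `1`, `2` has vanishing uniform Turán
density. -/
theorem uniformTuranDensity_nonpos_of_pattern {W : Type} [DecidableEq W] [Fintype W] (F : H3 W)
    (key : W → ℕ) (hkey : Function.Injective key) (χ : W → W → Fin 3)
    (h : ∀ e ∈ F.edges, ∃ a b c, e = {a, b, c} ∧ key a < key b ∧ key b < key c ∧
      χ a b = 0 ∧ χ a c = 1 ∧ χ b c = 2) :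
    uniformTuranDensity F ≤ 0 := by
  classical
  refine Real.sSup_nonpos fun d hd => ?_
  obtain ⟨-, hd1, hd2⟩ := hd
  by_contra hd0
  push Not at hd0
  have hM : ∀ w, key w < ∑ w, key w + 1 := fun w =>
    Nat.lt_succ_of_le (Finset.single_le_sum (f := key) (fun _ _ => Nat.zero_le _)
      (Finset.mem_univ w))
  let g : W → Fin (∑ w, key w + 1) := fun w => ⟨key w, hM w⟩
  have hg : Function.Injective g := fun a b hab => hkey (congrArg Fin.val hab)
  let φ : Fin (∑ w, key w + 1) → Fin (∑ w, key w + 1) → Fin 3 := fun i j =>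
    if h : ∃ p : W × W, g p.1 = i ∧ g p.2 = j then χ h.choose.1 h.choose.2 else 0
  have hφ : ∀ a b, φ (g a) (g b) = χ a b := by
    intro a b
    have h : ∃ p : W × W, g p.1 = g a ∧ g p.2 = g b := ⟨(a, b), rfl, rfl⟩
    have h1 := hg h.choose_spec.1
    have h2 := hg h.choose_spec.2
    simp only [φ]
    rw [dif_pos h, h1, h2]
  obtain ⟨η, hη, n₀, hT⟩ := exists_pattern_embedding _ φ hd0 hd1
  obtain ⟨n, hn, H, hfree, hdense⟩ := hd2 η hη n₀
  obtain ⟨u, hu, hut⟩ := hT (Fin n) (by rwa [Fintype.card_fin]) H hdense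
  refine hfree ⟨fun w => u (g w), hu.comp hg, fun e he => ?_⟩
  obtain ⟨a, b, c, rfl, hab, hbc, h0, h1, h2⟩ := h e he
  have := hut ⟨(g a, g b, g c), ⟨hab, hbc⟩, (hφ a b).trans h0, (hφ a c).trans h1, (hφ b c).trans h2⟩
  rw [Finset.image_insert, Finset.image_insert, Finset.image_singleton]
  exact this

/-- The length of the arc from `x` to `x'` on a cycle of length `n`. -/
def arc (n x x' : ℕ) : ℕ := if x ≤ x' then x' - x else x' + n - x

open scoped Classical in
/-- Three cyclically arranged classes of `n` vertices, where two vertices `x`, `x'` of a class form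
an edge with a vertex `y` of the next class if `f · y` tells each of them in which sector of length
`N` it sees the other. -/
noncomputable def sectorGraph {V : Type} [DecidableEq V] [Fintype V] {n : ℕ} (N : ℕ)
    (f : Fin n → Fin n → ℕ) (P : Fin 3 × Fin n ≃ V) : H3 V where
  edges := Finset.univ.filter fun s => ∃ i x x' y, x ≠ x' ∧ f x y = arc n x x' / N ∧
    f x' y = arc n x' x / N ∧ s = {P (i, x), P (i, x'), P (i + 1, y)}
  card3 := by
    intro e he
    obtain ⟨i, x, x', y, hx, -, -, rfl⟩ := (Finset.mem_filter.mp he).2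
    have hi : ∀ i : Fin 3, i ≠ i + 1 := by decide
    refine Finset.card_eq_three.mpr ⟨_, _, _, ?_, ?_, ?_, rfl⟩
    · simpa using hx
    · simp [hi]
    · simp [hi]

/-- The position of `x` on a cycle of length `n` cut open at `s`. -/
def cutPos (n s x : ℕ) : ℕ := if s ≤ x then x - s else x + n - s

theorem arc_add_le_arc {n N s x y z : ℕ} (hs : s ≤ n) (hx : x < n) (hy : y < n)
    (hzN : cutPos n s y + N ≤ n) (hxy : cutPos n s x < cutPos n s y)
    (hzx : cutPos n s z < cutPos n s x) : arc n x y + N ≤ arc n x z := by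
  unfold cutPos arc at *
  split_ifs at * <;> omega

theorem cutPos_inj {n s x y : ℕ} (hs : s ≤ n) (hx : x < n) (hy : y < n)
    (h : cutPos n s x = cutPos n s y) : x = y := by
  unfold cutPos at *
  split_ifs at * <;> omega

theorem cutPos_lt {n s x : ℕ} (hx : x < n) (hs : s ≤ n) : cutPos n s x < n := by
  unfold cutPos at *
  split_ifs at * <;> omega

theorem cutPos_add_le {n N j x : ℕ} (hs : (j + 1) * N ≤ n) (hx : x < n) (hN : 0 < N)
    (hj : x / N ≠ j) : cutPos n ((j + 1) * N) x + N ≤ n := by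
  have h : x < j * N ∨ (j + 1) * N ≤ x := by
    rcases lt_or_gt_of_ne hj with h | h
    · exact Or.inl ((Nat.div_lt_iff_lt_mul hN).mp h)
    · exact Or.inr ((Nat.le_div_iff_mul_le hN).mp h)
  rw [add_one_mul] at *
  unfold cutPos at *
  split_ifs at * <;> omega

open scoped Classical in
theorem sectorGraph_free {V : Type} [DecidableEq V] [Fintype V] {n N q : ℕ} (hn : n = q * N)
    (hN : 0 < N) (f : Fin n → Fin n → ℕ) (P : Fin 3 × Fin n ≃ V)
    {W : Type} [DecidableEq W] [Fintype W] (hW : Fintype.card W < q) (F : H3 W)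
    (hF : 0 < uniformTuranDensity F) : (sectorGraph N f P).free F := by
  rintro ⟨g, hg, hgF⟩
  refine hF.not_ge ?_
  obtain ⟨cl, pos, hP⟩ : ∃ (cl : W → Fin 3) (pos : W → Fin n), ∀ w, g w = P (cl w, pos w) :=
    ⟨fun w => (P.symm (g w)).1, fun w => (P.symm (g w)).2, fun w => by simp⟩
  obtain ⟨j, hjq, hj⟩ : ∃ j < q, ∀ w, (pos w : ℕ) / N ≠ j := by
    have : (Finset.univ.image fun w => (pos w : ℕ) / N).card < (Finset.range q).card := by
      rw [Finset.card_range]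
      exact Finset.card_image_le.trans_lt hW
    obtain ⟨j, hj, hj'⟩ := Finset.exists_mem_notMem_of_card_lt_card this
    exact ⟨j, Finset.mem_range.mp hj, fun w hw =>
      hj' (Finset.mem_image.mpr ⟨w, Finset.mem_univ w, hw⟩)⟩
  have hs : (j + 1) * N ≤ n := by
    rw [hn]
    exact Nat.mul_le_mul_right N hjq
  obtain ⟨c, hc⟩ : ∃ c : W → ℕ, ∀ w, c w = cutPos n ((j + 1) * N) (pos w) := ⟨_, fun _ => rfl⟩
  have hcn : ∀ w, c w < n := fun w => by
    rw [hc]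
    exact cutPos_lt (pos w).2 hs
  have hc_inj : ∀ w w', c w = c w' → pos w = pos w' := fun w w' h => by
    rw [hc, hc] at h
    exact Fin.ext (cutPos_inj hs (pos w).2 (pos w').2 h)
  let far : W → W → Prop := fun x y => ∃ x', cl x' = cl x ∧ c x < c x' ∧
    arc n (pos x) (pos x') / N = f (pos x) (pos y)
  have hfar : ∀ x x' y, cl x = cl x' → c x < c x' →
      f (pos x') (pos y) = arc n (pos x') (pos x) / N → ¬ far x' y := by
    rintro x x' y hcl hlt hf ⟨x'', hcl', hlt', hf'⟩
    rw [hf, hc, hc] at *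
    have := arc_add_le_arc hs (pos x').2 (pos x'').2
      (cutPos_add_le hs (pos x'').2 hN (hj x'')) hlt' hlt
    have h2 := Nat.div_le_div_right (c := N) this
    rw [Nat.add_div_right _ hN] at h2
    omega
  let χ : W → W → Fin 3 := fun a b =>
    if cl a = cl b then (if cl a = 2 then 2 else 0)
    else if cl b = cl a + 1 then (if far a b then 1 else 2)
    else (if far b a then 0 else 1)
  have hlex : ∀ a b, cl a < cl b → (cl a : ℕ) * n + c a < cl b * n + c b := by
    intro a b hab
    have h1 := Nat.mul_le_mul_right n (Nat.succ_le_of_lt (Fin.lt_def.mp hab))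
    rw [Nat.succ_mul] at h1
    have := hcn a
    omega
  have hkey : Function.Injective fun w => (cl w : ℕ) * n + c w := by
    intro a b hab
    replace hab : (cl a : ℕ) * n + c a = cl b * n + c b := hab
    rcases lt_trichotomy (cl a) (cl b) with h | h | h
    · exact absurd hab (hlex a b h).ne
    · rw [h] at hab
      refine hg ?_
      rw [hP, hP, h, hc_inj a b (by omega)]
    · exact absurd hab (hlex b a h).ne'
  refine uniformTuranDensity_nonpos_of_pattern F _ hkey χ fun e he => ?_
  have key : ∀ a b y, c a < c b → cl a = cl b → cl y = cl a + 1 →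
      f (pos a) (pos y) = arc n (pos a) (pos b) / N →
      f (pos b) (pos y) = arc n (pos b) (pos a) / N → e = {a, b, y} →
      ∃ a b z, e = {a, b, z} ∧ (cl a : ℕ) * n + c a < cl b * n + c b ∧
        (cl b : ℕ) * n + c b < cl z * n + c z ∧ χ a b = 0 ∧ χ a z = 1 ∧ χ b z = 2 := by
    intro a b y hlt hab hy hfa hfb he
    have h1 : far a y := ⟨b, hab.symm, hlt, hfa.symm⟩
    have h2 : ¬ far b y := hfar a b y hab hlt hfb
    rcases eq_or_ne (cl a) 2 with h | h
    · have hb : cl b = 2 := hab ▸ h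
      have hy0 : cl y = 0 := by
        rw [hy, h]
        rfl
      have h3 : ∀ b, cl b = 2 → (cl y : ℕ) * n + c y < cl b * n + c b := fun b hb =>
        hlex y b (by rw [hy0, hb]; decide)
      refine ⟨y, a, b, ?_, h3 a h, ?_, ?_, ?_, ?_⟩
      · rw [he]
        ext
        simp
        tauto
      · rw [h, hb]
        omega
      · simp [χ, hy0, h, h1]
      · simp [χ, hy0, hb, h2]
      · simp [χ, h, hb]
    · have hlt1 : cl a < cl y := by
        rw [hy]
        revert h
        generalize cl a = i
        revert i
        decide
      have hlt2 : cl b < cl y := hab ▸ hlt1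
      refine ⟨a, b, y, he, ?_, hlex b y hlt2, ?_, ?_, ?_⟩
      · rw [hab]
        omega
      · simp [χ, ← hab, h]
      · simp only [χ]
        rw [if_neg hlt1.ne, if_pos hy, if_pos h1]
      · simp only [χ]
        rw [if_neg hlt2.ne, if_pos (hab ▸ hy), if_neg h2]
  obtain ⟨i, x, x', y, hx, hf, hf', hs'⟩ := (Finset.mem_filter.mp (hgF e he)).2
  have hex : ∀ v ∈ e.image g, ∃ w ∈ e, g w = v := fun v hv => Finset.mem_image.mp hv
  obtain ⟨a, -, ha⟩ := hex (P (i, x)) (by rw [hs']; simp)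
  obtain ⟨b, -, hb⟩ := hex (P (i, x')) (by rw [hs']; simp)
  obtain ⟨z, -, hz⟩ := hex (P (i + 1, y)) (by rw [hs']; simp)
  have he' : e = {a, b, z} := by
    refine Finset.image_injective hg ?_
    rw [hs', Finset.image_insert, Finset.image_insert, Finset.image_singleton, ha, hb, hz]
  rw [hP, P.apply_eq_iff_eq, Prod.mk.injEq] at ha hb hz
  obtain ⟨rfl, rfl⟩ := ha
  obtain ⟨hb, rfl⟩ := hb
  obtain ⟨hz, rfl⟩ := hz
  rcases lt_trichotomy (c a) (c b) with h | h | h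
  · exact key a b z h hb.symm hz hf hf' he'
  · exact absurd (hc_inj a b h) hx
  · exact key b a z h hb (hb ▸ hz) hf' hf (by rw [he', Finset.insert_comm])

theorem arc_lt {n x x' : ℕ} (hx : x < n) (hx' : x' < n) : arc n x x' < n := by
  unfold arc
  split_ifs <;> omega

theorem fin_three_ne_add_one (i : Fin 3) : i ≠ i + 1 := by
  revert i
  decide

theorem codeg_comm {V : Type} [DecidableEq V] (H : H3 V) (u v : V) :
    H.codeg u v = H.codeg v u := by
  unfold H3.codeg
  simp only [and_comm]

theorem le_minCodeg {V : Type} [DecidableEq V] [Fintype V] [Nontrivial V] (H : H3 V) {D : ℕ}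
    (h : ∀ u v, u ≠ v → D ≤ H.codeg u v) : D ≤ H.minCodeg := by
  obtain ⟨u, v, huv⟩ := exists_pair_ne V
  refine le_csInf ⟨_, u, v, huv, rfl⟩ ?_
  rintro _ ⟨u, v, huv, rfl⟩
  exact h u v huv

theorem le_sectorGraph_codeg {V : Type} [DecidableEq V] [Fintype V] {n N q D : ℕ}
    (hn : n = q * N) (f : Fin n → Fin n → ℕ) (P : Fin 3 × Fin n ≃ V)
    (h1 : ∀ x x', x ≠ x' → ∀ a < q, ∀ b < q,
      D ≤ (Finset.univ.filter fun y => f x y = a ∧ f x' y = b).card)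
    (h2 : ∀ x y, D ≤ (Finset.univ.filter fun x' : Fin n => x ≠ x' ∧ f x y = arc n x x' / N ∧
      f x' y = arc n x' x / N).card) (u v : V) (huv : u ≠ v) :
    D ≤ (sectorGraph N f P).codeg u v := by
  have hq : ∀ x x' : Fin n, arc n x x' / N < q := fun x x' =>
    Nat.div_lt_of_lt_mul ((arc_lt x.2 x'.2).trans_eq (by rw [hn, mul_comm]))
  have same : ∀ i x x', x ≠ x' → D ≤ (sectorGraph N f P).codeg (P (i, x)) (P (i, x')) := by
    intro i x x' hx
    refine (h1 x x' hx _ (hq x x') _ (hq x' x)).trans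
      (Finset.card_le_card_of_injOn (fun y => {P (i, x), P (i, x'), P (i + 1, y)}) ?_ ?_)
    · intro y hy
      have hy := (Finset.mem_filter.mp hy).2
      refine Finset.mem_filter.mpr ⟨Finset.mem_filter.mpr ⟨Finset.mem_univ _,
        i, x, x', y, hx, hy.1, hy.2, rfl⟩, ?_, ?_⟩ <;> simp
    · intro y _ y' _ hyy
      have : P (i + 1, y) ∈ ({P (i, x), P (i, x'), P (i + 1, y')} : Finset V) := by
        beta_reduce at hyy
        rw [← hyy]
        simp
      simpa [(fin_three_ne_add_one i).symm] using this
  have next : ∀ i x y, D ≤ (sectorGraph N f P).codeg (P (i, x)) (P (i + 1, y)) := by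
    intro i x y
    refine (h2 x y).trans
      (Finset.card_le_card_of_injOn (fun x' => {P (i, x), P (i, x'), P (i + 1, y)}) ?_ ?_)
    · intro x' hx'
      have hx' := (Finset.mem_filter.mp hx').2
      refine Finset.mem_filter.mpr ⟨Finset.mem_filter.mpr ⟨Finset.mem_univ _,
        i, x, x', y, hx'.1, hx'.2.1, hx'.2.2, rfl⟩, ?_, ?_⟩ <;> simp
    · intro x' hx' x'' _ hxx
      have hne := (Finset.mem_filter.mp hx').2.1
      have : P (i, x') ∈ ({P (i, x), P (i, x''), P (i + 1, y)} : Finset V) := by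
        beta_reduce at hxx
        rw [← hxx]
        simp
      simpa [fin_three_ne_add_one i, hne.symm] using this
  obtain ⟨⟨i, x⟩, rfl⟩ := P.surjective u
  obtain ⟨⟨j, y⟩, rfl⟩ := P.surjective v
  have hij : i = j ∨ j = i + 1 ∨ i = j + 1 := by
    clear huv
    revert i j
    decide
  rcases hij with rfl | rfl | rfl
  · exact same i x y fun h => huv (by rw [h])
  · exact next i x y
  · rw [codeg_comm]
    exact next j y x

/-- A point of `(ℤ/q)^(m+4)`, with three distinguished coordinates split off. -/
abbrev Coord (q m : ℕ) := (Fin (m + 1) → ZMod q) × (ZMod q × ZMod q × ZMod q)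

/-- The colouring of pairs of points of `(ℤ/q)^(m+4)` used to colour pairs of vertices. -/
def coordColor {q m : ℕ} (x y : Coord q m) : ZMod q :=
  y.2.1 + ∑ i, x.1 i * y.1 i + x.2.2.1 * y.2.2.1 + x.2.2.2 * y.2.2.2 +
    x.2.1 * y.2.2.1 * y.2.2.2 + x.2.2.1 * x.2.2.2

section
variable {q m : ℕ} [Fact q.Prime]

theorem exists_coordColor_eq (h : Fin (m + 1) → ZMod q) (y : Coord q m) (c : ZMod q) :
    ∃ z, coordColor (h, z) y = c := by
  refine ⟨(0, 1 - y.2.2.2, c - y.2.1 - ∑ i, h i * y.1 i + y.2.2.1 * y.2.2.2 - y.2.2.1), ?_⟩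
  unfold coordColor
  ring

theorem exists_bilinear_eq {K : Type} [Field K] {α β γ : K} (h : α ≠ 0 ∨ β ≠ 0 ∨ γ ≠ 0) (c : K) :
    ∃ s t, α * s + β * t + γ * s * t = c := by
  by_cases hγ : γ = 0
  · subst hγ
    by_cases hα : α = 0
    · have hβ : β ≠ 0 := by simpa [hα] using h
      exact ⟨0, c / β, by field_simp; ring⟩
    · exact ⟨c / α, 0, by field_simp; ring⟩
  · exact ⟨1 - β / γ, c / γ + α * β / γ ^ 2 - α / γ, by field_simp; ring⟩

theorem card_coordColor_eq {x x' : Coord q m} (hx : x ≠ x') (a b : ZMod q) :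
    q ^ m ≤ (Finset.univ.filter fun y => coordColor x y = a ∧ coordColor x' y = b).card := by
  classical
  have hq : 0 < q := (Fact.out : q.Prime).pos
  suffices h : ∃ g : Coord q m → {y // coordColor x y = a ∧ coordColor x' y = b} ×
      (ZMod q × ZMod q × ZMod q × ZMod q), Function.Injective g by
    obtain ⟨g, hg⟩ := h
    have := Fintype.card_le_of_injective g hg
    simp only [Fintype.card_prod, Fintype.card_fun, ZMod.card, Fintype.card_fin,
      Fintype.card_subtype] at this
    refine Nat.le_of_mul_le_mul_right (this.trans' (le_of_eq ?_))
      (by positivity : 0 < q * (q * (q * q)))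
    ring
  by_cases h : x.1 = x'.1
  · have h' : x.2.2.1 - x'.2.2.1 ≠ 0 ∨ x.2.2.2 - x'.2.2.2 ≠ 0 ∨ x.2.1 - x'.2.1 ≠ 0 := by
      by_contra! hcon
      simp only [sub_eq_zero] at hcon
      exact hx (Prod.ext h (Prod.ext hcon.2.2 (Prod.ext hcon.1 hcon.2.1)))
    obtain ⟨s, t, hst⟩ := exists_bilinear_eq h'
      (a - b - x.2.2.1 * x.2.2.2 + x'.2.2.1 * x'.2.2.2)
    refine ⟨fun y => (⟨(y.1, a - ∑ i, x.1 i * y.1 i - x.2.2.1 * s - x.2.2.2 * t -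
      x.2.1 * s * t - x.2.2.1 * x.2.2.2, s, t), ?_, ?_⟩, 0, y.2), fun y y' hyy => ?_⟩
    · unfold coordColor
      ring
    · unfold coordColor
      simp only [h]
      linear_combination -hst
    · simp only [Prod.mk.injEq, Subtype.mk.injEq, true_and] at hyy
      exact Prod.ext hyy.1.1 hyy.2
  · obtain ⟨i, hi⟩ := Function.ne_iff.mp h
    have hi' : x.1 i - x'.1 i ≠ 0 := sub_ne_zero.mpr hi
    have hsum : ∀ (w : Coord q m) (y : Fin (m + 1) → ZMod q) (s : ZMod q),
        ∑ j, w.1 j * Function.update y i s j = ∑ j, w.1 j * y j + w.1 i * (s - y i) := by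
      intro w y s
      have : ∀ j, w.1 j * Function.update y i s j =
          w.1 j * y j + if j = i then w.1 i * (s - y i) else 0 := by
        intro j
        rcases eq_or_ne j i with rfl | hj
        · simp
          ring
        · simp [hj]
      simp only [this, Finset.sum_add_distrib, Finset.sum_ite_eq', Finset.mem_univ, if_true]
    let ρ : Coord q m → Coord q m → ZMod q := fun w y => ∑ j, w.1 j * y.1 j - w.1 i * y.1 i +
      w.2.2.1 * y.2.2.1 + w.2.2.2 * y.2.2.2 + w.2.1 * y.2.2.1 * y.2.2.2 + w.2.2.1 * w.2.2.2
    have hρ : ∀ w y s c, coordColor w (Function.update y.1 i s, (c, y.2.2)) =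
        c + w.1 i * s + ρ w y := by
      intro w y s c
      simp only [coordColor, ρ, hsum]
      ring
    let σ : Coord q m → ZMod q := fun y => ((a - ρ x y) - (b - ρ x' y)) / (x.1 i - x'.1 i)
    have hσ : ∀ y, x.1 i * σ y - x'.1 i * σ y = (a - ρ x y) - (b - ρ x' y) := by
      intro y
      rw [← sub_mul]
      exact mul_div_cancel₀ _ hi'
    refine ⟨fun y => (⟨(Function.update y.1 i (σ y), (a - x.1 i * σ y - ρ x y, y.2.2)), ?_, ?_⟩,
      y.1 i, y.2), fun y y' hyy => ?_⟩
    · rw [hρ]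
      ring
    · rw [hρ]
      linear_combination -hσ y
    · simp only [Prod.mk.injEq, Subtype.mk.injEq] at hyy
      refine Prod.ext (funext fun j => ?_) hyy.2.2
      rcases eq_or_ne j i with rfl | hj
      · exact hyy.2.1
      · have := congrFun hyy.1.1 j
        rwa [Function.update_of_ne hj, Function.update_of_ne hj] at this

end

theorem arc_div_eq {n N q x v w a : ℕ} (hn : n = q * N) (hx : x < n) (hv : v < n) (ha : a < q)
    (hw : w = v ∨ w = v + n) (h1 : x + a * N < w) (h2 : w < x + (a + 1) * N) :
    x ≠ v ∧ arc n x v / N = a ∧ arc n v x / N = q - 1 - a := by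
  obtain ⟨b, rfl⟩ : ∃ b, q = a + 1 + b := ⟨q - (a + 1), by omega⟩
  have hb : a + 1 + b - 1 - a = b := by omega
  have e1 : (a + 1) * N = a * N + N := by ring
  have e2 : (a + 1 + b) * N = a * N + N + b * N := by ring
  have e3 : (b + 1) * N = b * N + N := by ring
  rw [e1] at h2
  rw [e2] at hn
  rw [hb]
  refine ⟨by omega, Nat.div_eq_of_lt_le ?_ (e1 ▸ ?_), Nat.div_eq_of_lt_le ?_ (e3 ▸ ?_)⟩ <;>
  · unfold arc
    split_ifs <;> omega

/-- The blocks of length `B` inside the sector number `a` seen from `x`. -/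
theorem block_subset_sector {B M Q q x a j T t : ℕ} (hB : 0 < B) (hM : M = q * Q)
    (hx : x < M * B) (ha : a < q) (hj : j + 2 ≤ Q) (hT : T = (x + a * (Q * B)) / B + 1 + j)
    (ht : t = if T < M then T else T - M) :
    t < M ∧ ∀ v, t * B ≤ v → v < (t + 1) * B →
      x ≠ v ∧ arc (M * B) x v / (Q * B) = a ∧ arc (M * B) v x / (Q * B) = q - 1 - a := by
  have hn : M * B = q * (Q * B) := by rw [hM, mul_assoc]
  have haN : (a + 1) * (Q * B) ≤ M * B := hn ▸ Nat.mul_le_mul_right _ ha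
  have h1 := Nat.div_mul_le_self (x + a * (Q * B)) B
  have h2 := Nat.lt_div_mul_add hB (a := x + a * (Q * B))
  have h3 := Nat.mul_le_mul_right B hj
  have h4 : x + a * (Q * B) < T * B := by
    rw [hT, add_mul, add_mul]
    omega
  have h5 : (T + 1) * B ≤ x + (a + 1) * (Q * B) := by
    have e1 : (T + 1) * B = (x + a * (Q * B)) / B * B + (j + 2) * B := by
      rw [hT]
      ring
    rw [e1, add_one_mul a]
    omega
  have hTM : T < 2 * M := by
    have : T * B < 2 * M * B := by
      rw [add_one_mul] at h5
      rw [mul_assoc]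
      omega
    exact lt_of_mul_lt_mul_right this (Nat.zero_le _)
  have htM : t < M := by
    rw [ht]
    split_ifs <;> omega
  refine ⟨htM, fun v hv1 hv2 => ?_⟩
  have hv : v < M * B := hv2.trans_le (Nat.mul_le_mul_right B htM)
  by_cases hTlt : T < M
  · rw [if_pos hTlt] at ht
    rw [ht] at hv1 hv2
    exact arc_div_eq hn hx hv ha (Or.inl rfl) (by omega) (by omega)
  · rw [if_neg hTlt] at ht
    have e : T = t + M := by omega
    have e1 : T * B = t * B + M * B := by rw [e, add_mul]
    rw [add_one_mul] at h5 hv2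
    exact arc_div_eq hn hx hv ha (Or.inr rfl) (by omega) (by omega)

section
variable {q m : ℕ} [Fact q.Prime]

theorem exists_coord_equiv (q m : ℕ) [Fact q.Prime] :
    ∃ (e : Coord q m ≃ Fin (q ^ (m + 1) * q ^ 3)) (b : (Fin (m + 1) → ZMod q) ≃ Fin (q ^ (m + 1))),
      ∀ h z, (b h : ℕ) * q ^ 3 ≤ e (h, z) ∧ (e (h, z) : ℕ) < (b h + 1) * q ^ 3 := by
  have b : (Fin (m + 1) → ZMod q) ≃ Fin (q ^ (m + 1)) :=
    Fintype.equivFinOfCardEq (by simp [ZMod.card])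
  have l : ZMod q × ZMod q × ZMod q ≃ Fin (q ^ 3) :=
    Fintype.equivFinOfCardEq (by
      simp only [Fintype.card_prod, ZMod.card]
      ring)
  refine ⟨(Equiv.prodCongr b l).trans finProdFinEquiv, b, fun h z => ?_⟩
  have hz := (l z).2
  have : (((Equiv.prodCongr b l).trans finProdFinEquiv (h, z) : Fin _) : ℕ) =
      l z + q ^ 3 * b h := rfl
  rw [this, add_one_mul, mul_comm (q ^ 3)]
  omega

theorem le_card_sector (e : Coord q m ≃ Fin (q ^ (m + 1) * q ^ 3))
    (b : (Fin (m + 1) → ZMod q) ≃ Fin (q ^ (m + 1)))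
    (hb : ∀ h z, (b h : ℕ) * q ^ 3 ≤ e (h, z) ∧ (e (h, z) : ℕ) < (b h + 1) * q ^ 3)
    (x y : Fin (q ^ (m + 1) * q ^ 3)) :
    q ^ m - 1 ≤ (Finset.univ.filter fun x' : Fin (q ^ (m + 1) * q ^ 3) => x ≠ x' ∧
      (coordColor (e.symm x) (e.symm y)).val =
        arc (q ^ (m + 1) * q ^ 3) x x' / (q ^ m * q ^ 3) ∧
      (coordColor (e.symm x') (e.symm y)).val =
        arc (q ^ (m + 1) * q ^ 3) x' x / (q ^ m * q ^ 3)).card := by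
  have hq : 0 < q := (Fact.out : q.Prime).pos
  obtain ⟨a, ha⟩ : ∃ a, a = (coordColor (e.symm x) (e.symm y)).val := ⟨_, rfl⟩
  have haq : a < q := ha ▸ ZMod.val_lt _
  choose z hz using fun h => exists_coordColor_eq h (e.symm y) ((q - 1 - a : ℕ) : ZMod q)
  obtain ⟨T, hT⟩ : ∃ T : ℕ → ℕ, ∀ j, T j =
      (x + a * (q ^ m * q ^ 3)) / q ^ 3 + 1 + j := ⟨_, fun _ => rfl⟩
  obtain ⟨t, ht⟩ : ∃ t : ℕ → ℕ, ∀ j, t j =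
      if T j < q ^ (m + 1) then T j else T j - q ^ (m + 1) := ⟨_, fun _ => rfl⟩
  have hM : q ^ (m + 1) = q * q ^ m := pow_succ' q m
  have hblock : ∀ j : Fin (q ^ m - 1), _ := fun j =>
    block_subset_sector (pow_pos hq 3) hM x.2 haq (by omega) (hT j) (ht j)
  have hle : q ^ m ≤ q ^ (m + 1) := Nat.pow_le_pow_right hq (Nat.le_succ m)
  let g : Fin (q ^ m - 1) → (Fin (m + 1) → ZMod q) := fun j => b.symm ⟨t j, (hblock j).1⟩
  have hbg : ∀ j, (b (g j) : ℕ) = t j := fun j => by simp [g]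
  have hg : Function.Injective g := by
    intro j j' hjj
    have h1 : t j = t j' := by rw [← hbg, ← hbg, hjj]
    rw [ht, ht, hT, hT] at h1
    have := j.2
    have := j'.2
    refine Fin.ext ?_
    split_ifs at h1 <;> omega
  have hcard := Finset.card_fin (q ^ m - 1)
  rw [← hcard]
  refine Finset.card_le_card_of_injOn (fun j => e (g j, z (g j))) (fun j _ => ?_) ?_
  · obtain ⟨h1, h2, h3⟩ := (hblock j).2 (e (g j, z (g j))) (hbg j ▸ (hb _ _).1)
      (hbg j ▸ (hb _ _).2)
    refine Finset.mem_filter.mpr ⟨Finset.mem_univ _, fun h => h1 (congrArg Fin.val h), ?_, ?_⟩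
    · rw [h2, ha]
    · rw [h3, e.symm_apply_apply, hz, ZMod.val_natCast_of_lt (by omega)]
  · intro j _ j' _ hjj
    exact hg (congrArg Prod.fst (e.injective hjj))

end

theorem exists_codegree_construction (q m : ℕ) [Fact q.Prime] :
    ∃ H : H3 (Fin (3 * (q ^ (m + 1) * q ^ 3))), q ^ m - 1 ≤ H.minCodeg ∧
      ∀ (W : Type) [DecidableEq W] [Fintype W], Fintype.card W < q →
        ∀ F : H3 W, 0 < uniformTuranDensity F → H.free F := by
  have hq : 0 < q := (Fact.out : q.Prime).pos
  obtain ⟨e, b, hb⟩ := exists_coord_equiv q m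
  have hn : q ^ (m + 1) * q ^ 3 = q * (q ^ m * q ^ 3) := by ring
  have hpos : 0 < q ^ (m + 1) * q ^ 3 := by positivity
  have : Nontrivial (Fin (3 * (q ^ (m + 1) * q ^ 3))) :=
    Fin.nontrivial_iff_two_le.mpr (by omega)
  refine ⟨sectorGraph (q ^ m * q ^ 3) (fun x y => (coordColor (e.symm x) (e.symm y)).val)
    finProdFinEquiv, le_minCodeg _ (le_sectorGraph_codeg hn _ _ ?_ ?_), ?_⟩
  · intro x x' hx a ha c hc
    have hx' : e.symm x ≠ e.symm x' := fun h => hx (e.symm.injective h)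
    refine (Nat.sub_le _ _).trans ((card_coordColor_eq hx' (a : ZMod q) c).trans ?_)
    refine Finset.card_le_card_of_injOn e (fun y hy => ?_) e.injective.injOn
    obtain ⟨h1, h2⟩ := (Finset.mem_filter.mp hy).2
    refine Finset.mem_filter.mpr ⟨Finset.mem_univ _, ?_, ?_⟩
    · rw [e.symm_apply_apply, h1, ZMod.val_natCast_of_lt ha]
    · rw [e.symm_apply_apply, h2, ZMod.val_natCast_of_lt hc]
  · exact le_card_sector e b hb
  · intro W _ _ hW F hF
    exact sectorGraph_free hn (by positivity) _ _ hW F hF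

theorem exists_large_minCodeg (k : ℕ) : ∃ ε : ℝ, 0 < ε ∧ ∀ N : ℕ, ∃ n, N ≤ n ∧
    ∃ H : H3 (Fin (3 * n)), ε * n ≤ (H.minCodeg : ℝ) ∧
      (∀ (W : Type) [DecidableEq W] [Fintype W], Fintype.card W ≤ k →
        ∀ F : H3 W, 0 < uniformTuranDensity F → H.free F) := by
  obtain ⟨q, hkq, hq⟩ := Nat.exists_infinite_primes (k + 1)
  have : Fact q.Prime := ⟨hq⟩
  have hq0 : (0 : ℝ) < q := Nat.cast_pos.mpr hq.pos
  refine ⟨1 / (2 * (q : ℝ) ^ 4), by positivity, fun N => ?_⟩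
  obtain ⟨H, hH, hfree⟩ := exists_codegree_construction q (N + 1)
  have h2 : N + 2 ≤ q ^ (N + 1) := (Nat.lt_pow_self hq.one_lt : N + 1 < q ^ (N + 1))
  refine ⟨_, ?_, H, ?_, fun W _ _ hW => hfree W (by omega)⟩
  · have h3 : q ^ (N + 1) ≤ q ^ (N + 1 + 1) * q ^ 3 := by
      rw [pow_succ q (N + 1), mul_assoc]
      exact Nat.le_mul_of_pos_right _ (Nat.mul_pos hq.pos (pow_pos hq.pos 3))
    omega
  · have h4 : ((q ^ (N + 1) : ℕ) : ℝ) ≤ 2 * H.minCodeg := by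
      exact_mod_cast (by omega : q ^ (N + 1) ≤ 2 * H.minCodeg)
    refine le_trans (le_of_eq ?_) ((div_le_iff₀' two_pos).mpr h4)
    push_cast
    field_simp
    ring

theorem codeg_le {V : Type} [DecidableEq V] [Fintype V] (H : H3 V) {u v : V} (huv : u ≠ v) :
    H.codeg u v ≤ Fintype.card V := by
  classical
  have : H.edges.filter (fun e => u ∈ e ∧ v ∈ e) ⊆
      Finset.univ.image fun w : V => ({u, v, w} : Finset V) := by
    intro e he
    obtain ⟨he, hu, hv⟩ := Finset.mem_filter.mp he
    have h1 : ((e.erase u).erase v).card = 1 := by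
      rw [Finset.card_erase_of_mem (Finset.mem_erase.mpr ⟨huv.symm, hv⟩),
        Finset.card_erase_of_mem hu, H.card3 e he]
    obtain ⟨w, hw⟩ := Finset.card_eq_one.mp h1
    refine Finset.mem_image.mpr ⟨w, Finset.mem_univ w, ?_⟩
    rw [← hw, Finset.insert_erase (Finset.mem_erase.mpr ⟨huv.symm, hv⟩), Finset.insert_erase hu]
  exact (Finset.card_le_card this).trans Finset.card_image_le

theorem minCodeg_le {V : Type} [DecidableEq V] [Fintype V] (H : H3 V) :
    H.minCodeg ≤ Fintype.card V := by
  by_cases h : ∃ u v : V, u ≠ v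
  · obtain ⟨u, v, huv⟩ := h
    have h1 : H.minCodeg ≤ H.codeg u v := Nat.sInf_le ⟨u, v, huv, rfl⟩
    exact h1.trans (codeg_le H huv)
  · have : {d | ∃ u v : V, u ≠ v ∧ H.codeg u v = d} = ∅ := by
      ext d
      simp only [Set.mem_ofPred_eq, Set.mem_empty_iff_false, iff_false]
      rintro ⟨u, v, huv, -⟩
      exact h ⟨u, v, huv⟩
    unfold H3.minCodeg
    rw [this, Nat.sInf_empty]
    exact Nat.zero_le _

theorem bddAbove_minCodeg {W : Type} [DecidableEq W] (n : ℕ) (F : H3 W) :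
    BddAbove {d | ∃ H : H3 (Fin n), H.free F ∧ H.minCodeg = d} := by
  refine ⟨n, ?_⟩
  rintro _ ⟨H, -, rfl⟩
  exact (minCodeg_le H).trans_eq (Fintype.card_fin n)

theorem exCodeg_le {W : Type} [DecidableEq W] (n : ℕ) (F : H3 W) : exCodeg n F ≤ n := by
  refine csSup_le' ?_
  rintro _ ⟨H, -, rfl⟩
  exact (minCodeg_le H).trans_eq (Fintype.card_fin n)

theorem codegTuranDensity_pos {W : Type} [DecidableEq W] [Fintype W] (F : H3 W)
    (hF : 0 < uniformTuranDensity F) : 0 < codegTuranDensity F := by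
  obtain ⟨ε, hε, h⟩ := exists_large_minCodeg (Fintype.card W)
  refine (by positivity : 0 < ε / 3).trans_le (le_limsup_of_frequently_le ?_ ?_)
  · refine frequently_atTop.mpr fun N => ?_
    obtain ⟨n, hn, H, hH, hfree⟩ := h (N + 1)
    refine ⟨3 * n, by omega, ?_⟩
    have h1 : H.minCodeg ≤ exCodeg (3 * n) F :=
      le_csSup (bddAbove_minCodeg _ F) ⟨H, hfree W le_rfl F hF, rfl⟩
    have h2 : (H.minCodeg : ℝ) ≤ exCodeg (3 * n) F := Nat.cast_le.mpr h1
    have hn0 : (0 : ℝ) < n := Nat.cast_pos.mpr (by omega)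
    push_cast
    rw [le_div_iff₀ (by positivity)]
    linarith
  · refine isBoundedUnder_of ⟨1, fun n => ?_⟩
    exact div_le_one_of_le₀ (Nat.cast_le.mpr (exCodeg_le n F)) (Nat.cast_nonneg n)

end UniformTuran

/-- For every `k ≥ 1` there is `ε > 0` such that for infinitely many `n` there
is a 3-graph `H` on `3n` vertices with minimum codegree at least `ε n`
containing no copy of any 3-graph `F` with at most `k` vertices and
`π_⋅(F) > 0`. Consequently, every 3-graph `F` with `π_⋅(F) > 0` has
`π_co(F) > 0`. -/
theorem stmt9 :
    (∀ k : ℕ, 0 < k → ∃ ε : ℝ, 0 < ε ∧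
      ∀ N : ℕ, ∃ n, N ≤ n ∧
        ∃ H : H3 (Fin (3 * n)),
          ε * n ≤ (H.minCodeg : ℝ) ∧
          (∀ (W : Type) [DecidableEq W] [Fintype W], Fintype.card W ≤ k →
            ∀ F : H3 W, 0 < uniformTuranDensity F → H.free F)) ∧
    (∀ (W : Type) [DecidableEq W] [Fintype W] (F : H3 W),
      0 < uniformTuranDensity F → 0 < codegTuranDensity F) := by
  exact ⟨fun k _ => UniformTuran.exists_large_minCodeg k,
    fun _ _ _ F hF => UniformTuran.codegTuranDensity_pos F hF⟩
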